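/- arXiv:0902.4895 — 2 statements merged into one kernel-verified Lean document; each statement's English description precedes it below -/
import Mathlib

section
/- Let k ≥ 1 be an integer, let p(x) = α_k x^k + ... + α_1 x be a real polynomial of degree k with α_k > 0, let 0 < δ < 1/2, and let r be a C^k function on [1, ∞) such that |r^{(j)}(x)| ≤ C_j x^{δ−j} for all x ≥ 1 and 0 ≤ j ≤ k, for some constants C_j. Put f = p + r, and suppose in addition that for every positive integer q the sequence of fractional parts ({ f(n)/q })_{n∈ℕ} is dense in [0, 1). Then the sequence (⌊f(n)⌋)_{n∈ℕ} is an asymptotic basis. -/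
open Finset

section

/-- Gaussian moments. -/
def gmom : ℕ → ℚ
  | 0 => 1
  | 1 => 0
  | (j + 2) => (j + 1) * gmom j

lemma gmom_odd (i : ℕ) : gmom (2 * i + 1) = 0 := by
  induction i with
  | zero => rfl
  | succ i ih => 
    have : 2 * (i + 1) + 1 = (2 * i + 1) + 2 := by ring
    rw [this, gmom, ih, mul_zero]

lemma gmom_even (i : ℕ) : gmom (2 * i) * (2 ^ i * (i.factorial : ℚ)) = ((2 * i).factorial : ℚ) := by
  induction i with
  | zero => simp [gmom]
  | succ i ih => 
    have : 2 * (i + 1) = (2 * i) + 2 := by ring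
    rw [this, gmom, Nat.factorial_succ, Nat.factorial_succ (2*i+1), Nat.factorial_succ]
    push_cast
    rw [← ih]; ring

lemma sum_range_two_mul_add_one (g : ℕ → ℝ) (i : ℕ) (h : ∀ b, g (2 * b + 1) = 0) :
    ∑ a ∈ range (2 * i + 1), g a = ∑ b ∈ range (i + 1), g (2 * b) := by
  induction i with
  | zero => simp
  | succ i ih =>
    rw [show 2 * (i + 1) + 1 = (2 * i + 1) + 1 + 1 by ring, sum_range_succ, sum_range_succ, ih, h,
      sum_range_succ _ (i+1)]
    rw [show 2 * (i+1) = 2 * i + 1 + 1 by ring]; ring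

/-- Moments of the Gaussian of variance `s`. -/
noncomputable def gM (j : ℕ) (s : ℝ) : ℝ := (gmom j : ℝ) * s ^ (j / 2)

lemma gM_odd (i : ℕ) (s : ℝ) : gM (2 * i + 1) s = 0 := by simp [gM, gmom_odd]

lemma gM_conv (j : ℕ) (s s' : ℝ) :
    ∑ a ∈ range (j + 1), (j.choose a : ℝ) * gM a s * gM (j - a) s' = gM j (s + s') := by
  obtain ⟨i, rfl | rfl⟩ := Nat.even_or_odd' j
  · rw [sum_range_two_mul_add_one _ _ (by intro b; simp [gM_odd])]
    have e1 : ∀ i : ℕ, 2 * i / 2 = i := by intro i; omega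
    simp only [gM, e1, add_pow s s', mul_sum]
    refine sum_congr rfl fun b hb => ?_
    have hb' : b ≤ i := by simp at hb; omega
    obtain ⟨c, rfl⟩ := Nat.exists_eq_add_of_le hb'
    have e2 : 2 * (b + c) - 2 * b = 2 * c := by omega
    have e3 : b + c - b = c := by omega
    rw [e2, e1, e3]
    have h1 : (gmom (2 * b) : ℝ) * (2 ^ b * (b.factorial : ℝ)) = ((2 * b).factorial : ℝ) := by
      exact_mod_cast gmom_even b
    have h2 : (gmom (2 * c) : ℝ) * (2 ^ c * (c.factorial : ℝ)) = ((2 * c).factorial : ℝ) := by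
      exact_mod_cast gmom_even c
    have h3 : (gmom (2 * (b+c)) : ℝ) * (2 ^ (b+c) * ((b+c).factorial : ℝ)) = ((2 * (b+c)).factorial : ℝ) := by
      exact_mod_cast gmom_even (b+c)
    have h4 : ((b + c).choose b : ℝ) * (b.factorial) * (c.factorial) = (b+c).factorial := by
      have := Nat.choose_mul_factorial_mul_factorial hb'
      rw [e3] at this
      exact_mod_cast this
    have h5 : ((2 * (b + c)).choose (2 * b) : ℝ) * ((2*b).factorial) * ((2*c).factorial) = (2*(b+c)).factorial := by
      have := Nat.choose_mul_factorial_mul_factorial (show 2 * b ≤ 2 * (b + c) by omega)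
      rw [e2] at this
      exact_mod_cast this
    have hb0 : (b.factorial : ℝ) ≠ 0 := by positivity
    have hc0 : (c.factorial : ℝ) ≠ 0 := by positivity
    have key : ((2 * (b + c)).choose (2 * b) : ℝ) * gmom (2*b) * gmom (2*c) = gmom (2*(b+c)) * (b+c).choose b := by
      have : (2 ^ b * (b.factorial : ℝ)) * (2 ^ c * (c.factorial : ℝ)) ≠ 0 := by positivity
      apply mul_right_cancel₀ this
      calc _ = ((2 * (b + c)).choose (2 * b) : ℝ) * (gmom (2 * b) * (2 ^ b * (b.factorial : ℝ))) * (gmom (2 * c) * (2 ^ c * (c.factorial : ℝ))) := by ring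
        _ = (gmom (2 * (b+c)) : ℝ) * (2 ^ (b+c) * (((b + c).choose b : ℝ) * (b.factorial) * (c.factorial))) := by
          rw [h1, h2, h5, h4, h3]
        _ = _ := by ring
    linear_combination (s^b * s'^c) * key
  · rw [gM_odd]
    apply sum_eq_zero
    intro a ha
    obtain ⟨b, rfl | rfl⟩ := Nat.even_or_odd' a
    · have : 2 * i + 1 - 2 * b = 2 * (i - b) + 1 := by simp at ha; omega
      rw [this, gM_odd, mul_zero]
    · simp [gM_odd]

lemma conv_moments {ι ι' : Type} [Fintype ι] [Fintype ι'] (K : ℕ) (w ξ : ι → ℝ) (w' ξ' : ι' → ℝ)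
    (s s' : ℝ) (h : ∀ j ≤ K, ∑ i, w i * ξ i ^ j = gM j s) (h' : ∀ j ≤ K, ∑ i, w' i * ξ' i ^ j = gM j s') :
    ∀ j ≤ K, ∑ p : ι × ι', (w p.1 * w' p.2) * (ξ p.1 + ξ' p.2) ^ j = gM j (s + s') := by
  intro j hj
  rw [← gM_conv]
  have : ∀ a ∈ range (j+1), (j.choose a : ℝ) * gM a s * gM (j - a) s' = 
      ∑ p : ι × ι', (j.choose a : ℝ) * (w p.1 * ξ p.1 ^ a) * (w' p.2 * ξ' p.2 ^ (j - a)) := by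
    intro a ha
    simp at ha
    rw [← h a (by omega), ← h' (j-a) (by omega), Fintype.sum_prod_type, mul_assoc, sum_mul_sum, mul_sum]
    refine sum_congr rfl fun x _ => ?_
    rw [mul_sum]
    refine sum_congr rfl fun x _ => ?_
    ring
  rw [sum_congr rfl this, sum_comm]
  refine sum_congr rfl fun p _ => ?_
  rw [add_pow, mul_sum]
  refine sum_congr rfl fun x _ => ?_
  ring

open MeasureTheory in
lemma gauss_integrable (j : ℕ) : Integrable (fun t : ℝ => t ^ j * Real.exp (-(1/2) * t ^ 2)) := by
  have := integrable_rpow_mul_exp_neg_mul_sq (b := 1/2) (by norm_num) (s := j) (by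
    have : (0:ℝ) ≤ j := by positivity
    linarith)
  simpa using this

open MeasureTheory in
lemma gauss_moment (j : ℕ) : ∫ t : ℝ, t ^ j * Real.exp (-(1/2) * t ^ 2) = 
    gmom j * ∫ t : ℝ, Real.exp (-(1/2) * t ^ 2) := by
  have hd : ∀ t : ℝ, HasDerivAt (fun t : ℝ => Real.exp (-(1/2) * t ^ 2)) (- (t * Real.exp (-(1/2) * t ^ 2))) t := by
    intro t
    have := ((hasDerivAt_pow 2 t).const_mul (-(1/2) : ℝ)).exp
    convert this using 1
    push_cast; ring
  have key : ∀ j : ℕ, (∫ t : ℝ, t ^ j * Real.exp (-(1/2) * t ^ 2) = 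
    gmom j * ∫ t : ℝ, Real.exp (-(1/2) * t ^ 2)) ∧ (∫ t : ℝ, t ^ (j+1) * Real.exp (-(1/2) * t ^ 2) = 
    gmom (j+1) * ∫ t : ℝ, Real.exp (-(1/2) * t ^ 2)) := by
    intro j
    induction j with
    | zero =>
      refine ⟨by simp [gmom], ?_⟩
      have h0 := integral_eq_zero_of_hasDerivAt_of_integrable hd (by simpa using (gauss_integrable 1).neg)
        (by simpa using (gauss_integrable 0))
      rw [integral_neg] at h0
      simp [gmom]; simpa using h0
    | succ j ih =>
      refine ⟨ih.2, ?_⟩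
      have hd2 : ∀ t : ℝ, HasDerivAt (fun t : ℝ => t ^ (j+1) * Real.exp (-(1/2) * t ^ 2)) 
         (((j:ℝ)+1) * (t ^ j * Real.exp (-(1/2) * t ^ 2)) - t ^ (j+2) * Real.exp (-(1/2) * t ^ 2)) t := by
        intro t
        refine ((hasDerivAt_pow (j+1) t).fun_mul (hd t)).congr_deriv ?_
        push_cast; ring
      have h0 := integral_eq_zero_of_hasDerivAt_of_integrable hd2 
        (((gauss_integrable j).const_mul _).sub (gauss_integrable (j+2))) (gauss_integrable (j+1))
      rw [integral_sub ((gauss_integrable j).const_mul _) (gauss_integrable (j+2)), integral_const_mul, ih.1] at h0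
      rw [show j + 1 + 1 = j + 2 by ring, gmom]
      push_cast
      linarith
  exact (key j).1
end

section
open scoped Pointwise

/-- the moment curve -/
def mcurve (K : ℕ) (t : ℝ) : Fin (K + 1) → ℝ := fun j => t ^ (j : ℕ)

def mvec (K : ℕ) : Fin (K + 1) → ℝ := fun j => (gmom j : ℝ)

/-- the Vandermonde map -/
noncomputable def vmap (K : ℕ) : (Fin (K + 1) → ℝ) →ₗ[ℝ] (Fin (K + 1) → ℝ) :=
  ∑ i : Fin (K + 1), (LinearMap.proj i).smulRight (mcurve K (i : ℕ))

lemma vmap_apply (K : ℕ) (b : Fin (K + 1) → ℝ) : vmap K b = ∑ i, b i • mcurve K (i : ℕ) := by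
  simp [vmap]

lemma vmap_inj (K : ℕ) : Function.Injective (vmap K) := by
  rw [← LinearMap.ker_eq_bot, LinearMap.ker_eq_bot']
  intro b hb
  refine Matrix.eq_zero_of_forall_pow_sum_mul_pow_eq_zero (f := fun i : Fin (K+1) => ((i : ℕ) : ℝ)) ?_ ?_
  · intro i j h
    simpa [Fin.ext_iff] using h
  · intro j
    have := congrFun hb j
    rw [vmap_apply] at this
    simpa [mcurve] using this

noncomputable def veq (K : ℕ) : (Fin (K + 1) → ℝ) ≃ₗ[ℝ] (Fin (K + 1) → ℝ) :=
  LinearEquiv.ofInjectiveEndo (vmap K) (vmap_inj K)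

lemma veq_apply (K : ℕ) (b : Fin (K + 1) → ℝ) : veq K b = ∑ i, b i • mcurve K (i : ℕ) := by
  rw [← vmap_apply]; rfl

noncomputable def vcone (K : ℕ) : PointedCone ℝ (Fin (K + 1) → ℝ) :=
  Submodule.span _ (Set.range fun t : ℚ => mcurve K (t : ℝ))

lemma poly_gauss_pos (K : ℕ) (q : Fin (K + 1) → ℝ) (h0 : ∀ t : ℝ, 0 ≤ ∑ j, q j * t ^ (j : ℕ))
    (h : ∑ j, q j * (gmom j : ℝ) ≤ 0) : ∀ t : ℝ, ∑ j, q j * t ^ (j : ℕ) = 0 := by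
  open MeasureTheory in
  set g : ℝ → ℝ := fun t => (∑ j, q j * t ^ (j : ℕ)) * Real.exp (-(1/2) * t ^ 2) with hg
  have hge : g = fun t => ∑ j, q j * (t ^ (j : ℕ) * Real.exp (-(1/2) * t ^ 2)) := by
    ext t; simp only [hg, sum_mul, mul_assoc]
  have hgInt : Integrable g := by
    rw [hge]
    exact integrable_finsetSum _ fun j _ => (gauss_integrable j).const_mul _
  have hI : ∫ t, g t = (∑ j, q j * (gmom j : ℝ)) * ∫ t : ℝ, Real.exp (-(1/2) * t ^ 2) := by
    simp only [hge]
    rw [integral_finsetSum _ fun (j : Fin (K+1)) _ => (gauss_integrable (j:ℕ)).const_mul (q j), sum_mul]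
    refine sum_congr rfl fun j _ => ?_
    rw [integral_const_mul, gauss_moment]; ring
  have hle : ∫ t, g t ≤ 0 := by
    rw [hI]
    exact mul_nonpos_of_nonpos_of_nonneg h (integral_nonneg fun t => (Real.exp_pos _).le)
  have hg0 : 0 ≤ g := fun t => mul_nonneg (h0 t) (Real.exp_pos _).le
  have hz : ∫ t, g t = 0 := le_antisymm hle (integral_nonneg hg0)
  rw [integral_eq_zero_iff_of_nonneg hg0 hgInt] at hz
  have hc : Continuous g := by fun_prop
  have := (Continuous.ae_eq_iff_eq volume hc continuous_const).1 hz
  intro t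
  have ht : g t = 0 := congrFun this t
  exact (mul_eq_zero.1 ht).resolve_right (Real.exp_pos _).ne'

lemma mvec_mem (K : ℕ) : mvec K ∈ ((veq K) '' {b | ∀ i, 0 < b i}) + (vcone K : Set (Fin (K + 1) → ℝ)) := by
  by_contra hm
  have hO : IsOpen ((veq K) '' {b | ∀ i, 0 < b i}) := by
    have h1 : IsOpen {b : Fin (K + 1) → ℝ | ∀ i, 0 < b i} := by
      simp only [Set.ofPred_forall]
      exact isOpen_iInter_of_finite fun i => isOpen_lt continuous_const (continuous_apply i)
    exact (veq K).toContinuousLinearEquiv.toHomeomorph.isOpenMap _ h1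
  have hOc : Convex ℝ ((veq K) '' {b | ∀ i, 0 < b i}) := by
    have h1 : Convex ℝ {b : Fin (K + 1) → ℝ | ∀ i, 0 < b i} := by
      simp only [Set.ofPred_forall]
      exact convex_iInter fun i => convex_halfSpace_gt (LinearMap.proj i).isLinear 0
    exact h1.linear_image (veq K).toLinearMap
  obtain ⟨f, hf⟩ := geometric_hahn_banach_open_point (hOc.add (vcone K).toConvexCone.convex) hO.add_right hm
  have hφ : ∀ t : ℚ, mcurve K (t : ℝ) ∈ vcone K := fun t => Submodule.subset_span ⟨t, rfl⟩
  have hone : (veq K) (fun _ => 1) ∈ (veq K) '' {b | ∀ i, 0 < b i} := ⟨_, by simp, rfl⟩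
  have hsm : ∀ c : ℝ, 0 < c → c • (veq K) (fun _ => 1) ∈ (veq K) '' {b | ∀ i, 0 < b i} := by
    intro c hc
    refine ⟨c • fun _ => 1, by simpa using hc, by simp⟩
  -- f nonpositive on the curve
  have hneg : ∀ t : ℚ, f (mcurve K (t : ℝ)) ≤ 0 := by
    intro t
    by_contra! hpos
    set o := (veq K) (fun _ => 1)
    set c : ℝ := max 0 ((f (mvec K) - f o) / f (mcurve K t)) with hc
    have hcm : c • mcurve K (t : ℝ) ∈ vcone K := (vcone K).smul_mem (le_max_left _ _) (hφ t)
    have := hf _ (Set.add_mem_add hone hcm)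
    rw [map_add, map_smul, smul_eq_mul] at this
    have h2 : (f (mvec K) - f o) / f (mcurve K t) ≤ c := le_max_right _ _
    rw [div_le_iff₀ hpos] at h2
    linarith
  have hm0 : 0 ≤ f (mvec K) := by
    by_contra! hneg'
    set o := (veq K) (fun _ => 1)
    have h1 := hf _ (Set.add_mem_add (hsm ((- f (mvec K)) / (|f o| + 1)) (by
      apply div_pos; linarith
      positivity)) (vcone K).zero_mem)
    rw [add_zero, map_smul, smul_eq_mul, div_mul_eq_mul_div, div_lt_iff₀ (by positivity)] at h1
    have : -|f o| ≤ f o := neg_abs_le _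
    nlinarith
  have hrep : ∀ v : Fin (K + 1) → ℝ, f v = ∑ j, v j * f (Pi.single j 1) := by
    intro v
    conv_lhs => rw [pi_eq_sum_univ' v]
    simp [map_sum]
  have h3 := poly_gauss_pos K (fun j => - f (Pi.single j 1)) ?_ ?_
  · have h4 : ∀ t : ℝ, f (mcurve K t) = 0 := by
      intro t
      rw [hrep]
      have := h3 t
      simp only [neg_mul, sum_neg_distrib, neg_eq_zero] at this
      rw [← this]
      exact sum_congr rfl fun j _ => by simp [mcurve]; ring
    have h5 : ∀ v, f v = 0 := by
      intro v
      obtain ⟨b, rfl⟩ := (veq K).surjective v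
      rw [veq_apply]; simp [h4]
    have := hf _ (Set.add_mem_add hone (vcone K).zero_mem)
    rw [h5, h5] at this
    exact lt_irrefl _ this
  · have hcl : ∀ t : ℝ, f (mcurve K t) ≤ 0 := by
      have hcont : Continuous fun t => f (mcurve K t) := by
        apply f.continuous.comp
        unfold mcurve; fun_prop
      intro t
      have hcl : IsClosed {t : ℝ | f (mcurve K t) ≤ 0} := isClosed_le hcont continuous_const
      have : closure (Set.range ((↑) : ℚ → ℝ)) ⊆ {t : ℝ | f (mcurve K t) ≤ 0} := by
        apply hcl.closure_subset_iff.2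
        rintro _ ⟨t, rfl⟩
        exact hneg t
      apply this
      rw [Rat.denseRange_cast.closure_range]; trivial
    intro t
    have := hcl t
    rw [hrep] at this
    simp only [neg_mul, sum_neg_distrib]
    rw [neg_nonneg]
    refine le_trans (le_of_eq (sum_congr rfl fun j _ => ?_)) this
    simp [mcurve]; ring
  · rw [hrep] at hm0
    simp only [neg_mul, sum_neg_distrib]
    rw [neg_nonpos]
    refine le_trans hm0 (le_of_eq (sum_congr rfl fun j _ => ?_))
    simp [mvec]; ring

lemma rat_vandermonde (K : ℕ) (r : Fin (K + 1) → ℚ) :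
    ∃ b : Fin (K + 1) → ℚ, ∀ j : Fin (K + 1), ∑ i : Fin (K + 1), b i * ((i : ℕ) : ℚ) ^ (j : ℕ) = r j := by
  set V := Matrix.vandermonde (fun i : Fin (K + 1) => ((i : ℕ) : ℚ)) with hV
  have hdet : IsUnit V.det := by
    rw [isUnit_iff_ne_zero]
    apply Matrix.det_vandermonde_ne_zero_iff.2
    intro i j h
    simpa [Fin.ext_iff] using h
  refine ⟨Matrix.vecMul r V⁻¹, fun j => ?_⟩
  have : Matrix.vecMul (Matrix.vecMul r V⁻¹) V = r := by
    rw [Matrix.vecMul_vecMul, Matrix.nonsing_inv_mul V hdet, Matrix.vecMul_one]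
  exact congrFun this j

lemma rat_quadrature (K : ℕ) (hK : 1 ≤ K) : ∃ (ι : Type) (_ : Fintype ι) (w t : ι → ℚ), (∀ i, 0 < w i) ∧
    (∀ j ≤ K, ∑ i, w i * t i ^ j = gmom j) ∧ (∃ i, t i = 0) ∧ (∃ i, t i = 1) := by
  obtain ⟨_, ⟨b, hb, rfl⟩, x, hx, hbx⟩ := Set.mem_add.1 (mvec_mem K)
  have hx' : x ∈ Submodule.span {c : ℝ // 0 ≤ c} (Set.range fun t : ℚ => mcurve K (t : ℝ)) := hx
  rw [Finsupp.mem_span_range_iff_exists_finsupp] at hx'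
  obtain ⟨c, hc⟩ := hx'
  let σ := {s : ℚ // s ∈ c.support}
  let c' : σ → ℝ := fun s => (c s.1 : ℝ)
  have hc' : ∑ s : σ, c' s • mcurve K ((s.1 : ℚ) : ℝ) = x := by
    rw [← hc, Finsupp.sum, ← Finset.sum_coe_sort c.support]
    rfl
  let G : (σ → ℝ) → (Fin (K + 1) → ℝ) := fun v =>
    (veq K).symm (mvec K - ∑ s : σ, v s • mcurve K ((s.1 : ℚ) : ℝ))
  have hG : Continuous G := by
    have : Continuous (veq K).symm := (veq K).symm.toContinuousLinearEquiv.continuous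
    apply this.comp
    fun_prop
  have hGc : G c' = b := by
    simp only [G, hc', ← hbx]; simp
  have hopen : IsOpen {v | ∀ i, 0 < G v i} := by
    simp only [Set.ofPred_forall]
    exact isOpen_iInter_of_finite fun i => isOpen_lt continuous_const ((continuous_apply i).comp hG)
  obtain ⟨ε, hε, hball⟩ := Metric.isOpen_iff.1 hopen c' (by
    intro i; rw [hGc]; exact hb i)
  have hw : ∀ s : σ, ∃ q : ℚ, c' s < q ∧ (q : ℝ) < c' s + ε := fun s => exists_rat_btwn (by linarith)
  choose w hw1 hw2 using hw
  have hwG : ∀ i, 0 < G (fun s => (w s : ℝ)) i := by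
    apply hball
    rw [Metric.mem_ball, dist_pi_lt_iff hε]
    intro s
    rw [Real.dist_eq, abs_lt]
    constructor <;> linarith [hw1 s, hw2 s]
  obtain ⟨b', hb'⟩ := rat_vandermonde K (fun j => gmom j - ∑ s : σ, w s * s.1 ^ (j : ℕ))
  have hbG : (fun i => (b' i : ℝ)) = G (fun s => (w s : ℝ)) := by
    apply (veq K).injective
    simp only [G, LinearEquiv.apply_symm_apply]
    rw [veq_apply]
    ext j
    have := congrArg (fun q : ℚ => (q : ℝ)) (hb' j)
    push_cast at this
    simpa [mcurve, mvec, Finset.sum_apply] using this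
  refine ⟨Fin (K + 1) ⊕ σ, inferInstance, Sum.elim b' w, Sum.elim (fun i => ((i : ℕ) : ℚ)) (fun s => s.1), ?_, ?_, ?_, ?_⟩
  · rintro (i | s)
    · have := hwG i
      rw [← hbG] at this
      simpa using this
    · have h1 : (0 : ℝ) ≤ c' s := (c s.1).2
      have := h1.trans_lt (hw1 s)
      simpa using this
  · intro j hj
    have := hb' ⟨j, by omega⟩
    rw [Fintype.sum_sum_type]
    simp only [Sum.elim_inl, Sum.elim_inr]
    simp only at this
    rw [this]; ring
  · exact ⟨Sum.inl 0, by simp⟩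
  · exact ⟨Sum.inl ⟨1, by omega⟩, by simp⟩
end

section

lemma common_denom {ι : Type} [Fintype ι] (t : ι → ℚ) :
    ∃ (D : ℕ) (τ : ι → ℤ), 0 < D ∧ ∀ i, (τ i : ℚ) = D * t i := by
  classical
  refine ⟨∏ i, (t i).den, fun i => (∏ j ∈ univ.erase i, (t j).den : ℕ) * (t i).num, 
    Finset.prod_pos fun i _ => (t i).den_pos, fun i => ?_⟩
  rw [← Finset.mul_prod_erase univ _ (mem_univ i)]
  have h := Rat.den_mul_eq_num (t i)
  push_cast
  rw [← h]; ring

lemma sum_replicate_map {J : Type} [Fintype J] (n : J → ℕ) (y : J → ℤ) (g : ℤ → ℝ) :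
    ((∑ p, Multiset.replicate (n p) (y p)).map g).sum = ∑ p, (n p : ℝ) * g (y p) := by
  have h : ∀ S : Multiset ℤ, (S.map g).sum = (Multiset.sumAddMonoidHom.comp (Multiset.mapAddMonoidHom g)) S := fun S => rfl
  rw [h, map_sum]
  refine sum_congr rfl fun p _ => ?_
  rw [← h]; simp

lemma gauss_scale {ι : Type} [Fintype ι] (K : ℕ) (w t : ι → ℚ) 
    (h : ∀ j ≤ K, ∑ i, w i * t i ^ j = gmom j) (x : ℝ) :
    ∀ j ≤ K, ∑ i, (w i : ℝ) * ((t i : ℝ) * x) ^ j = gM j (x ^ 2) := by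
  intro j hj
  have h1 : ∑ i, (w i : ℝ) * (t i : ℝ) ^ j = gmom j := by exact_mod_cast congrArg (fun q : ℚ => (q : ℝ)) (h j hj)
  simp only [mul_pow, ← mul_assoc]
  rw [← sum_mul, h1]
  obtain ⟨i, rfl | rfl⟩ := Nat.even_or_odd' j
  · rw [gM, ← pow_mul]; congr 2; omega
  · rw [gM_odd, gmom_odd]; simp

lemma hilbert_minus (k : ℕ) : ∃ (a w : ℕ) (μ : ℕ → ℝ), 0 < a ∧ μ 1 = 0 ∧ 0 ≤ μ 2 ∧
    ∀ (Q : ℕ) (x : ℤ), x ^ 2 ≤ Q → ∃ S : Multiset ℤ, Multiset.card S = w ∧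
      (∀ y ∈ S, (y : ℝ) ^ 2 ≤ μ 2 * Q) ∧
      ∀ j ≤ k, ((a * x : ℤ) : ℝ) ^ j + (S.map (fun y : ℤ => (y : ℝ) ^ j)).sum = μ j * (Q : ℝ) ^ (j / 2) := by
  obtain ⟨ι, _, w, t, hw, hmom, ⟨i0, hi0⟩, ⟨i1, hi1⟩⟩ := rat_quadrature (max k 2) (by omega)
  obtain ⟨D, τ, hD, hτ⟩ := common_denom t
  obtain ⟨W, ω, hW, hω⟩ := common_denom w
  have hωpos : ∀ i, 0 < ω i := by
    intro i
    have : (0 : ℚ) < ω i := by rw [hω]; have := hw i; positivity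
    exact_mod_cast this
  have hτR : ∀ i, (τ i : ℝ) = D * t i := fun i => by exact_mod_cast congrArg (fun q : ℚ => (q : ℝ)) (hτ i)
  have hωR : ∀ i, ((ω i).toNat : ℝ) = W * w i := fun i => by
    have h1 : (((ω i).toNat : ℤ) : ℝ) = ω i := by rw [Int.toNat_of_nonneg (hωpos i).le]
    have h2 : (ω i : ℝ) = W * w i := by exact_mod_cast congrArg (fun q : ℚ => (q : ℝ)) (hω i)
    rw [← h2, ← h1, Int.cast_natCast]
  let J := (((ι × ι) × ι) × ι) × ι
  let n : J → ℕ := fun p => (ω p.1.1.1.1).toNat * (ω p.1.1.1.2).toNat * (ω p.1.1.2).toNat * (ω p.1.2).toNat * (ω p.2).toNat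
  have hn : ∀ p, 0 < n p := by
    intro p
    have : ∀ i, 0 < (ω i).toNat := fun i => by have := hωpos i; omega
    exact Nat.mul_pos (Nat.mul_pos (Nat.mul_pos (Nat.mul_pos (this _) (this _)) (this _)) (this _)) (this _)
  refine ⟨D, (∑ p, n p) - 1, fun j => (D : ℝ) ^ j * W ^ 5 * gmom j, hD, by simp [gmom], by
    simp [gmom]; positivity, ?_⟩
  intro Q x hx
  obtain ⟨y1, y2, y3, y4, hy⟩ := Nat.sum_four_squares (Q - x ^ 2 : ℤ).toNat
  have hy' : (x : ℝ) ^ 2 + (y1 : ℝ) ^ 2 + (y2 : ℝ) ^ 2 + (y3 : ℝ) ^ 2 + (y4 : ℝ) ^ 2 = Q := by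
    have h1 : (((Q - x ^ 2 : ℤ).toNat : ℤ) : ℤ) = Q - x ^ 2 := Int.toNat_of_nonneg (by omega)
    rw [← hy] at h1
    have h2 := congrArg (fun z : ℤ => (z : ℝ)) h1
    push_cast at h2
    linarith
  let fm : J → ℤ := fun p => τ p.1.1.1.1 * x + τ p.1.1.1.2 * y1 + τ p.1.1.2 * y2 + τ p.1.2 * y3 + τ p.2 * y4
  have hfull : ∀ j ≤ max k 2, ∑ p, (n p : ℝ) * (fm p : ℝ) ^ j = (D : ℝ) ^ j * W ^ 5 * gmom j * (Q : ℝ) ^ (j / 2) := by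
    intro j hj
    have h := gauss_scale _ w t hmom
    have h5 := conv_moments _ _ _ _ _ _ _ (conv_moments _ _ _ _ _ _ _ (conv_moments _ _ _ _ _ _ _
      (conv_moments _ _ _ _ _ _ _ (h x) (h y1)) (h y2)) (h y3)) (h y4) j hj
    rw [hy', gM] at h5
    rw [mul_assoc _ (gmom j : ℝ), ← h5, mul_sum]
    refine sum_congr rfl fun p _ => ?_
    simp only [n, fm]
    push_cast
    simp only [hωR, hτR]
    rw [show (D:ℝ) * t p.1.1.1.1 * x + D * t p.1.1.1.2 * y1 + D * t p.1.1.2 * y2 + D * t p.1.2 * y3 + D * t p.2 * y4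
      = D * (t p.1.1.1.1 * x + t p.1.1.1.2 * y1 + t p.1.1.2 * y2 + t p.1.2 * y3 + t p.2 * y4) by ring, mul_pow]
    ring
  let p0 : J := ((((i1, i0), i0), i0), i0)
  have hτ0 : τ i0 = 0 := by
    have := hτ i0; rw [hi0] at this; simpa using this
  have hτ1 : τ i1 = D := by
    have := hτ i1; rw [hi1, mul_one] at this; exact_mod_cast this
  have hp0 : fm p0 = D * x := by simp [fm, p0, hτ0, hτ1]
  let Sf : Multiset ℤ := ∑ p, Multiset.replicate (n p) (fm p)
  have hmem : (D * x : ℤ) ∈ Sf := by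
    rw [Multiset.mem_sum]
    exact ⟨p0, mem_univ _, by rw [Multiset.mem_replicate]; exact ⟨(hn p0).ne', hp0.symm⟩⟩
  have hcons := Multiset.cons_erase hmem
  have hsum : ∀ j ≤ max k 2, (Sf.map (fun y : ℤ => (y : ℝ) ^ j)).sum = (D : ℝ) ^ j * W ^ 5 * gmom j * (Q : ℝ) ^ (j / 2) := by
    intro j hj
    rw [← hfull j hj]
    exact sum_replicate_map n fm _
  refine ⟨Sf.erase (D * x), ?_, ?_, ?_⟩
  · rw [Multiset.card_erase_of_mem hmem, Nat.pred_eq_sub_one]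
    congr 1
    simp [Sf]
  · intro y hy
    have hy2 := Multiset.mem_of_mem_erase hy
    have h2 := hsum 2 (by omega)
    rw [show 2 / 2 = 1 by rfl, pow_one] at h2
    rw [← h2]
    apply Multiset.single_le_sum
    · intro z hz
      obtain ⟨u, _, rfl⟩ := Multiset.mem_map.1 hz
      positivity
    · exact Multiset.mem_map_of_mem (fun y : ℤ => (y : ℝ) ^ 2) hy2
  · intro j hj
    rw [← hsum j (by omega)]
    conv_rhs => rw [← hcons]
    simp
end

section

/-- signed sums -/
def SR (F : ℤ → ℝ) (s : ℕ) (H y : ℝ) : Prop :=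
  ∃ S S' : Multiset ℤ, Multiset.card S = s ∧ Multiset.card S' = s ∧ (∀ h ∈ S, (h : ℝ) ^ 2 ≤ H) ∧
    (∀ h ∈ S', (h : ℝ) ^ 2 ≤ H) ∧ y = (S.map F).sum - (S'.map F).sum

lemma SR.neg {F : ℤ → ℝ} {s : ℕ} {H y : ℝ} (h : SR F s H y) : SR F s H (-y) := by
  obtain ⟨S, S', h1, h2, h3, h4, rfl⟩ := h
  exact ⟨S', S, h2, h1, h4, h3, by ring⟩

lemma SR.mono {F : ℤ → ℝ} {s : ℕ} {H H' y : ℝ} (h : SR F s H y) (hH : H ≤ H') : SR F s H' y := by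
  obtain ⟨S, S', h1, h2, h3, h4, rfl⟩ := h
  exact ⟨S, S', h1, h2, fun z hz => (h3 z hz).trans hH, fun z hz => (h4 z hz).trans hH, rfl⟩

lemma SR.add {F : ℤ → ℝ} {s s' : ℕ} {H y y' : ℝ} (h : SR F s H y) (h' : SR F s' H y') :
    SR F (s + s') H (y + y') := by
  obtain ⟨S, S', h1, h2, h3, h4, rfl⟩ := h
  obtain ⟨T, T', k1, k2, k3, k4, rfl⟩ := h'
  refine ⟨S + T, S' + T', by simp [h1, k1], by simp [h2, k2], ?_, ?_, ?_⟩
  · intro z hz; rcases Multiset.mem_add.1 hz with hz | hz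
    · exact h3 z hz
    · exact k3 z hz
  · intro z hz; rcases Multiset.mem_add.1 hz with hz | hz
    · exact h4 z hz
    · exact k4 z hz
  · simp; ring

lemma SR.one {F : ℤ → ℝ} {H : ℝ} {u v : ℤ} (hu : (u : ℝ) ^ 2 ≤ H) (hv : (v : ℝ) ^ 2 ≤ H) :
    SR F 1 H (F u - F v) :=
  ⟨{u}, {v}, by simp, by simp, by simpa using hu, by simpa using hv, by simp⟩

lemma SR.diff {F G : ℤ → ℝ} {s : ℕ} {H y : ℝ} (hG : ∀ h, G h = F (h + 1) - F (h - 1)) (h : SR G s H y) :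
    SR F (s + s) (2 * H + 2) y := by
  obtain ⟨S, S', h1, h2, h3, h4, rfl⟩ := h
  refine ⟨S.map (fun h => h + 1) + S'.map (fun h => h - 1), S.map (fun h => h - 1) + S'.map (fun h => h + 1),
    by simp [h1, h2], by simp [h1, h2], ?_, ?_, ?_⟩
  · intro z hz
    rcases Multiset.mem_add.1 hz with hz | hz <;> obtain ⟨u, hu, rfl⟩ := Multiset.mem_map.1 hz
    · push_cast; nlinarith [h3 u hu, sq_nonneg ((u : ℝ) - 1)]
    · push_cast; nlinarith [h4 u hu, sq_nonneg ((u : ℝ) + 1)]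
  · intro z hz
    rcases Multiset.mem_add.1 hz with hz | hz <;> obtain ⟨u, hu, rfl⟩ := Multiset.mem_map.1 hz
    · push_cast; nlinarith [h3 u hu, sq_nonneg ((u : ℝ) + 1)]
    · push_cast; nlinarith [h4 u hu, sq_nonneg ((u : ℝ) - 1)]
  · have hGe : G = fun h => F (h + 1) - F (h - 1) := funext hG
    simp only [hGe, Multiset.map_add, Multiset.sum_add, Multiset.map_map, Multiset.sum_map_sub, Function.comp_def]
    ring

/-- polynomial with coefficients `c` -/
def pol (k : ℕ) (c : ℕ → ℝ) (h : ℤ) : ℝ := ∑ i ∈ range (k + 1), c i * (h : ℝ) ^ i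

/-- coefficients of the difference -/
def dco (k : ℕ) (c : ℕ → ℝ) (i : ℕ) : ℝ :=
  ∑ l ∈ range (k + 1), c l * (l.choose i * (1 - (-1) ^ (l - i)))

lemma pol_diff (k : ℕ) (c : ℕ → ℝ) (h : ℤ) :
    pol k (dco (k + 1) c) h = pol (k + 1) c (h + 1) - pol (k + 1) c (h - 1) := by
  have h1 : dco (k + 1) c (k + 1) = 0 := by
    apply sum_eq_zero
    intro l hl
    rcases Nat.lt_or_ge l (k + 1) with hlt | hge
    · simp [Nat.choose_eq_zero_of_lt hlt]
    · have : l - (k + 1) = 0 := by simp at hl; omega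
      simp [this]
  have h2 : pol k (dco (k + 1) c) h = ∑ i ∈ range (k + 1 + 1), dco (k + 1) c i * (h : ℝ) ^ i := by
    rw [sum_range_succ _ (k + 1), h1, zero_mul, add_zero]; rfl
  rw [h2]
  unfold pol dco
  rw [← sum_sub_distrib]
  simp only [sum_mul]
  rw [sum_comm]
  refine sum_congr rfl fun l hl => ?_
  have hl' : l + 1 ≤ k + 1 + 1 := by simp at hl; omega
  have e1 : ((h : ℝ) + 1) ^ l = ∑ i ∈ range (k + 1 + 1), (h : ℝ) ^ i * l.choose i := by
    rw [add_pow]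
    simp only [one_pow, mul_one]
    apply sum_subset (range_subset_range.2 hl')
    intro i _ hi
    rw [Nat.choose_eq_zero_of_lt (by simp at hi; omega)]; simp
  have e2 : ((h : ℝ) + (-1)) ^ l = ∑ i ∈ range (k + 1 + 1), (h : ℝ) ^ i * (-1) ^ (l - i) * l.choose i := by
    rw [add_pow]
    apply sum_subset (range_subset_range.2 hl')
    intro i _ hi
    rw [Nat.choose_eq_zero_of_lt (by simp at hi; omega)]; simp
  push_cast
  rw [sub_eq_add_neg (h : ℝ) 1, e1, e2, ← mul_sub, ← sum_sub_distrib, mul_sum]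
  refine sum_congr rfl fun i _ => ?_
  ring

lemma dco_lower (k : ℕ) (c : ℕ → ℝ) (κ X : ℝ) (hκ : 0 < κ) (hX : 1 ≤ X)
    (hc : ∀ i, 1 ≤ i → i ≤ k + 1 → κ * X ^ (k + 1 - i) ≤ c i) (i : ℕ) (hi : 1 ≤ i) (hik : i ≤ k) :
    κ * X ^ (k - i) ≤ dco (k + 1) c i := by
  have hnn : ∀ l ∈ range (k + 1 + 1), 0 ≤ c l * (l.choose i * (1 - (-1) ^ (l - i))) := by
    intro l hl
    rcases Nat.lt_or_ge l i with hlt | hge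
    · simp [Nat.choose_eq_zero_of_lt hlt]
    · have h1 : 0 ≤ c l := le_trans (by positivity) (hc l (by omega) (by simp at hl; omega))
      have h2 : (-1 : ℝ) ^ (l - i) ≤ 1 := (le_abs_self _).trans (by simp)
      exact mul_nonneg h1 (mul_nonneg (by positivity) (by linarith))
  have h := single_le_sum hnn (show i + 1 ∈ range (k + 1 + 1) by simp; omega)
  refine le_trans ?_ h
  have h1 := hc (i + 1) (by omega) (by omega)
  rw [show k + 1 - (i + 1) = k - i by omega] at h1
  have h0 : 0 ≤ κ * X ^ (k - i) := by positivity
  simp only [Nat.add_sub_cancel_left, pow_one, Nat.choose_succ_self_right]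
  push_cast
  have : (1 : ℝ) ≤ i := by exact_mod_cast hi
  nlinarith

lemma dco_upper (k : ℕ) (c : ℕ → ℝ) (K X : ℝ) (hK : 0 < K) (hX : 1 ≤ X)
    (hc : ∀ i, 1 ≤ i → i ≤ k + 1 → |c i| ≤ K * X ^ (k + 1 - i)) (i : ℕ) (hi : 1 ≤ i) (hik : i ≤ k) :
    |dco (k + 1) c i| ≤ (k + 2) * (K * (2 ^ (k + 1) * 2)) * X ^ (k - i) := by
  have hb : ∀ l ∈ range (k + 1 + 1), |c l * (l.choose i * (1 - (-1) ^ (l - i)))| ≤ 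
      K * (2 ^ (k + 1) * 2) * X ^ (k - i) := by
    intro l hl
    rcases Nat.lt_or_ge i l with hlt | hge
    · have hl' : l ≤ k + 1 := by simp at hl; omega
      have h1 := hc l (by omega) hl'
      have h2 : X ^ (k + 1 - l) ≤ X ^ (k - i) := pow_le_pow_right₀ hX (by omega)
      have h3 : (l.choose i : ℝ) ≤ 2 ^ (k + 1) := by
        have := (Nat.choose_le_two_pow l i).trans (Nat.pow_le_pow_right (by norm_num) hl')
        exact_mod_cast this
      have h4 : |1 - (-1 : ℝ) ^ (l - i)| ≤ 2 := by
        refine (abs_sub _ _).trans ?_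
        simp; norm_num
      rw [abs_mul, abs_mul, Nat.abs_cast]
      calc |c l| * ((l.choose i : ℝ) * |1 - (-1 : ℝ) ^ (l - i)|) ≤ (K * X ^ (k - i)) * (2 ^ (k + 1) * 2) := by
            gcongr
            exact h1.trans (by gcongr)
        _ = _ := by ring
    · have : (l.choose i : ℝ) * (1 - (-1) ^ (l - i)) = 0 := by
        rcases Nat.lt_or_ge l i with h | h
        · simp [Nat.choose_eq_zero_of_lt h]
        · have : l - i = 0 := by omega
          simp [this]
      rw [this]; simp; positivity
  refine (abs_sum_le_sum_abs _ _).trans ((sum_le_sum hb).trans ?_)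
  rw [sum_const, card_range, nsmul_eq_mul]
  push_cast
  apply le_of_eq; ring

lemma even_part (k : ℕ) (c : ℕ → ℝ) (K X B : ℝ) (hK : 0 < K) (hX : 1 ≤ X) (hB : 1 ≤ B) (hk : 2 ≤ k)
    (hc : ∀ i, 1 ≤ i → i ≤ k → |c i| ≤ K * X ^ (k - i)) (u : ℤ) (hu : (u : ℝ) ^ 2 ≤ B * X) :
    |pol k c u + pol k c (-u) - 2 * pol k c 0 - 2 * c 2 * (u : ℝ) ^ 2| ≤ (k + 1) * (2 * K * B ^ k) * X ^ (k - 2) := by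
  have e : pol k c u + pol k c (-u) - 2 * pol k c 0 - 2 * c 2 * (u : ℝ) ^ 2 = 
      ∑ i ∈ range (k + 1), (c i * ((u : ℝ) ^ i + (-u : ℝ) ^ i - 2 * (0 : ℝ) ^ i) - (if i = 2 then 2 * c 2 * (u : ℝ) ^ 2 else 0)) := by
    rw [sum_sub_distrib, sum_ite_eq' (range (k + 1)) 2, if_pos (by simp; omega)]
    unfold pol
    push_cast
    rw [mul_sum, ← sum_add_distrib, ← sum_sub_distrib]
    congr 1
    refine sum_congr rfl fun i _ => ?_
    ring
  have hb : ∀ i ∈ range (k + 1), |c i * ((u : ℝ) ^ i + (-u : ℝ) ^ i - 2 * (0 : ℝ) ^ i) - (if i = 2 then 2 * c 2 * (u : ℝ) ^ 2 else 0)|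
      ≤ (2 * K * B ^ k) * X ^ (k - 2) := by
    intro i hi
    have hpos : 0 ≤ (2 * K * B ^ k) * X ^ (k - 2) := by positivity
    obtain ⟨b, rfl | rfl⟩ := Nat.even_or_odd' i
    · rcases Nat.lt_or_ge b 2 with hb | hb
      · interval_cases b
        · simpa using (by norm_num; exact hpos)
        · have : c (2 * 1) * ((u : ℝ) ^ (2 * 1) + (-u : ℝ) ^ (2 * 1) - 2 * (0 : ℝ) ^ (2 * 1)) - (if 2 * 1 = 2 then 2 * c 2 * (u : ℝ) ^ 2 else 0) = 0 := by
            norm_num; ring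
          rw [this]; simpa using hpos
      · have hi' : 2 * b ≤ k := by simp at hi; omega
        rw [if_neg (by omega), sub_zero, zero_pow (by omega), mul_zero, sub_zero, (even_two_mul b).neg_pow,
          ← two_mul, pow_mul, abs_mul, abs_of_nonneg (show 0 ≤ 2 * ((u : ℝ) ^ 2) ^ b by positivity)]
        calc |c (2 * b)| * (2 * ((u : ℝ) ^ 2) ^ b) ≤ (K * X ^ (k - 2 * b)) * (2 * (B * X) ^ b) := by
              gcongr
              exact hc _ (by omega) hi'
          _ = (2 * K * B ^ b) * X ^ (k - 2 * b + b) := by rw [mul_pow, pow_add]; ring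
          _ ≤ (2 * K * B ^ k) * X ^ (k - 2) := by
              gcongr
              · omega
              · omega
    · rw [if_neg (by omega), (odd_two_mul_add_one b).neg_pow]
      simpa using hpos
  rw [e]
  refine (abs_sum_le_sum_abs _ _).trans ((sum_le_sum hb).trans ?_)
  rw [sum_const, card_range, nsmul_eq_mul]
  push_cast
  apply le_of_eq; ring

set_option maxHeartbeats 2000000 in
lemma signed_cover (k : ℕ) : ∀ (κ K : ℝ), 0 < κ → 0 < K → ∃ (s : ℕ) (B : ℕ) (K' : ℝ), 
    ∀ (X : ℝ), 1 ≤ X → ∀ c : ℕ → ℝ, (∀ i, 1 ≤ i → i ≤ k + 1 → κ * X ^ (k + 1 - i) ≤ c i) →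
    (∀ i, 1 ≤ i → i ≤ k + 1 → |c i| ≤ K * X ^ (k + 1 - i)) → ∀ R : ℝ, |R| ≤ K * X ^ k →
    ∃ y, SR (pol (k + 1) c) s (B * X) y ∧ |R - y| ≤ K' := by
  induction k with
  | zero =>
    intro κ K hκ hK
    refine ⟨0, 0, K, fun X hX c _ _ R hR => ⟨0, ⟨0, 0, by simp, by simp, by simp, by simp, by simp⟩, by simpa using hR⟩⟩
  | succ k ih =>
    intro κ K hκ hK
    set B1 : ℕ := ⌈K / κ⌉₊ + 1 with hB1
    have hB1' : K / κ ≤ B1 := by rw [hB1]; push_cast; linarith [Nat.le_ceil (K / κ)]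
    have hB1'' : (1 : ℝ) ≤ B1 := by rw [hB1]; push_cast; linarith [Nat.cast_nonneg (α := ℝ) ⌈K / κ⌉₊]
    set E : ℝ := ((k + 2 : ℕ) + 1) * (2 * K * (B1 : ℝ) ^ (k + 2)) with hE
    have hE0 : 0 ≤ E := by positivity
    set K1 : ℝ := (2 * K + 4 * E) + (((k + 1 : ℕ) : ℝ) + 2) * (K * (2 ^ (k + 1 + 1) * 2)) with hK1
    have hK1pos : 0 < K1 := by positivity
    obtain ⟨s, B, K', hmain⟩ := ih κ K1 hκ hK1pos
    refine ⟨(2 + 2 + 2 + 2) + (s + s), B1 + (2 * B + 2), K', fun X hX c hcl hcu R hR => ?_⟩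
    have hX0 : 0 < X := by linarith
    have hc2 : κ * X ^ k ≤ c 2 := by simpa using hcl 2 (by omega) (by omega)
    have hc2u : c 2 ≤ K * X ^ k := by simpa using (le_abs_self _).trans (hcu 2 (by omega) (by omega))
    have hXk : 0 < X ^ k := by positivity
    have hc2p : 0 < c 2 := lt_of_lt_of_le (by positivity) hc2
    set n : ℕ := ⌊|R| / (2 * c 2)⌋₊ with hn
    have hn1 : (n : ℝ) * (2 * c 2) ≤ |R| := by
      rw [← le_div_iff₀ (by positivity)]; exact Nat.floor_le (by positivity)
    have hn2 : |R| < (n + 1) * (2 * c 2) := by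
      rw [← div_lt_iff₀ (by positivity)]; exact Nat.lt_floor_add_one _
    have hn3 : (n : ℝ) ≤ B1 * X := by
      have h1 : (n : ℝ) * (κ * X ^ k) ≤ K * X ^ (k + 1) := by
        have : (n : ℝ) * (κ * X ^ k) ≤ n * (2 * c 2) := mul_le_mul_of_nonneg_left (by linarith) (Nat.cast_nonneg n)
        linarith
      have h2 : (n : ℝ) * κ ≤ K * X := by
        rw [pow_succ] at h1
        nlinarith
      have h3 : (n : ℝ) ≤ K / κ * X := by
        rw [div_mul_eq_mul_div, le_div_iff₀ hκ]; exact h2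
      exact h3.trans (by gcongr)
    obtain ⟨u1, u2, u3, u4, hu⟩ := Nat.sum_four_squares n
    have hu' : (u1 : ℝ) ^ 2 + (u2 : ℝ) ^ 2 + (u3 : ℝ) ^ 2 + (u4 : ℝ) ^ 2 = n := by exact_mod_cast hu
    set F := pol (k + 1 + 1) c with hF
    have hH : (B1 : ℝ) * X ≤ ((B1 + (2 * B + 2) : ℕ) : ℝ) * X := by
      gcongr; omega
    have hSR2 : ∀ u : ℕ, (u : ℝ) ^ 2 ≤ n → SR F 2 (((B1 + (2 * B + 2) : ℕ) : ℝ) * X) (F u + F (-u) - 2 * F 0) := by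
      intro u hu
      have h1 : ((u : ℤ) : ℝ) ^ 2 ≤ ((B1 + (2 * B + 2) : ℕ) : ℝ) * X := by
        push_cast at hH ⊢; linarith
      have h0 : ((0 : ℤ) : ℝ) ^ 2 ≤ ((B1 + (2 * B + 2) : ℕ) : ℝ) * X := by
        simp; positivity
      have h2 : ((-(u : ℤ) : ℤ) : ℝ) ^ 2 ≤ ((B1 + (2 * B + 2) : ℕ) : ℝ) * X := by
        push_cast at h1 ⊢; rw [neg_sq]; exact h1
      have := (SR.one (F := F) h1 h0).add (SR.one (F := F) h2 h0)
      convert this using 1; ring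
    have heven : ∀ u : ℕ, (u : ℝ) ^ 2 ≤ n → |F u + F (-u) - 2 * F 0 - 2 * c 2 * (u : ℝ) ^ 2| ≤ E * X ^ k := by
      intro u hu
      have := even_part (k + 2) c K X B1 hK hX hB1'' (by omega) hcu u (by push_cast; linarith)
      simpa [hE] using this
    have q1 : (u1 : ℝ) ^ 2 ≤ n := by nlinarith [sq_nonneg (u2 : ℝ), sq_nonneg (u3 : ℝ), sq_nonneg (u4 : ℝ)]
    have q2 : (u2 : ℝ) ^ 2 ≤ n := by nlinarith [sq_nonneg (u1 : ℝ), sq_nonneg (u3 : ℝ), sq_nonneg (u4 : ℝ)]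
    have q3 : (u3 : ℝ) ^ 2 ≤ n := by nlinarith [sq_nonneg (u2 : ℝ), sq_nonneg (u1 : ℝ), sq_nonneg (u4 : ℝ)]
    have q4 : (u4 : ℝ) ^ 2 ≤ n := by nlinarith [sq_nonneg (u2 : ℝ), sq_nonneg (u3 : ℝ), sq_nonneg (u1 : ℝ)]
    have hS := (((hSR2 u1 q1).add (hSR2 u2 q2)).add (hSR2 u3 q3)).add (hSR2 u4 q4)
    set y0 := (F u1 + F (-u1) - 2 * F 0) + (F u2 + F (-u2) - 2 * F 0) + (F u3 + F (-u3) - 2 * F 0) + (F u4 + F (-u4) - 2 * F 0) with hy0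
    have hy0b : abs (|R| - y0) ≤ (2 * K + 4 * E) * X ^ k := by
      have a1 := abs_le.1 (heven u1 q1)
      have a2 := abs_le.1 (heven u2 q2)
      have a3 := abs_le.1 (heven u3 q3)
      have a4 := abs_le.1 (heven u4 q4)
      have hs : 2 * c 2 * (u1 : ℝ) ^ 2 + 2 * c 2 * (u2 : ℝ) ^ 2 + 2 * c 2 * (u3 : ℝ) ^ 2 + 2 * c 2 * (u4 : ℝ) ^ 2 = n * (2 * c 2) := by
        rw [← hu']; ring
      have hn2' : |R| < n * (2 * c 2) + 2 * c 2 := by rw [add_mul, one_mul] at hn2; exact hn2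
      have p1 : 0 ≤ K * X ^ k := by positivity
      have p2 : 0 ≤ E * X ^ k := by positivity
      have e1 : (2 * K + 4 * E) * X ^ k = 2 * (K * X ^ k) + 4 * (E * X ^ k) := by ring
      rw [e1, abs_le]
      obtain ⟨a11, a12⟩ := a1
      obtain ⟨a21, a22⟩ := a2
      obtain ⟨a31, a32⟩ := a3
      obtain ⟨a41, a42⟩ := a4
      constructor
      · linarith
      · linarith
    obtain ⟨y1, hy1, hy1b⟩ : ∃ y1, SR F (2 + 2 + 2 + 2) (((B1 + (2 * B + 2) : ℕ) : ℝ) * X) y1 ∧ |R - y1| ≤ (2 * K + 4 * E) * X ^ k := by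
      rcases le_total 0 R with h | h
      · rw [abs_of_nonneg h] at hy0b
        exact ⟨y0, hS, hy0b⟩
      · refine ⟨-y0, hS.neg, ?_⟩
        rw [abs_of_nonpos h] at hy0b
        rw [← abs_neg]; convert hy0b using 2; ring
    obtain ⟨y2, hy2, hy2b⟩ := hmain X hX (dco (k + 1 + 1) c)
      (fun i h1 h2 => dco_lower (k + 1) c κ X hκ hX hcl i h1 h2)
      (fun i h1 h2 => (dco_upper (k + 1) c K X hK hX hcu i h1 h2).trans (by
        gcongr
        rw [hK1]
        have : 0 ≤ 2 * K + 4 * E := by positivity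
        linarith)) (R - y1) (hy1b.trans (by
        gcongr
        rw [hK1]
        have : 0 ≤ (((k + 1 : ℕ) : ℝ) + 2) * (K * (2 ^ (k + 1 + 1) * 2)) := by positivity
        linarith))
    refine ⟨y1 + y2, hy1.add ((SR.diff (pol_diff (k + 1) c) hy2).mono ?_), ?_⟩
    · push_cast
      nlinarith [Nat.cast_nonneg (α := ℝ) B, Nat.cast_nonneg (α := ℝ) B1]
    · rwa [← sub_sub]
end

section

lemma taylor_r (n : ℕ) (r : ℝ → ℝ) (hr : ContDiffOn ℝ (n + 1 : ℕ) r (Set.Ici 1)) (x0 x : ℝ) (h0 : 1 < x0)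
    (hx : 1 ≤ x) : ∃ ξ, min x0 x ≤ ξ ∧ r x = ∑ j ∈ range (n + 1),
      iteratedDerivWithin j r (Set.Ici 1) x0 / (j.factorial : ℝ) * (x - x0) ^ j +
      iteratedDerivWithin (n + 1) r (Set.Ici 1) ξ * (x - x0) ^ (n + 1) / ((n + 1).factorial : ℝ) := by
  rcases eq_or_ne x0 x with rfl | hne
  · refine ⟨x0, by simp, ?_⟩
    rw [sum_range_succ']
    simp
  have hsub : Set.uIcc x0 x ⊆ Set.Ici 1 := by
    intro y hy
    exact (le_min h0.le hx).trans hy.1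
  have hr' : ContDiffOn ℝ (n + 1) r (Set.uIcc x0 x) := by
    exact_mod_cast hr.mono hsub
  obtain ⟨ξ, h1, h2⟩ := taylor_mean_remainder_lagrange_iteratedDeriv hne hr'
  have hξ : 1 < ξ := lt_of_le_of_lt (le_min h0.le hx) h1.1
  refine ⟨ξ, h1.1.le, ?_⟩
  have e1 : iteratedDerivWithin (n + 1) r (Set.Ici 1) ξ = iteratedDeriv (n + 1) r ξ :=
    iteratedDerivWithin_eq_iteratedDeriv (uniqueDiffOn_Ici 1) (hr.contDiffAt (Ici_mem_nhds hξ)) hξ.le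
  have hc0 : ContDiffAt ℝ (n + 1 : ℕ) r x0 := hr.contDiffAt (Ici_mem_nhds h0)
  rw [e1]
  rw [taylor_within_apply] at h2
  rw [← h2]
  have : ∑ j ∈ range (n + 1), iteratedDerivWithin j r (Set.Ici 1) x0 / (j.factorial : ℝ) * (x - x0) ^ j =
     ∑ k ∈ range (n + 1), ((k.factorial : ℝ)⁻¹ * (x - x0) ^ k) • iteratedDerivWithin k r (Set.uIcc x0 x) x0 := by
    refine sum_congr rfl fun j hj => ?_
    have hj' : (j : WithTop ℕ∞) ≤ (n + 1 : ℕ) := by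
      have : j ≤ n + 1 := by simp at hj; omega
      exact_mod_cast this
    rw [iteratedDerivWithin_eq_iteratedDeriv (uniqueDiffOn_Ici 1) (hc0.of_le hj') h0.le,
      iteratedDerivWithin_eq_iteratedDeriv (uniqueDiffOn_uIcc hne) (hc0.of_le hj') Set.left_mem_uIcc,
      smul_eq_mul]
    ring
  rw [this]; ring

lemma rem_bound (k : ℕ) (hk : 1 ≤ k) (δ : ℝ) (hδ : δ < 1 / 2) (B X h ξ : ℝ) (hB : 0 ≤ B)
    (hX : 2 ≤ X) (hh : h ^ 2 ≤ B * X) (hξ : X / 2 ≤ ξ) :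
    ξ ^ (δ - k) * |h| ^ k ≤ 1 + (2 * B) ^ k := by
  have hξ1 : 1 ≤ ξ := by linarith
  have hξ0 : 0 < ξ := by linarith
  set t := ξ ^ (δ - k) * |h| ^ k with ht
  have ht2 : t ^ 2 ≤ (2 * B) ^ k := by
    have e : t ^ 2 = ξ ^ (2 * δ - 2 * k) * (h ^ 2) ^ k := by
      rw [ht, mul_pow, ← Real.rpow_mul_natCast hξ0.le, ← pow_mul, mul_comm k 2, pow_mul, sq_abs]
      congr 2; push_cast; ring
    have h1 : (h ^ 2) ^ k ≤ (2 * B) ^ k * ξ ^ (k : ℝ) := by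
      rw [Real.rpow_natCast, ← mul_pow]
      gcongr
      nlinarith
    rw [e]
    calc ξ ^ (2 * δ - 2 * k) * (h ^ 2) ^ k ≤ ξ ^ (2 * δ - 2 * k) * ((2 * B) ^ k * ξ ^ (k : ℝ)) := by gcongr
      _ = (2 * B) ^ k * (ξ ^ (2 * δ - 2 * k + k)) := by rw [Real.rpow_add hξ0]; ring
      _ ≤ (2 * B) ^ k * 1 := by
        gcongr
        apply Real.rpow_le_one_of_one_le_of_nonpos hξ1
        have : (1 : ℝ) ≤ k := by exact_mod_cast hk
        linarith
      _ = _ := mul_one _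
  nlinarith [sq_nonneg (t - 1)]

set_option maxHeartbeats 1000000 in
lemma taylor_f (k : ℕ) (hk : 1 ≤ k) (α : ℕ → ℝ) (hα : 0 < α k)
    (δ : ℝ) (hδ : δ < 1 / 2)
    (r : ℝ → ℝ) (hr : ContDiffOn ℝ k r (Set.Ici 1))
    (hbound : ∀ j : ℕ, j ≤ k → ∃ Cj : ℝ, ∀ x : ℝ, 1 ≤ x →
      |iteratedDerivWithin j r (Set.Ici 1) x| ≤ Cj * x ^ (δ - j))
    (f : ℝ → ℝ) (hf : ∀ x : ℝ, f x = (∑ i ∈ Finset.Icc 1 k, α i * x ^ i) + r x) :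
    ∃ κ K : ℝ, 0 < κ ∧ 0 < K ∧ ∀ B : ℝ, 0 ≤ B → ∃ (E : ℝ) (X1 : ℕ), ∀ X : ℕ, X1 ≤ X → ∃ c : ℕ → ℝ,
      (∀ i, 1 ≤ i → i ≤ k → κ * (X : ℝ) ^ (k - i) ≤ c i ∧ |c i| ≤ K * (X : ℝ) ^ (k - i)) ∧
      ∀ h : ℤ, (h : ℝ) ^ 2 ≤ B * X → (1 : ℝ) ≤ X + h ∧ |f (X + h) - pol k c h| ≤ E := by
  choose! C hC using hbound
  set C0 : ℝ := ∑ j ∈ range (k + 1), |C j| with hC0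
  have hC0n : 0 ≤ C0 := sum_nonneg fun _ _ => abs_nonneg _
  have hC' : ∀ j ≤ k, ∀ x : ℝ, 1 ≤ x → |iteratedDerivWithin j r (Set.Ici 1) x| ≤ C0 * x ^ (δ - j) := by
    intro j hj x hx
    refine (hC j hj x hx).trans ?_
    gcongr
    refine (le_abs_self _).trans ?_
    exact single_le_sum (f := fun j => |C j|) (fun _ _ => abs_nonneg _) (by simp; omega)
  set A : ℝ := ∑ i ∈ Icc 1 k, |α i| with hA
  have hAn : 0 ≤ A := sum_nonneg fun _ _ => abs_nonneg _
  set M : ℝ := A * 2 ^ k + C0 with hM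
  have hMn : 0 ≤ M := by positivity
  refine ⟨α k / 2, α k * (2 ^ k + 1), by positivity, by positivity, fun B hB => 
    ⟨C0 * (1 + (2 * B) ^ k), ⌈2 * M / α k⌉₊ + ⌈4 * B⌉₊ + 2, fun X hX => ?_⟩⟩
  have hX' : ((⌈2 * M / α k⌉₊ + ⌈4 * B⌉₊ + 2 : ℕ) : ℝ) ≤ X := by exact_mod_cast hX
  push_cast at hX'
  have hXM : 2 * M / α k ≤ X := by
    linarith [Nat.le_ceil (2 * M / α k), Nat.cast_nonneg (α := ℝ) ⌈4 * B⌉₊]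
  have hXB : 4 * B ≤ X := by
    linarith [Nat.le_ceil (4 * B), Nat.cast_nonneg (α := ℝ) ⌈2 * M / α k⌉₊]
  have hX2 : (2 : ℝ) ≤ X := by
    linarith [Nat.cast_nonneg (α := ℝ) ⌈4 * B⌉₊, Nat.cast_nonneg (α := ℝ) ⌈2 * M / α k⌉₊]
  clear hX'
  generalize hx : (X : ℝ) = x at *
  have hx0 : 0 < x := by linarith
  have hx1 : 1 ≤ x := by linarith
  set D : ℕ → ℝ := fun j => if j < k then iteratedDerivWithin j r (Set.Ici 1) x / (j.factorial : ℝ) else 0 with hD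
  refine ⟨fun j => (∑ l ∈ Icc 1 k, α l * (l.choose j : ℝ) * x ^ (l - j)) + D j, ?_, ?_⟩
  · intro i hi1 hik
    have key : |(∑ l ∈ Icc 1 k, α l * (l.choose i : ℝ) * x ^ (l - i)) + D i - α k * (k.choose i : ℝ) * x ^ (k - i)| * x 
        ≤ M * x ^ (k - i) := by
      have e : (∑ l ∈ Icc 1 k, α l * (l.choose i : ℝ) * x ^ (l - i)) - α k * (k.choose i : ℝ) * x ^ (k - i)
         = ∑ l ∈ (Icc 1 k).erase k, α l * (l.choose i : ℝ) * x ^ (l - i) := by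
        rw [← add_sum_erase _ _ (show k ∈ Icc 1 k by simp; omega)]; ring
      have b1 : |∑ l ∈ (Icc 1 k).erase k, α l * (l.choose i : ℝ) * x ^ (l - i)| * x ≤ A * 2 ^ k * x ^ (k - i) := by
        calc _ ≤ (∑ l ∈ (Icc 1 k).erase k, |α l * (l.choose i : ℝ) * x ^ (l - i)|) * x := by
              gcongr; exact abs_sum_le_sum_abs _ _
          _ = ∑ l ∈ (Icc 1 k).erase k, |α l * (l.choose i : ℝ) * x ^ (l - i)| * x := by rw [sum_mul]
          _ ≤ ∑ l ∈ (Icc 1 k).erase k, |α l| * (2 ^ k * x ^ (k - i)) := by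
              refine sum_le_sum fun l hl => ?_
              have hl' : 1 ≤ l ∧ l < k := by simp at hl; omega
              rw [abs_mul, abs_mul, Nat.abs_cast, abs_of_nonneg (show 0 ≤ x ^ (l - i) by positivity)]
              rcases Nat.lt_or_ge l i with h | h
              · rw [Nat.choose_eq_zero_of_lt h]; simp; positivity
              · have h3 : (l.choose i : ℝ) ≤ 2 ^ k := by
                  have := (Nat.choose_le_two_pow l i).trans (Nat.pow_le_pow_right (n := 2) (by norm_num) hl'.2.le)
                  exact_mod_cast this
                calc |α l| * (l.choose i : ℝ) * x ^ (l - i) * x = |α l| * ((l.choose i : ℝ) * x ^ (l - i + 1)) := by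
                      rw [pow_succ]; ring
                  _ ≤ _ := by
                      gcongr
                      omega
          _ ≤ ∑ l ∈ (Icc 1 k), |α l| * (2 ^ k * x ^ (k - i)) := by
              refine sum_le_sum_of_subset_of_nonneg (erase_subset _ _) fun l _ _ => by positivity
          _ = _ := by rw [← sum_mul]; ring
      have b2 : |D i| * x ≤ C0 * x ^ (k - i) := by
        rcases Nat.lt_or_ge i k with h | h
        · have h1 := hC' i hik x hx1
          have h2 : x ^ (δ - i) ≤ 1 := by
            apply Real.rpow_le_one_of_one_le_of_nonpos hx1
            have : (1 : ℝ) ≤ i := by exact_mod_cast hi1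
            linarith
          have h3 : |D i| ≤ C0 := by
            rw [hD]; simp only [if_pos h]
            rw [abs_div, Nat.abs_cast]
            refine (div_le_self (abs_nonneg _) (by exact_mod_cast Nat.one_le_iff_ne_zero.2 (Nat.factorial_ne_zero i))).trans ?_
            refine h1.trans ?_
            nlinarith
          have h4 : x ≤ x ^ (k - i) := le_self_pow₀ hx1 (by omega)
          gcongr
        · rw [hD]; simp only [if_neg (not_lt.2 h)]; simp; positivity
      have e2 : (∑ l ∈ Icc 1 k, α l * (l.choose i : ℝ) * x ^ (l - i)) + D i - α k * (k.choose i : ℝ) * x ^ (k - i)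
        = (∑ l ∈ (Icc 1 k).erase k, α l * (l.choose i : ℝ) * x ^ (l - i)) + D i := by rw [← e]; ring
      rw [e2, hM, add_mul]
      calc _ ≤ (|∑ l ∈ (Icc 1 k).erase k, α l * (l.choose i : ℝ) * x ^ (l - i)| + |D i|) * x := by
            gcongr; exact abs_add_le _ _
        _ ≤ _ := by rw [add_mul]; linarith
    set ci := (∑ l ∈ Icc 1 k, α l * (l.choose i : ℝ) * x ^ (l - i)) + D i with hci
    have hMx : M ≤ α k / 2 * x := by
      rw [div_le_iff₀ hα] at hXM; linarith
    have key2 : |ci - α k * (k.choose i : ℝ) * x ^ (k - i)| ≤ α k / 2 * x ^ (k - i) := by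
      have : |ci - α k * (k.choose i : ℝ) * x ^ (k - i)| * x ≤ (α k / 2 * x ^ (k - i)) * x := by
        refine key.trans ?_
        calc M * x ^ (k - i) ≤ (α k / 2 * x) * x ^ (k - i) := by gcongr
          _ = _ := by ring
      exact le_of_mul_le_mul_right this hx0
    have hch1 : (1 : ℝ) ≤ k.choose i := by exact_mod_cast Nat.choose_pos hik
    have hch2 : (k.choose i : ℝ) ≤ 2 ^ k := by exact_mod_cast Nat.choose_le_two_pow k i
    have hp : 0 < α k * x ^ (k - i) := by positivity
    have m1 : α k * x ^ (k - i) ≤ α k * (k.choose i : ℝ) * x ^ (k - i) := by nlinarith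
    have m2 : α k * (k.choose i : ℝ) * x ^ (k - i) ≤ α k * 2 ^ k * x ^ (k - i) := by gcongr
    have k2 := abs_le.1 key2
    constructor
    · linarith [k2.1]
    · rw [abs_le]
      have : α k * (2 ^ k + 1) * x ^ (k - i) = α k * 2 ^ k * x ^ (k - i) + α k * x ^ (k - i) := by ring
      rw [this]
      constructor <;> linarith [k2.1, k2.2]
  · intro h hh
    have hhx : |(h : ℝ)| ≤ x / 2 := by
      have q : (h : ℝ) ^ 2 ≤ (x / 2) ^ 2 := by nlinarith
      exact abs_le_of_sq_le_sq q (by linarith)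
    have hhl := (abs_le.1 hhx).1
    have h1 : 1 ≤ x + h := by linarith
    refine ⟨h1, ?_⟩
    obtain ⟨n, rfl⟩ : ∃ n, k = n + 1 := ⟨k - 1, by omega⟩
    obtain ⟨ξ, hξ, hT⟩ := taylor_r n r hr x (x + h) (by linarith) h1
    have hξ' : x / 2 ≤ ξ := le_trans (le_min (by linarith) (by linarith)) hξ
    have e1 : pol (n + 1) (fun j => (∑ l ∈ Icc 1 (n + 1), α l * (l.choose j : ℝ) * x ^ (l - j)) + D j) h = 
        ∑ i ∈ Icc 1 (n + 1), α i * (x + h) ^ i + ∑ j ∈ range (n + 1), iteratedDerivWithin j r (Set.Ici 1) x / (j.factorial : ℝ) * (h : ℝ) ^ j := by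
      unfold pol
      simp only [add_mul]
      rw [sum_add_distrib]
      congr 1
      · simp only [sum_mul]
        rw [sum_comm]
        refine sum_congr rfl fun l hl => ?_
        have hl' : l ≤ n + 1 := (mem_Icc.1 hl).2
        rw [add_comm x, add_pow, mul_sum]
        rw [← sum_subset (range_mono (show l + 1 ≤ n + 1 + 1 by omega))]
        · refine sum_congr rfl fun i _ => ?_
          ring
        · intro i _ hi
          have : l < i := by simp at hi; omega
          rw [Nat.choose_eq_zero_of_lt this]; simp
      · rw [sum_range_succ]
        simp only [hD, lt_irrefl, if_false, zero_mul, add_zero]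
        refine sum_congr rfl fun j hj => ?_
        rw [if_pos (by simpa using hj)]
    have e2 : f (x + h) - pol (n + 1) (fun j => (∑ l ∈ Icc 1 (n + 1), α l * (l.choose j : ℝ) * x ^ (l - j)) + D j) h = 
       iteratedDerivWithin (n + 1) r (Set.Ici 1) ξ * (h : ℝ) ^ (n + 1) / ((n + 1).factorial : ℝ) := by
      rw [e1, hf, hT]
      simp only [add_sub_cancel_left]
      ring
    rw [e2, abs_div, Nat.abs_cast]
    refine (div_le_self (abs_nonneg _) (by exact_mod_cast Nat.one_le_iff_ne_zero.2 (Nat.factorial_ne_zero _))).trans ?_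
    rw [abs_mul, abs_pow]
    calc _ ≤ (C0 * ξ ^ (δ - (n + 1 : ℕ))) * |(h : ℝ)| ^ (n + 1) := by
          gcongr
          exact hC' (n + 1) le_rfl ξ (by linarith)
      _ = C0 * (ξ ^ (δ - (n + 1 : ℕ)) * |(h : ℝ)| ^ (n + 1)) := by ring
      _ ≤ _ := by
          gcongr
          exact rem_bound (n + 1) hk δ hδ B x h ξ hB hX2 hh hξ'
end

section

lemma ms_close {ι : Type*} (F G : ι → ℝ) (E : ℝ) (S : Multiset ι) : (∀ h ∈ S, |F h - G h| ≤ E) →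
    |(S.map F).sum - (S.map G).sum| ≤ Multiset.card S * E := by
  induction S using Multiset.induction_on with
  | empty => simp
  | cons a S ih =>
    intro h
    have h1 := h a (Multiset.mem_cons_self a S)
    have h2 := ih fun b hb => h b (Multiset.mem_cons_of_mem hb)
    rw [Multiset.map_cons, Multiset.map_cons, Multiset.sum_cons, Multiset.sum_cons, Multiset.card_cons]
    push_cast
    rw [abs_le] at *
    constructor <;> linarith [h1.1, h1.2, h2.1, h2.2]

lemma pol_ms (k : ℕ) (c : ℕ → ℝ) (S : Multiset ℤ) :
    (S.map (pol k c)).sum = ∑ j ∈ range (k + 1), c j * (S.map (fun y : ℤ => (y : ℝ) ^ j)).sum := by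
  induction S using Multiset.induction_on with
  | empty => simp
  | cons a S ih =>
    simp only [Multiset.map_cons, Multiset.sum_cons, ih, mul_add, sum_add_distrib]
    rfl

set_option maxHeartbeats 2000000 in
lemma model_cover (k : ℕ) (hk : 1 ≤ k) (κ K : ℝ) (hκ : 0 < κ) (hK : 0 < K) : ∃ T H : ℕ, 0 < T ∧
    ∀ C : ℝ, 0 ≤ C → ∃ (K' : ℝ) (X2 : ℕ), ∀ X : ℕ, X2 ≤ X → ∀ c : ℕ → ℝ,
      (∀ i, 1 ≤ i → i ≤ k → κ * (X : ℝ) ^ (k - i) ≤ c i ∧ |c i| ≤ K * (X : ℝ) ^ (k - i)) →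
      ∀ N : ℝ, |N - T * c 0| ≤ C * (X : ℝ) ^ (k - 1) → ∃ S : Multiset ℤ, Multiset.card S = T ∧
        (∀ h ∈ S, (h : ℝ) ^ 2 ≤ H * X) ∧ |(S.map (pol k c)).sum - N| ≤ K' := by
  obtain ⟨a, w, μ, ha, hμ1, hμ2, hil⟩ := hilbert_minus k
  have hμ0 : μ 0 = 1 + w := by
    obtain ⟨S, hS, -, h⟩ := hil 0 0 (by simp)
    have := h 0 (by omega)
    simp [hS] at this
    exact this.symm
  have ha1 : (1 : ℝ) ≤ a := by exact_mod_cast ha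
  have hak : (1 : ℝ) ≤ (a : ℝ) ^ k := one_le_pow₀ ha1
  obtain ⟨s, B, K', hsc⟩ := signed_cover (k - 1) κ (3 * K * (a : ℝ) ^ k) hκ (by positivity)
  have hkk : k - 1 + 1 = k := by omega
  rw [hkk] at hsc
  refine ⟨(s + 1) * (1 + w), ⌈μ 2⌉₊ * (B + 1) + a ^ 2 * (B + 1), by positivity, fun C hC => ?_⟩
  set C1 : ℝ := C + (s + 1) * ((∑ j ∈ range (k + 1), |μ j|) * (K * ((B : ℝ) + 1) ^ k)) with hC1
  have hC1n : 0 ≤ C1 := by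
    have : 0 ≤ ∑ j ∈ range (k + 1), |μ j| := sum_nonneg fun _ _ => abs_nonneg _
    positivity
  set M1 : ℝ := C1 / κ + 1 with hM1
  have hM1p : 1 ≤ M1 := by rw [hM1]; have : 0 ≤ C1 / κ := by positivity
                           linarith
  refine ⟨K', ⌈M1 ^ 2⌉₊ + ⌈(k + 1) * M1 ^ k⌉₊ + 1, fun X hX c hc N hN => ?_⟩
  have hX' : ((⌈M1 ^ 2⌉₊ + ⌈(k + 1) * M1 ^ k⌉₊ + 1 : ℕ) : ℝ) ≤ X := by exact_mod_cast hX
  push_cast at hX'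
  have g1 := Nat.le_ceil (M1 ^ 2)
  have g2 := Nat.le_ceil ((k + 1) * M1 ^ k)
  have g3 := Nat.cast_nonneg (α := ℝ) ⌈M1 ^ 2⌉₊
  have g4 := Nat.cast_nonneg (α := ℝ) ⌈(k + 1) * M1 ^ k⌉₊
  have hXM : M1 ^ 2 ≤ X := by linarith
  have hXk : (k + 1) * M1 ^ k ≤ X := by linarith
  have hx1 : (1 : ℝ) ≤ X := by linarith
  clear hX' g1 g2 g3 g4
  have hx0 : (0 : ℝ) < X := by linarith
  set x : ℝ := (X : ℝ) with hx
  set Q : ℕ := (B + 1) * X with hQ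
  have hQr : (Q : ℝ) = ((B : ℝ) + 1) * x := by rw [hQ]; push_cast; rfl
  set Φ : ℝ := ∑ j ∈ range (k + 1), c j * (μ j * (Q : ℝ) ^ (j / 2)) with hΦ
  have hil' : ∀ z : ℤ, (z : ℝ) ^ 2 ≤ Q → ∃ S : Multiset ℤ, Multiset.card S = w ∧
      (∀ y ∈ S, (y : ℝ) ^ 2 ≤ μ 2 * Q) ∧ (S.map (pol k c)).sum = Φ - pol k c (a * z) := by
    intro z hz
    obtain ⟨S, h1, h2, h3⟩ := hil Q z (by exact_mod_cast hz)
    refine ⟨S, h1, h2, ?_⟩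
    rw [pol_ms, hΦ]
    unfold pol
    rw [← sum_sub_distrib]
    refine sum_congr rfl fun j hj => ?_
    rw [← h3 j (by simp at hj; omega)]
    ring
  choose! G hG1 hG2 hG3 using hil'
  set R : ℝ := N - (s + 1) * Φ with hR
  have hRb : |R| ≤ C1 * x ^ (k - 1) := by
    have e : Φ = c 0 * (1 + w) + ∑ j ∈ range k, c (j + 1) * (μ (j + 1) * (Q : ℝ) ^ ((j + 1) / 2)) := by
      rw [hΦ, sum_range_succ', hμ0]; simp; ring
    have b : |∑ j ∈ range k, c (j + 1) * (μ (j + 1) * (Q : ℝ) ^ ((j + 1) / 2))| ≤ 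
        ((∑ j ∈ range (k + 1), |μ j|) * (K * ((B : ℝ) + 1) ^ k)) * x ^ (k - 1) := by
      calc _ ≤ ∑ j ∈ range k, |c (j + 1) * (μ (j + 1) * (Q : ℝ) ^ ((j + 1) / 2))| := abs_sum_le_sum_abs _ _
        _ ≤ ∑ j ∈ range k, |μ (j + 1)| * (K * ((B : ℝ) + 1) ^ k * x ^ (k - 1)) := by
          refine sum_le_sum fun j hj => ?_
          have hj' : j < k := by simpa using hj
          rcases Nat.eq_zero_or_pos j with rfl | hj0
          · simp [hμ1]
          · rw [abs_mul, abs_mul, abs_pow, Nat.abs_cast, hQr, mul_pow]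
            have h1 := (hc (j + 1) (by omega) (by omega)).2
            calc _ ≤ (K * x ^ (k - (j + 1))) * (|μ (j + 1)| * (((B : ℝ) + 1) ^ k * x ^ ((j + 1) / 2))) := by
                  gcongr
                  · linarith [Nat.cast_nonneg (α := ℝ) B]
                  · omega
              _ = |μ (j + 1)| * (K * ((B : ℝ) + 1) ^ k * x ^ (k - (j + 1) + (j + 1) / 2)) := by rw [pow_add]; ring
              _ ≤ _ := by
                  gcongr
                  omega
        _ = (∑ j ∈ range k, |μ (j + 1)|) * (K * ((B : ℝ) + 1) ^ k * x ^ (k - 1)) := by rw [sum_mul]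
        _ ≤ (∑ j ∈ range (k + 1), |μ j|) * (K * ((B : ℝ) + 1) ^ k * x ^ (k - 1)) := by
          gcongr
          rw [sum_range_succ' _ k]
          linarith [abs_nonneg (μ 0)]
        _ = _ := by ring
    set Sg := ∑ j ∈ range k, c (j + 1) * (μ (j + 1) * (Q : ℝ) ^ ((j + 1) / 2)) with hSg
    have e2 : R = (N - ((s + 1) * (1 + w) : ℕ) * c 0) - (s + 1) * Sg := by
      rw [hR, e]; push_cast; ring
    rw [e2, hC1, add_mul C]
    refine (abs_sub _ _).trans (add_le_add hN ?_)
    rw [abs_mul, abs_of_nonneg (show (0 : ℝ) ≤ s + 1 by positivity), mul_assoc]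
    gcongr
  set c' : ℕ → ℝ := fun i => c i * (a : ℝ) ^ i with hc'
  have hpol : ∀ z : ℤ, pol k c' z = pol k c (a * z) := by
    intro z
    unfold pol
    refine sum_congr rfl fun i _ => ?_
    rw [hc']; push_cast; ring
  have hc'l : ∀ i, 1 ≤ i → i ≤ k → κ * x ^ (k - i) ≤ c' i := by
    intro i h1 h2
    have h3 := (hc i h1 h2).1
    have h4 : (1 : ℝ) ≤ (a : ℝ) ^ i := one_le_pow₀ ha1
    have h5 : 0 ≤ c i := le_trans (by positivity) h3
    simp only [hc']
    nlinarith
  have hc'u : ∀ i, 1 ≤ i → i ≤ k → |c' i| ≤ K * (a : ℝ) ^ k * x ^ (k - i) := by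
    intro i h1 h2
    have h3 := (hc i h1 h2).2
    have h4 : (a : ℝ) ^ i ≤ (a : ℝ) ^ k := pow_le_pow_right₀ ha1 h2
    simp only [hc']
    rw [abs_mul, abs_pow, Nat.abs_cast]
    calc _ ≤ (K * x ^ (k - i)) * (a : ℝ) ^ k := by gcongr
      _ = _ := by ring
  have hxk : 0 < x ^ (k - 1) := by positivity
  have hc1l := hc'l 1 le_rfl hk
  have hc1u := (le_abs_self _).trans (hc'u 1 le_rfl hk)
  have hc1p : 0 < c' 1 := lt_of_lt_of_le (by positivity) hc1l
  set h : ℤ := ⌊R / c' 1⌋ with hh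
  have hf1 : (h : ℝ) * c' 1 ≤ R := by
    rw [← le_div_iff₀ hc1p]; exact Int.floor_le _
  have hf2 : R < (h + 1) * c' 1 := by
    rw [← div_lt_iff₀ hc1p]; exact Int.lt_floor_add_one _
  have hq : |R / c' 1| ≤ C1 / κ := by
    rw [abs_div, abs_of_pos hc1p, div_le_div_iff₀ hc1p hκ]
    calc |R| * κ ≤ (C1 * x ^ (k - 1)) * κ := by gcongr
      _ = C1 * (κ * x ^ (k - 1)) := by ring
      _ ≤ _ := by gcongr
  have hhM : |(h : ℝ)| ≤ M1 := by
    have q1 := Int.floor_le (R / c' 1)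
    have q2 := Int.lt_floor_add_one (R / c' 1)
    rw [← hh] at q1 q2
    rw [abs_le] at *
    rw [hM1]
    constructor <;> linarith [hq.1, hq.2]
  set y1 : ℝ := pol k c' h - pol k c' 0 with hy1
  have hy1e : y1 = ∑ j ∈ range (k - 1), c' (j + 2) * (h : ℝ) ^ (j + 2) + c' 1 * h := by
    obtain ⟨n, rfl⟩ : ∃ n, k = n + 1 := ⟨k - 1, by omega⟩
    rw [hy1]
    unfold pol
    rw [sum_range_succ', sum_range_succ', sum_range_succ' (n := n + 1), sum_range_succ' (n := n)]
    simp
  have hRy : |R - y1| ≤ 3 * K * (a : ℝ) ^ k * x ^ (k - 1) := by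
    have b : |∑ j ∈ range (k - 1), c' (j + 2) * (h : ℝ) ^ (j + 2)| * x ≤ (k + 1) * M1 ^ k * (K * (a : ℝ) ^ k * x ^ (k - 1)) := by
      calc _ ≤ (∑ j ∈ range (k - 1), |c' (j + 2) * (h : ℝ) ^ (j + 2)|) * x := by
            gcongr; exact abs_sum_le_sum_abs _ _
        _ = ∑ j ∈ range (k - 1), |c' (j + 2) * (h : ℝ) ^ (j + 2)| * x := by rw [sum_mul]
        _ ≤ ∑ j ∈ range (k - 1), M1 ^ k * (K * (a : ℝ) ^ k * x ^ (k - 1)) := by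
          refine sum_le_sum fun j hj => ?_
          have hj' : j < k - 1 := by simpa using hj
          rw [abs_mul, abs_pow]
          have h1 := hc'u (j + 2) (by omega) (by omega)
          have h2 : |(h : ℝ)| ^ (j + 2) ≤ M1 ^ k := by
            calc _ ≤ M1 ^ (j + 2) := by gcongr
              _ ≤ _ := pow_le_pow_right₀ hM1p (by omega)
          calc _ ≤ (K * (a : ℝ) ^ k * x ^ (k - (j + 2))) * M1 ^ k * x := by gcongr
            _ = M1 ^ k * (K * (a : ℝ) ^ k * x ^ (k - (j + 2) + 1)) := by rw [pow_succ]; ring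
            _ ≤ _ := by
              gcongr
              omega
        _ = ((k - 1 : ℕ) : ℝ) * (M1 ^ k * (K * (a : ℝ) ^ k * x ^ (k - 1))) := by simp
        _ ≤ (k + 1) * (M1 ^ k * (K * (a : ℝ) ^ k * x ^ (k - 1))) := by
          gcongr
          have : k - 1 ≤ k + 1 := by omega
          exact_mod_cast this
        _ = _ := by ring
    have b2 : |∑ j ∈ range (k - 1), c' (j + 2) * (h : ℝ) ^ (j + 2)| ≤ K * (a : ℝ) ^ k * x ^ (k - 1) := by
      refine le_of_mul_le_mul_right (b.trans ?_) hx0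
      rw [mul_comm _ x]
      gcongr
    have b3 := abs_le.1 b2
    have e3 : 3 * K * (a : ℝ) ^ k * x ^ (k - 1) = 3 * (K * (a : ℝ) ^ k * x ^ (k - 1)) := by ring
    have p3 : 0 < K * (a : ℝ) ^ k * x ^ (k - 1) := by positivity
    rw [add_mul, one_mul] at hf2
    rw [hy1e, abs_le, e3]
    constructor <;> linarith [b3.1, b3.2]
  obtain ⟨y2, hy2, hy2b⟩ := hsc x hx1 c' hc'l (fun i h1 h2 => (hc'u i h1 h2).trans (by
    have : 0 < K * (a : ℝ) ^ k := by positivity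
    gcongr
    linarith)) (R - y1) hRy
  have hBx : (0 : ℝ) ≤ B * x := by positivity
  have hSR1 : SR (pol k c') 1 Q y1 := by
    rw [hy1]
    apply SR.one
    · rw [hQr, ← sq_abs]
      have : |(h : ℝ)| ^ 2 ≤ M1 ^ 2 := by gcongr
      linarith
    · simp
  have hSR := hSR1.add (hy2.mono (show (B : ℝ) * x ≤ Q by rw [hQr]; linarith))
  obtain ⟨S, S', s1, s2, s3, s4, s5⟩ := hSR
  refine ⟨S.map (fun z => (a : ℤ) * z) + S'.bind G, ?_, ?_, ?_⟩
  · rw [Multiset.card_add, Multiset.card_map, s1, Multiset.card_bind,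
      Multiset.map_congr rfl (fun z hz => show (Multiset.card ∘ G) z = w from hG1 z (s4 z hz))]
    simp [s2]; ring
  · intro z hz
    have p1 : (0 : ℝ) ≤ ⌈μ 2⌉₊ * (((B : ℝ) + 1) * x) := by positivity
    have p2 : (0 : ℝ) ≤ (a : ℝ) ^ 2 * (((B : ℝ) + 1) * x) := by positivity
    have e : ((⌈μ 2⌉₊ * (B + 1) + a ^ 2 * (B + 1) : ℕ) : ℝ) * x = 
      ⌈μ 2⌉₊ * (((B : ℝ) + 1) * x) + (a : ℝ) ^ 2 * (((B : ℝ) + 1) * x) := by push_cast; ring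
    rw [e]
    rcases Multiset.mem_add.1 hz with hz | hz
    · obtain ⟨u, hu, rfl⟩ := Multiset.mem_map.1 hz
      have := s3 u hu
      rw [hQr] at this
      have h3 : (a : ℝ) ^ 2 * (u : ℝ) ^ 2 ≤ (a : ℝ) ^ 2 * (((B : ℝ) + 1) * x) := by gcongr
      push_cast
      rw [mul_pow]
      linarith
    · obtain ⟨u, hu, hz⟩ := Multiset.mem_bind.1 hz
      have h1 := hG2 u (s4 u hu) z hz
      rw [hQr] at h1
      have h3 : μ 2 * (((B : ℝ) + 1) * x) ≤ ⌈μ 2⌉₊ * (((B : ℝ) + 1) * x) := by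
        gcongr; exact Nat.le_ceil _
      linarith
  · have e : ((S.map (fun z => (a : ℤ) * z) + S'.bind G).map (pol k c)).sum = (y1 + y2) + (s + 1) * Φ := by
      rw [s5, Multiset.map_add, Multiset.sum_add, Multiset.map_map, Multiset.map_bind, Multiset.sum_bind,
        Multiset.map_congr rfl (fun z hz => hG3 z (s4 z hz)), Multiset.sum_map_sub]
      rw [show (S'.map (fun _ => Φ)).sum = (s + 1) * Φ by
        rw [Multiset.map_const', Multiset.sum_replicate, s2, nsmul_eq_mul]; push_cast; ring]
      rw [Multiset.map_congr rfl (fun z _ => show (pol k c ∘ fun z => (a : ℤ) * z) z = pol k c' z from (hpol z).symm),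
        Multiset.map_congr rfl (fun z _ => (hpol z).symm)]
      ring
    rw [e, ← abs_neg]
    convert hy2b using 2
    rw [hR]; ring
end


lemma pol_zero (k : ℕ) (c : ℕ → ℝ) : pol k c 0 = c 0 := by
  unfold pol
  rw [sum_range_succ']
  simp

lemma pol_one (k : ℕ) (c : ℕ → ℝ) : pol k c 1 = c 0 + ∑ i ∈ range k, c (i + 1) := by
  unfold pol
  rw [sum_range_succ']
  simp [add_comm]

lemma pol_nat (k : ℕ) (hk : 1 ≤ k) (c : ℕ → ℝ) (hc : ∀ i, 1 ≤ i → i ≤ k → 0 ≤ c i) (m : ℕ) :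
    c 0 + c 1 * m ≤ pol k c m := by
  obtain ⟨n, rfl⟩ : ∃ n, k = n + 1 := ⟨k - 1, by omega⟩
  unfold pol
  rw [sum_range_succ', sum_range_succ']
  have : 0 ≤ ∑ i ∈ range n, c (i + 1 + 1) * (((m : ℤ) : ℝ)) ^ (i + 1 + 1) := by
    refine sum_nonneg fun i hi => ?_
    have := hc (i + 1 + 1) (by omega) (by simp at hi; omega)
    have h2 : (0 : ℝ) ≤ ((m : ℤ) : ℝ) := by simp
    positivity
  simp at this ⊢
  linarith

lemma coarse (k : ℕ) (hk : 1 ≤ k) (f : ℝ → ℝ) (κ K : ℝ) (hκ : 0 < κ) (hK : 0 < K)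
    (hT : ∀ B : ℝ, 0 ≤ B → ∃ (E : ℝ) (X1 : ℕ), ∀ X : ℕ, X1 ≤ X → ∃ c : ℕ → ℝ,
      (∀ i, 1 ≤ i → i ≤ k → κ * (X : ℝ) ^ (k - i) ≤ c i ∧ |c i| ≤ K * (X : ℝ) ^ (k - i)) ∧
      ∀ h : ℤ, (h : ℝ) ^ 2 ≤ B * X → (1 : ℝ) ≤ X + h ∧ |f (X + h) - pol k c h| ≤ E) :
    (∀ (M : ℝ) (n0 : ℕ), ∃ n : ℕ, n0 < n ∧ M < f n) ∧ ∃ (T : ℕ) (E' N0 : ℝ), ∀ N : ℝ, N0 ≤ N →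
      ∃ S : Multiset ℕ, Multiset.card S = T ∧ (∀ n ∈ S, 0 < n) ∧
        |(S.map (fun n : ℕ => f n)).sum - N| ≤ E' := by
  obtain ⟨T, H, hTp, hmod⟩ := model_cover k hk κ K hκ hK
  obtain ⟨E, X1, hX1⟩ := hT (H + 1) (by positivity)
  have hE : 0 ≤ E := by
    obtain ⟨c, -, h⟩ := hX1 X1 le_rfl
    exact (abs_nonneg _).trans (h 0 (by simp; positivity)).2
  have hunb : ∀ (M : ℝ) (n0 : ℕ), ∃ n : ℕ, n0 < n ∧ M < f n := by
    set m : ℕ := ⌈(2 * E + 1) / κ⌉₊ + 1 with hm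
    have hm1 : 2 * E + 1 ≤ κ * m := by
      have : (2 * E + 1) / κ ≤ m := (Nat.le_ceil _).trans (by rw [hm]; push_cast; linarith)
      rw [div_le_iff₀ hκ] at this; linarith
    have hstep : ∀ X : ℕ, X1 + m ^ 2 ≤ X → f X + 1 ≤ f ((X + m : ℕ) : ℝ) := by
      intro X hX
      obtain ⟨c, hc, hh⟩ := hX1 X (by omega)
      have hXm : ((m : ℝ)) ^ 2 ≤ X := by
        have : m ^ 2 ≤ X := by omega
        exact_mod_cast this
      have hX1' : (1 : ℝ) ≤ X := by
        have : 1 ≤ X := by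
          have : 0 < m ^ 2 := by positivity
          omega
        exact_mod_cast this
      have a0 := (hh 0 (by simp; positivity)).2
      have am := (hh m (by
        push_cast
        have : (0 : ℝ) ≤ H * X := by positivity
        linarith)).2
      have hpn := pol_nat k hk c (fun i h1 h2 => le_trans (by positivity) (hc i h1 h2).1) m
      have hc1 : κ ≤ c 1 := by
        have h1 := (hc 1 le_rfl hk).1
        have h2 : (1 : ℝ) ≤ (X : ℝ) ^ (k - 1) := one_le_pow₀ hX1'
        nlinarith
      have hc1m : κ * m ≤ c 1 * m := by gcongr
      rw [pol_zero] at a0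
      push_cast at a0 am ⊢
      rw [add_zero] at a0
      rw [abs_le] at a0 am
      linarith [a0.1, a0.2, am.1, am.2]
    intro M n0
    have hind : ∀ j : ℕ, f ((X1 + m ^ 2 + n0 : ℕ) : ℝ) + j ≤ f ((X1 + m ^ 2 + n0 + j * m : ℕ) : ℝ) := by
      intro j
      induction j with
      | zero => simp
      | succ j ih =>
        have := hstep (X1 + m ^ 2 + n0 + j * m) (by omega)
        rw [show X1 + m ^ 2 + n0 + (j + 1) * m = X1 + m ^ 2 + n0 + j * m + m by ring]
        push_cast at *
        linarith
    obtain ⟨j, hj⟩ := exists_nat_gt (M - f ((X1 + m ^ 2 + n0 : ℕ) : ℝ))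
    refine ⟨X1 + m ^ 2 + n0 + j * m, ?_, by linarith [hind j]⟩
    have : 0 < m ^ 2 := by positivity
    have : 0 ≤ j * m := by positivity
    omega
  refine ⟨hunb, ?_⟩
  obtain ⟨K', X2, hX2⟩ := hmod (T * (k * K + 3 * E)) (by positivity)
  set X0 : ℕ := X1 + X2 + 1 with hX0
  refine ⟨T, T * E + K', T * f X0, fun N hN => ?_⟩
  have hTr : (0 : ℝ) < T := by exact_mod_cast hTp
  have hex : ∃ m : ℕ, X0 ≤ m ∧ N < T * f ((m + 1 : ℕ) : ℝ) := by
    obtain ⟨n, h1, h2⟩ := hunb (N / T) X0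
    refine ⟨n - 1, by omega, ?_⟩
    rw [show n - 1 + 1 = n by omega]
    rw [div_lt_iff₀ hTr] at h2; linarith
  classical
  obtain ⟨X, ⟨hXX, hNX⟩, hXmin⟩ : ∃ X : ℕ, (X0 ≤ X ∧ N < T * f ((X + 1 : ℕ) : ℝ)) ∧
      ∀ m < X, ¬ (X0 ≤ m ∧ N < T * f ((m + 1 : ℕ) : ℝ)) :=
    ⟨Nat.find hex, Nat.find_spec hex, fun m hm => Nat.find_min hex hm⟩
  have hNl : T * f X ≤ N := by
    rcases Nat.eq_or_lt_of_le hXX with h | h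
    · rw [← h]; exact hN
    · by_contra hcon
      refine hXmin (X - 1) (by omega) ⟨by omega, ?_⟩
      rw [show X - 1 + 1 = X by omega]; linarith
  obtain ⟨c, hc, hh⟩ := hX1 X (by omega)
  have hx1 : (1 : ℝ) ≤ X := by
    have : 1 ≤ X := by omega
    exact_mod_cast this
  have hxk : (1 : ℝ) ≤ (X : ℝ) ^ (k - 1) := one_le_pow₀ hx1
  have a0 := (hh 0 (by simp; positivity)).2
  have a1 := (hh 1 (by
        push_cast
        have : (0 : ℝ) ≤ H * X := by positivity
        linarith)).2
  have hsum : ∑ i ∈ range k, c (i + 1) ≤ k * K * (X : ℝ) ^ (k - 1) := by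
    calc _ ≤ ∑ i ∈ range k, K * (X : ℝ) ^ (k - 1) := by
          refine sum_le_sum fun i hi => ?_
          have h1 := (le_abs_self _).trans (hc (i + 1) (by omega) (by simp at hi; omega)).2
          refine h1.trans ?_
          gcongr
          omega
      _ = _ := by rw [sum_const, card_range, nsmul_eq_mul]; ring
  rw [pol_zero] at a0
  rw [pol_one] at a1
  have hNc : |N - T * c 0| ≤ (T * (k * K + 3 * E)) * (X : ℝ) ^ (k - 1) := by
    push_cast at a0 a1 hNX
    rw [add_zero] at a0
    rw [abs_le] at a0 a1
    have u1 : f (X + 1) ≤ c 0 + (k * K + 3 * E) * (X : ℝ) ^ (k - 1) := by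
      have : E ≤ E * (X : ℝ) ^ (k - 1) := by nlinarith
      nlinarith [a1.2]
    have u2 : c 0 - (k * K + 3 * E) * (X : ℝ) ^ (k - 1) ≤ f X := by
      have : E ≤ E * (X : ℝ) ^ (k - 1) := by nlinarith
      have : 0 ≤ k * K * (X : ℝ) ^ (k - 1) := by positivity
      nlinarith [a0.1]
    have v1 := mul_le_mul_of_nonneg_left u1 hTr.le
    have v2 := mul_le_mul_of_nonneg_left u2 hTr.le
    rw [mul_add] at v1
    rw [mul_sub] at v2
    rw [abs_le, mul_assoc]
    constructor <;> linarith
  obtain ⟨S, s1, s2, s3⟩ := hX2 X (by omega) c hc N hNc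
  have s2' : ∀ h ∈ S, (h : ℝ) ^ 2 ≤ (H + 1) * X := fun h hS => (s2 h hS).trans (by linarith)
  have hpos : ∀ h ∈ S, (1 : ℤ) ≤ X + h := by
    intro h hS
    have := (hh h (s2' h hS)).1
    exact_mod_cast this
  refine ⟨S.map (fun h => ((X : ℤ) + h).toNat), by simp [s1], ?_, ?_⟩
  · intro n hn
    obtain ⟨h, hS, rfl⟩ := Multiset.mem_map.1 hn
    have := hpos h hS
    omega
  · rw [Multiset.map_map]
    have hcl := ms_close ((fun n : ℕ => f n) ∘ fun h : ℤ => ((X : ℤ) + h).toNat) (pol k c) E S (by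
      intro h hS
      have h1 := hpos h hS
      have h2 := (hh h (s2' h hS)).2
      have h3 : ((((X : ℤ) + h).toNat : ℕ) : ℝ) = X + h := by
        have : ((((X : ℤ) + h).toNat : ℕ) : ℤ) = X + h := Int.toNat_of_nonneg (by omega)
        exact_mod_cast this
      simp only [Function.comp]
      rw [h3]; exact h2)
    rw [s1] at hcl
    rw [abs_le] at *
    constructor <;> linarith [hcl.1, hcl.2, s3.1, s3.2]

lemma ms_to_fin (g : ℕ → ℤ) (S : Multiset ℕ) (hS : ∀ n ∈ S, 0 < n) (t : ℕ) (ht : Multiset.card S = t) :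
    ∃ n : Fin t → ℕ, (∀ i, 0 < n i) ∧ ∑ i, g (n i) = (S.map g).sum := by
  subst ht
  induction S using Quotient.inductionOn with
  | h l =>
    refine ⟨fun i => l.get (i.cast (by simp)), fun i => hS _ (by simp), ?_⟩
    simp only [Multiset.quot_mk_to_coe, Multiset.map_coe, Multiset.sum_coe]
    rw [← Fin.sum_univ_fun_getElem]
    rfl

theorem stmt_10 (k : ℕ) (hk : 1 ≤ k) (α : ℕ → ℝ) (hα : 0 < α k)
    (δ : ℝ) (hδ0 : 0 < δ) (hδ : δ < 1 / 2)
    (r : ℝ → ℝ) (hr : ContDiffOn ℝ k r (Set.Ici 1))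
    (hbound : ∀ j : ℕ, j ≤ k → ∃ Cj : ℝ, ∀ x : ℝ, 1 ≤ x →
      |iteratedDerivWithin j r (Set.Ici 1) x| ≤ Cj * x ^ (δ - j))
    (f : ℝ → ℝ) (hf : ∀ x : ℝ, f x = (∑ i ∈ Finset.Icc 1 k, α i * x ^ i) + r x)
    (hdense : ∀ q : ℕ, 0 < q → ∀ y ∈ Set.Ico (0 : ℝ) 1, ∀ ε : ℝ, 0 < ε →
      ∃ n : ℕ, 0 < n ∧ |Int.fract (f n / q) - y| < ε) :
    ∃ t : ℕ, ∃ N₀ : ℤ, ∀ N : ℤ, N₀ ≤ N →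
      ∃ n : Fin t → ℕ, (∀ i, 0 < n i) ∧ ∑ i, ⌊f (n i)⌋ = N := by
  obtain ⟨κ, K, hκ, hK, hT⟩ := taylor_f k hk α hα δ hδ r hr hbound f hf
  obtain ⟨hunb, T, E', N0, hcov⟩ := coarse k hk f κ K hκ hK hT
  set g : ℕ → ℤ := fun n => ⌊f n⌋ with hg
  -- the modulus
  obtain ⟨n1, hn1, hn1'⟩ := hunb (f (1 : ℕ) + 1) 0
  have hq0 : g 1 < g n1 := by
    have h1 : (⌊f (1 : ℕ)⌋ : ℝ) ≤ f (1 : ℕ) := Int.floor_le _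
    have h2 : ⌊f (1 : ℕ)⌋ + 1 ≤ ⌊f n1⌋ := by
      rw [Int.le_floor]; push_cast; push_cast at h1 hn1'; linarith
    simp only [hg]; omega
  obtain ⟨q, hq, hqp⟩ : ∃ q : ℕ, g n1 = g 1 + q ∧ 0 < q := ⟨(g n1 - g 1).toNat, by omega, by omega⟩
  have hqr : (0 : ℝ) < q := by exact_mod_cast hqp
  -- the step
  obtain ⟨n2, e, hn2, he⟩ : ∃ (n2 : ℕ) (e : ℤ), 0 < n2 ∧ g n2 = g 1 + 1 + q * e := by
    set c : ℤ := (g 1 + 1) % q with hc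
    have hc0 : 0 ≤ c := Int.emod_nonneg _ (by omega)
    have hc1 : c < q := Int.emod_lt_of_pos _ (by omega)
    have hc0' : (0 : ℝ) ≤ c := by exact_mod_cast hc0
    have hc1' : (c : ℝ) + 1 ≤ q := by exact_mod_cast hc1
    obtain ⟨n2, hn2, hd⟩ := hdense q hqp ((c + 1 / 2) / q) ⟨by positivity, by
      rw [div_lt_one hqr]; linarith⟩ (1 / (4 * q)) (by positivity)
    have hfl : g n2 = c + q * ⌊f n2 / q⌋ := by
      simp only [hg]
      rw [Int.floor_eq_iff]
      have e1 : f n2 = q * Int.fract (f n2 / q) + q * ⌊f n2 / q⌋ := by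
        rw [Int.fract]; field_simp; ring
      have e2 : |q * Int.fract (f n2 / q) - (c + 1 / 2)| < 1 / 4 := by
        have : q * Int.fract (f n2 / q) - (c + 1 / 2) = q * (Int.fract (f n2 / q) - (c + 1 / 2) / q) := by
          field_simp
        rw [this, abs_mul, abs_of_pos hqr]
        calc _ < q * (1 / (4 * (q : ℝ))) := by gcongr
          _ = 1 / 4 := by field_simp
      rw [abs_lt] at e2
      push_cast
      constructor
      · linarith [e2.1]
      · linarith [e2.2]
    refine ⟨n2, ⌊f n2 / q⌋ - (g 1 + 1) / q, hn2, ?_⟩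
    have := Int.emod_add_mul_ediv (g 1 + 1) q
    rw [hfl, mul_sub]
    linarith
  set L : ℕ := ⌈E'⌉₊ + T with hL
  set a : ℕ := e.natAbs with ha
  set A : ℤ := ((2 * L + 2 * (a * (2 * L)) : ℕ) : ℤ) * g 1 + q * (a * (2 * L)) with hA
  refine ⟨T + (2 * L + 2 * (a * (2 * L))), ⌈N0⌉ + A + L, fun N hN => ?_⟩
  obtain ⟨S, hS1, hS2, hS3⟩ := hcov ((N - A - L : ℤ) : ℝ) (by
    have h1 : (⌈N0⌉ : ℝ) ≤ ((N - A - L : ℤ) : ℝ) := by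
      have : ⌈N0⌉ ≤ N - A - L := by linarith
      exact_mod_cast this
    exact (Int.le_ceil _).trans h1)
  have hSg : |(((S.map g).sum : ℤ) : ℝ) - ((N - A - L : ℤ) : ℝ)| ≤ L := by
    have h1 := ms_close (fun n : ℕ => ((g n : ℤ) : ℝ)) (fun n : ℕ => f n) 1 S (by
      intro n _
      have h1 : (⌊f n⌋ : ℝ) ≤ f n := Int.floor_le _
      have h2 : f n < ⌊f n⌋ + 1 := Int.lt_floor_add_one _
      simp only [hg]
      rw [abs_le]; constructor <;> linarith)
    have h2 : (((S.map g).sum : ℤ) : ℝ) = (S.map (fun n : ℕ => ((g n : ℤ) : ℝ))).sum := by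
      have := map_multiset_sum (Int.castRingHom ℝ) (S.map g)
      rw [Multiset.map_map] at this
      exact this
    have hLr : (L : ℝ) = ⌈E'⌉₊ + T := by rw [hL]; push_cast; rfl
    rw [h2]
    push_cast at hS3 ⊢
    rw [hS1] at h1
    have h3 := Nat.le_ceil E'
    rw [abs_le] at *
    constructor <;> linarith [h1.1, h1.2, hS3.1, hS3.2]
  have hSg' : |(S.map g).sum - (N - A - L)| ≤ (L : ℤ) := by exact_mod_cast hSg
  obtain ⟨j, hj⟩ : ∃ j : ℕ, (j : ℤ) = N - A - (S.map g).sum := by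
    rw [abs_le] at hSg'
    exact ⟨(N - A - (S.map g).sum).toNat, by omega⟩
  have hj2 : j ≤ 2 * L := by
    rw [abs_le] at hSg'; omega
  have hea : -(a : ℤ) ≤ e ∧ e ≤ a := by omega
  obtain ⟨b, hb⟩ : ∃ b : ℕ, (b : ℤ) = a * (2 * L) - e * j := by
    refine ⟨((a : ℤ) * (2 * L) - e * j).toNat, Int.toNat_of_nonneg ?_⟩
    have h1 : e * j ≤ a * j := by gcongr; exact hea.2
    have h2 : (a : ℤ) * j ≤ a * (2 * L) := by gcongr; exact_mod_cast hj2
    linarith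
  have hb2 : b ≤ 2 * (a * (2 * L)) := by
    have h1 : -(a : ℤ) * j ≤ e * j := by gcongr; exact hea.1
    have h2 : (a : ℤ) * j ≤ a * (2 * L) := by gcongr; exact_mod_cast hj2
    have : (b : ℤ) ≤ 2 * (a * (2 * L)) := by linarith
    exact_mod_cast this
  obtain ⟨d, hd⟩ : ∃ d : ℕ, j + b + d = 2 * L + 2 * (a * (2 * L)) := ⟨2 * L + 2 * (a * (2 * L)) - (j + b), by omega⟩
  obtain ⟨n, hn, hns⟩ := ms_to_fin g (S + (Multiset.replicate j n2 + Multiset.replicate b n1 + Multiset.replicate d 1)) (by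
    intro n hn
    rcases Multiset.mem_add.1 hn with hn | hn
    · exact hS2 n hn
    rcases Multiset.mem_add.1 hn with hn | hn
    · rcases Multiset.mem_add.1 hn with hn | hn
      · rw [Multiset.eq_of_mem_replicate hn]; exact hn2
      · rw [Multiset.eq_of_mem_replicate hn]; exact hn1
    · rw [Multiset.eq_of_mem_replicate hn]; exact one_pos) (T + (2 * L + 2 * (a * (2 * L)))) (by
      simp [hS1, hd])
  refine ⟨n, hn, ?_⟩
  have : ∑ i, ⌊f (n i)⌋ = ∑ i, g (n i) := rfl
  rw [this, hns]
  have hd' : (j : ℤ) + b + d = ((2 * L + 2 * (a * (2 * L)) : ℕ) : ℤ) := by exact_mod_cast hd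
  rw [← hd'] at hA
  simp only [Multiset.map_add, Multiset.sum_add, Multiset.map_replicate, Multiset.sum_replicate, nsmul_eq_mul]
  rw [he, hq]
  have hj' : (S.map g).sum = N - A - j := by linarith
  rw [hj', hA]
  have hb' : (q : ℤ) * b = q * (a * (2 * L) - e * j) := by rw [hb]
  linear_combination hb'
end

section
/- Let c > 0 be a real number that is not an integer. Then the sequence (⌊n^c⌋)_{n∈ℕ} is an asymptotic basis: there exist s ∈ ℕ and N_0 such that every integer N ≥ N_0 can be written as ⌊n_1^c⌋ + ⌊n_2^c⌋ + ... + ⌊n_s^c⌋ for some positive integers n_1, ..., n_s. -/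
open Finset

/-- The unit exponential. -/
noncomputable def ee (x : ℝ) : ℂ := Complex.exp (x * Complex.I)

lemma ee_norm (x : ℝ) : ‖ee x‖ = 1 := Complex.norm_exp_ofReal_mul_I x

lemma ee_add (x y : ℝ) : ee (x + y) = ee x * ee y := by
  simp [ee, add_mul, Complex.exp_add]

lemma ee_conj (x : ℝ) : (starRingEnd ℂ) (ee x) = ee (-x) := by
  simp [ee, ← Complex.exp_conj]

lemma ee_sub (x y : ℝ) : ee (x - y) = ee x * (starRingEnd ℂ) (ee y) := by
  rw [ee_conj, ← ee_add, sub_eq_add_neg]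

lemma ee_re (x : ℝ) : (ee x).re = Real.cos x := by
  simp [ee, Complex.exp_ofReal_mul_I_re]

/-- Functions behaving like polynomials of degree `d + 1` with `(d+1)`-st difference `b`. -/
def PolyLike : ℕ → ℝ → (ℕ → ℝ) → Prop
  | 0, b, φ => ∀ n, φ (n + 1) - φ n = b
  | d + 1, b, φ => ∀ h : ℕ, PolyLike d (h * b) (fun n => φ (n + h) - φ n)

lemma sqdiff (z : ℕ → ℂ) (N : ℕ) :
    ‖∑ n ∈ range (N + 1), z n‖ ^ 2 = ∑ n ∈ range (N + 1), ‖z n‖ ^ 2 +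
      2 * (∑ h ∈ range N, ∑ n ∈ range (N - h), z (n + (h + 1)) * (starRingEnd ℂ) (z n)).re := by
  induction N with
  | zero => simp
  | succ N ih =>
    rw [Finset.sum_range_succ (fun n => z n), Finset.sum_range_succ (fun n => ‖z n‖ ^ 2)]
    have h1 : ∑ h ∈ range (N + 1), ∑ n ∈ range (N + 1 - h), z (n + (h + 1)) * (starRingEnd ℂ) (z n)
        = ∑ h ∈ range N, ∑ n ∈ range (N - h), z (n + (h + 1)) * (starRingEnd ℂ) (z n)
          + z (N + 1) * (starRingEnd ℂ) (∑ n ∈ range (N + 1), z n) := by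
      have h2 : ∀ h ∈ range (N + 1),
          ∑ n ∈ range (N + 1 - h), z (n + (h + 1)) * (starRingEnd ℂ) (z n)
          = ∑ n ∈ range (N - h), z (n + (h + 1)) * (starRingEnd ℂ) (z n)
            + z (N + 1) * (starRingEnd ℂ) (z (N + 1 - 1 - h)) := by
        intro h hh
        have : h ≤ N := by simpa [Nat.lt_succ_iff] using hh
        rw [show N + 1 - h = (N - h) + 1 by omega, Finset.sum_range_succ,
          show N - h + (h + 1) = N + 1 by omega, show N + 1 - 1 - h = N - h by omega]
      rw [Finset.sum_congr rfl h2, Finset.sum_add_distrib, Finset.sum_range_succ]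
      simp only [Nat.sub_self, Finset.range_zero, Finset.sum_empty, add_zero]
      rw [← Finset.mul_sum,
        Finset.sum_range_reflect (fun n => (starRingEnd ℂ) (z n)) (N + 1), map_sum]
    rw [h1, Complex.add_re]
    have h3 : ∀ a b : ℂ, ‖a + b‖ ^ 2 = ‖a‖ ^ 2 + ‖b‖ ^ 2 + 2 * (b * (starRingEnd ℂ) a).re := by
      intro a b
      rw [← Complex.normSq_eq_norm_sq, ← Complex.normSq_eq_norm_sq, ← Complex.normSq_eq_norm_sq]
      simp [Complex.normSq_apply]
      ring
    rw [h3, ih]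
    ring

lemma sqdiff_ee (φ : ℕ → ℝ) (N : ℕ) :
    ‖∑ n ∈ range N, ee (φ n)‖ ^ 2 ≤ N +
      2 * ∑ h ∈ range N, ‖∑ n ∈ range (N - 1 - h), ee (φ (n + (h + 1)) - φ n)‖ := by
  cases N with
  | zero => simp
  | succ N =>
    rw [sqdiff]
    simp only [ee_norm, one_pow, Finset.sum_const, Finset.card_range, nsmul_eq_mul, mul_one,
      Nat.add_sub_cancel]
    gcongr
    refine (Complex.re_le_norm _).trans ((norm_sum_le _ _).trans ?_)
    rw [Finset.sum_range_succ]
    refine le_add_of_le_of_nonneg (le_of_eq ?_) (norm_nonneg _)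
    refine Finset.sum_congr rfl fun h _ => ?_
    congr 1
    refine Finset.sum_congr rfl fun n _ => ?_
    rw [ee_sub]

lemma sum_rpow_neg_le (κ : ℝ) (hκ : 0 < κ) (hκ2 : κ ≤ 1 / 2) (N H : ℕ) (hNH : N ≤ H) (hH : 1 ≤ H) :
    ∑ h ∈ range N, ((h : ℝ) + 1) ^ (-κ) ≤ 2 * (H : ℝ) ^ (1 - κ) := by
  have h1 : ∀ N : ℕ, ∑ h ∈ range N, ((h : ℝ) + 1) ^ (-(1 / 2) : ℝ) ≤ 2 * Real.sqrt N := by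
    intro N
    induction N with
    | zero => simp
    | succ N ih =>
      rw [Finset.sum_range_succ]
      have e : ((N : ℝ) + 1) ^ (-(1 / 2) : ℝ) = 1 / Real.sqrt (N + 1) := by
        rw [Real.rpow_neg (by positivity), Real.sqrt_eq_rpow, one_div, one_div]
      have hp : 0 < Real.sqrt ((N : ℝ) + 1) := by positivity
      have hs := Real.sq_sqrt (show (0 : ℝ) ≤ N + 1 by positivity)
      have hs' := Real.sq_sqrt (show (0 : ℝ) ≤ N by positivity)
      have : 1 / Real.sqrt ((N : ℝ) + 1) ≤ 2 * Real.sqrt (N + 1) - 2 * Real.sqrt N := by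
        rw [div_le_iff₀ hp]
        nlinarith [sq_nonneg (Real.sqrt ((N : ℝ) + 1) - Real.sqrt N)]
      rw [e]
      push_cast
      linarith
  have hHp : (0 : ℝ) < H := by exact_mod_cast hH
  calc ∑ h ∈ range N, ((h : ℝ) + 1) ^ (-κ)
      ≤ ∑ h ∈ range N, (H : ℝ) ^ (1 / 2 - κ) * ((h : ℝ) + 1) ^ (-(1 / 2) : ℝ) := by
        refine Finset.sum_le_sum fun h hh => ?_
        have hh' : h < N := by simpa using hh
        have : (h : ℝ) + 1 ≤ H := by exact_mod_cast (by omega : h + 1 ≤ H)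
        rw [show -κ = (1 / 2 - κ) + (-(1 / 2)) by ring, Real.rpow_add (by positivity)]
        gcongr
    _ = (H : ℝ) ^ (1 / 2 - κ) * ∑ h ∈ range N, ((h : ℝ) + 1) ^ (-(1 / 2) : ℝ) := by
        rw [Finset.mul_sum]
    _ ≤ (H : ℝ) ^ (1 / 2 - κ) * (2 * Real.sqrt H) := by
        gcongr
        refine (h1 N).trans ?_
        gcongr
    _ = 2 * (H : ℝ) ^ (1 - κ) := by
        rw [Real.sqrt_eq_rpow, show (1 - κ) = (1 / 2 - κ) + 1 / 2 by ring, Real.rpow_add hHp]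
        ring

lemma geom_ee (b : ℝ) (hb : b ≠ 0) (hb1 : |b| ≤ 1) (φ : ℕ → ℝ) (hφ : ∀ n, φ (n + 1) - φ n = b)
    (N : ℕ) : ‖∑ n ∈ range N, ee (φ n)‖ ≤ 4 / |b| := by
  have h1 : ∀ n, φ n = φ 0 + n * b := by
    intro n
    induction n with
    | zero => simp
    | succ n ih => have := hφ n; push_cast; linarith
  have h2 : ∀ n : ℕ, ee (φ n) = ee (φ 0) * ee b ^ n := by
    intro n
    rw [h1 n, ee_add]
    congr 1
    simp only [ee]
    rw [← Complex.exp_nat_mul]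
    push_cast
    ring_nf
  have hbp : 0 < |b| := abs_pos.2 hb
  have h3 : |b| / 2 ≤ ‖ee b - 1‖ := by
    have h4 : ‖ee b - 1‖ = ‖2 * Real.sin (b / 2)‖ := by
      simp only [ee]
      rw [mul_comm]
      exact Complex.norm_exp_I_mul_ofReal_sub_one b
    rw [h4, Real.norm_eq_abs, abs_mul, abs_two]
    have h5 := Real.mul_abs_le_abs_sin (x := b / 2) (by
      rw [abs_div, abs_two]; have := Real.pi_gt_three; linarith)
    rw [abs_div, abs_two] at h5
    have h6 : (1 : ℝ) / 2 ≤ 2 / Real.pi := by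
      rw [div_le_div_iff₀ (by norm_num) Real.pi_pos]
      have := Real.pi_le_four; linarith
    nlinarith
  have hne : ee b ≠ 1 := by
    intro h
    rw [h] at h3
    simp at h3
    linarith
  rw [Finset.sum_congr rfl (fun n _ => h2 n), ← Finset.mul_sum, geom_sum_eq hne, norm_mul, ee_norm,
    one_mul, norm_div]
  rw [div_le_div_iff₀ (by linarith) hbp]
  have : ‖ee b ^ N - 1‖ ≤ 2 := by
    refine (norm_sub_le _ _).trans ?_
    rw [norm_pow, ee_norm]; norm_num
  nlinarith [norm_nonneg (ee b ^ N - 1)]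

lemma weyl (d : ℕ) : ∃ C κ : ℝ, 1 ≤ C ∧ 0 < κ ∧ κ ≤ 1 / 2 ∧ ∀ H : ℕ, 1 ≤ H → ∀ b : ℝ, b ≠ 0 →
    |b| * (H : ℝ) ^ d ≤ 1 → ∀ φ, PolyLike d b φ → ∀ N ≤ H,
    ‖∑ n ∈ range N, ee (φ n)‖ ≤ C * H * (|b| * (H : ℝ) ^ (d + 1)) ^ (-κ) := by
  induction d with
  | zero =>
    refine ⟨2, 1 / 2, by norm_num, by norm_num, le_refl _, ?_⟩
    intro H hH b hb hbH φ hφ N hN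
    have hbp : 0 < |b| := abs_pos.2 hb
    have hHp : (0 : ℝ) < H := by exact_mod_cast hH
    have h1 := geom_ee b hb (by simpa using hbH) φ hφ N
    have h2 : ‖∑ n ∈ range N, ee (φ n)‖ ≤ H := by
      refine (norm_sum_le _ _).trans ?_
      simp only [ee_norm, Finset.sum_const, Finset.card_range, nsmul_eq_mul, mul_one]
      exact_mod_cast hN
    refine le_of_sq_le_sq ?_ (by positivity)
    calc ‖∑ n ∈ range N, ee (φ n)‖ ^ 2 ≤ H * (4 / |b|) := by
          rw [sq]; gcongr
      _ = (2 * H * (|b| * (H : ℝ) ^ (0 + 1)) ^ (-(1 / 2) : ℝ)) ^ 2 := by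
          rw [mul_pow, ← Real.rpow_natCast (_ ^ (-(1 / 2) : ℝ)), ← Real.rpow_mul (by positivity)]
          norm_num
          rw [Real.rpow_neg_one]
          field_simp
          norm_num
  | succ d ih =>
    obtain ⟨C, κ, hC, hκ, hκ2, ih⟩ := ih
    refine ⟨Real.sqrt (4 * C + 1), κ / 2, ?_, by linarith, by linarith, ?_⟩
    · rw [Real.one_le_sqrt]; linarith
    intro H hH b hb hbH φ hφ N hN
    have hbp : 0 < |b| := abs_pos.2 hb
    have hH1 : (1 : ℝ) ≤ H := by exact_mod_cast hH
    have hHp : (0 : ℝ) < H := by linarith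
    have hX : 0 < |b| * (H : ℝ) ^ (d + 1 + 1) := by positivity
    have h1 : ∀ h ∈ range N, ‖∑ n ∈ range (N - 1 - h), ee (φ (n + (h + 1)) - φ n)‖ ≤
        C * H * (|b| * (H : ℝ) ^ (d + 1)) ^ (-κ) * ((h : ℝ) + 1) ^ (-κ) := by
      intro h hh
      have hh' : h < N := by simpa using hh
      have hhH : (h : ℝ) + 1 ≤ H := by exact_mod_cast (by omega : h + 1 ≤ H)
      have hp : (0 : ℝ) < h + 1 := by positivity
      have := ih H hH (((h + 1 : ℕ) : ℝ) * b) (mul_ne_zero (by positivity) hb) (by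
        rw [abs_mul]
        push_cast
        rw [abs_of_pos hp]
        calc ((h : ℝ) + 1) * |b| * (H : ℝ) ^ d ≤ H * |b| * (H : ℝ) ^ d := by gcongr
          _ = |b| * (H : ℝ) ^ (d + 1) := by ring
          _ ≤ 1 := hbH) _ (hφ (h + 1)) (N - 1 - h) (by omega)
      refine this.trans (le_of_eq ?_)
      rw [abs_mul]
      push_cast
      rw [abs_of_pos hp, mul_assoc ((h : ℝ) + 1), Real.mul_rpow hp.le (by positivity)]
      ring
    have h2 : ‖∑ n ∈ range N, ee (φ n)‖ ^ 2 ≤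
        (4 * C + 1) * ((H : ℝ) ^ 2 * (|b| * (H : ℝ) ^ (d + 1 + 1)) ^ (-κ)) := by
      have hE : (|b| * (H : ℝ) ^ (d + 1)) ^ (-κ) * (H : ℝ) ^ (1 - κ) =
          H * (|b| * (H : ℝ) ^ (d + 1 + 1)) ^ (-κ) := by
        rw [pow_succ (H : ℝ) (d + 1), ← mul_assoc,
          Real.mul_rpow (x := |b| * (H : ℝ) ^ (d + 1)) (by positivity) hHp.le,
          show 1 - κ = 1 + -κ by ring, Real.rpow_add hHp, Real.rpow_one]
        ring
      have hF : (H : ℝ) ≤ (H : ℝ) ^ 2 * (|b| * (H : ℝ) ^ (d + 1 + 1)) ^ (-κ) := by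
        rw [Real.rpow_neg hX.le, ← div_eq_mul_inv, le_div_iff₀ (by positivity)]
        have : (|b| * (H : ℝ) ^ (d + 1 + 1)) ^ κ ≤ H := by
          calc (|b| * (H : ℝ) ^ (d + 1 + 1)) ^ κ ≤ (H : ℝ) ^ κ := by
                apply Real.rpow_le_rpow hX.le _ hκ.le
                rw [pow_succ (H : ℝ) (d + 1), ← mul_assoc]
                nlinarith
            _ ≤ (H : ℝ) ^ (1 : ℝ) := Real.rpow_le_rpow_of_exponent_le hH1 (by linarith)
            _ = H := Real.rpow_one _
        nlinarith
      calc ‖∑ n ∈ range N, ee (φ n)‖ ^ 2 ≤ _ := sqdiff_ee φ N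
        _ ≤ H + 2 * ∑ h ∈ range N,
            C * H * (|b| * (H : ℝ) ^ (d + 1)) ^ (-κ) * ((h : ℝ) + 1) ^ (-κ) := by
            gcongr with h hh
            exact h1 h hh
        _ = H + 2 * (C * H * (|b| * (H : ℝ) ^ (d + 1)) ^ (-κ) *
              ∑ h ∈ range N, ((h : ℝ) + 1) ^ (-κ)) := by rw [← Finset.mul_sum]
        _ ≤ H + 2 * (C * H * (|b| * (H : ℝ) ^ (d + 1)) ^ (-κ) * (2 * (H : ℝ) ^ (1 - κ))) := by
            gcongr
            exact sum_rpow_neg_le κ hκ hκ2 N H hN hH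
        _ = H + 4 * C * H * ((|b| * (H : ℝ) ^ (d + 1)) ^ (-κ) * (H : ℝ) ^ (1 - κ)) := by ring
        _ ≤ _ := by rw [hE]; nlinarith
    refine le_of_sq_le_sq ?_ (by positivity)
    refine h2.trans (le_of_eq ?_)
    rw [mul_pow, mul_pow, Real.sq_sqrt (by linarith), ← Real.rpow_natCast (_ ^ (-(κ / 2))),
      ← Real.rpow_mul hX.le]
    push_cast
    rw [show -(κ / 2) * 2 = -κ by ring]
    ring

lemma polyLike_poly (d : ℕ) : ∀ P : Polynomial ℝ, P.natDegree ≤ d + 1 →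
    PolyLike d ((d + 1).factorial * P.coeff (d + 1)) (fun n => P.eval (n : ℝ)) := by
  induction d with
  | zero =>
    intro P hP n
    obtain ⟨a, b, rfl⟩ := Polynomial.exists_eq_X_add_C_of_natDegree_le_one (by simpa using hP)
    simp
    ring
  | succ d ih =>
    intro P hP h
    have hQ : ∀ j, (Polynomial.taylor (h : ℝ) P - P).coeff j =
        (Polynomial.hasseDeriv j P).eval (h : ℝ) - P.coeff j := by
      intro j; rw [Polynomial.coeff_sub, Polynomial.taylor_coeff]
    have hhi : ∀ j, d + 1 + 1 < j → P.coeff j = 0 := fun j hj =>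
      Polynomial.coeff_eq_zero_of_natDegree_lt (by omega)
    have h1 : (Polynomial.hasseDeriv (d + 1) P) =
        Polynomial.C (P.coeff (d + 1)) + Polynomial.C ((d + 2 : ℝ) * P.coeff (d + 2)) *
          Polynomial.X := by
      ext j
      rw [Polynomial.hasseDeriv_coeff]
      rcases j with _ | _ | j
      · simp
      · simp [Polynomial.coeff_C, show 0 + 1 + (d + 1) = d + 2 by ring,
          Nat.choose_succ_self_right]
        ring_nf
        simp
      · rw [hhi _ (by omega)]
        simp [Polynomial.coeff_C, Polynomial.coeff_X]
    have hdeg : (Polynomial.taylor (h : ℝ) P - P).natDegree ≤ d + 1 := by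
      rw [Polynomial.natDegree_le_iff_coeff_eq_zero]
      intro j hj
      rw [hQ]
      have : Polynomial.hasseDeriv j P = Polynomial.C (P.coeff j) := by
        ext i
        rw [Polynomial.hasseDeriv_coeff]
        rcases i with _ | i
        · simp
        · rw [hhi _ (by omega)]
          simp [Polynomial.coeff_C]
      rw [this]
      simp
    have := ih _ hdeg
    rw [hQ, h1] at this
    convert this using 1
    · simp
      rw [Nat.factorial_succ (d + 1)]
      push_cast
      ring
    · funext n
      simp [Polynomial.taylor_eval]

/-- Generalized binomial coefficients. -/
noncomputable def binc : ℕ → ℝ → ℝ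
  | 0, _ => 1
  | j + 1, c => c / (j + 1) * binc j (c - 1)

lemma binc_ne (j : ℕ) : ∀ c : ℝ, (¬∃ m : ℤ, c = m) → binc j c ≠ 0 := by
  induction j with
  | zero => intro c _; simp [binc]
  | succ j ih =>
    intro c hc
    rw [binc]
    refine mul_ne_zero (div_ne_zero ?_ (by positivity)) (ih _ ?_)
    · rintro rfl; exact hc ⟨0, by simp⟩
    · rintro ⟨m, hm⟩
      exact hc ⟨m + 1, by push_cast; linarith⟩

lemma taylor_rpow (E : ℕ) : ∀ c : ℝ, ∃ C : ℝ, 0 ≤ C ∧ ∀ z : ℝ, 0 ≤ z → z ≤ 1 →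
    |(1 + z) ^ c - ∑ j ∈ range E, binc j c * z ^ j| ≤ C * z ^ E := by
  induction E with
  | zero =>
    intro c
    refine ⟨2 ^ |c|, by positivity, fun z hz hz1 => ?_⟩
    simp only [Finset.range_zero, Finset.sum_empty, sub_zero, pow_zero, mul_one]
    rw [abs_of_pos (by positivity)]
    calc (1 + z) ^ c ≤ (1 + z) ^ |c| :=
          Real.rpow_le_rpow_of_exponent_le (by linarith) (le_abs_self c)
      _ ≤ 2 ^ |c| := Real.rpow_le_rpow (by linarith) (by linarith) (abs_nonneg c)
  | succ E ih =>
    intro c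
    obtain ⟨C, hC, h⟩ := ih (c - 1)
    refine ⟨|c| * C, by positivity, fun z hz hz1 => ?_⟩
    set g : ℝ → ℝ := fun z => (1 + z) ^ c - ∑ j ∈ range (E + 1), binc j c * z ^ j with hg
    have hder : ∀ x ∈ Set.Icc (0 : ℝ) z, HasDerivWithinAt g
        (c * ((1 + x) ^ (c - 1) - ∑ j ∈ range E, binc j (c - 1) * x ^ j)) (Set.Icc 0 z) x := by
      intro x hx
      apply HasDerivAt.hasDerivWithinAt
      have h1 : HasDerivAt (fun z : ℝ => (1 + z) ^ c) (c * (1 + x) ^ (c - 1)) x := by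
        have := ((hasDerivAt_id x).const_add 1).rpow_const (p := c)
          (Or.inl (by have := hx.1; simp; linarith))
        simpa using this
      have h2 : HasDerivAt (fun z : ℝ => ∑ j ∈ range (E + 1), binc j c * z ^ j)
          (∑ j ∈ range (E + 1), binc j c * (j * x ^ (j - 1))) x := by
        apply HasDerivAt.fun_sum
        intro j _
        exact (hasDerivAt_pow j x).const_mul _
      have h3 : ∑ j ∈ range (E + 1), binc j c * (j * x ^ (j - 1)) =
          c * ∑ j ∈ range E, binc j (c - 1) * x ^ j := by
        rw [Finset.sum_range_succ']
        simp only [Nat.cast_zero, zero_mul, mul_zero, add_zero, Nat.add_sub_cancel]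
        rw [Finset.mul_sum]
        refine Finset.sum_congr rfl fun j _ => ?_
        rw [binc]
        push_cast
        field_simp
      rw [mul_sub, ← h3]
      exact h1.sub h2
    have hb : ∀ x ∈ Set.Icc (0 : ℝ) z,
        ‖c * ((1 + x) ^ (c - 1) - ∑ j ∈ range E, binc j (c - 1) * x ^ j)‖ ≤ |c| * C * z ^ E := by
      intro x hx
      rw [norm_mul, Real.norm_eq_abs, Real.norm_eq_abs, mul_assoc]
      have := h x hx.1 (hx.2.trans hz1)
      gcongr
      refine this.trans ?_
      have := hx.1
      have := hx.2
      gcongr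
    have := (convex_Icc (0 : ℝ) z).norm_image_sub_le_of_norm_hasDerivWithin_le hder hb
      (Set.left_mem_Icc.2 hz) (Set.right_mem_Icc.2 hz)
    have h0 : g 0 = 0 := by
      simp [hg, Finset.sum_range_succ', binc]
    rw [h0, sub_zero, sub_zero, Real.norm_eq_abs, Real.norm_eq_abs, abs_of_nonneg hz] at this
    rw [pow_succ, ← mul_assoc]
    exact this

lemma ev_rpow (K e f : ℝ) (h : e < f) : ∀ᶠ M : ℕ in Filter.atTop, K * (M : ℝ) ^ e ≤ (M : ℝ) ^ f := by
  have h1 : Filter.Tendsto (fun M : ℕ => (M : ℝ) ^ (f - e)) Filter.atTop Filter.atTop :=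
    (tendsto_rpow_atTop (by linarith)).comp tendsto_natCast_atTop_atTop
  filter_upwards [h1.eventually_ge_atTop K, Filter.eventually_ge_atTop 1] with M h2 h3
  have hM : (0 : ℝ) < M := by exact_mod_cast h3
  calc K * (M : ℝ) ^ e ≤ (M : ℝ) ^ (f - e) * (M : ℝ) ^ e := by gcongr
    _ = (M : ℝ) ^ f := by rw [← Real.rpow_add hM]; ring_nf

lemma ee_lip (x y : ℝ) : ‖ee x - ee y‖ ≤ |x - y| := by
  have : ee x - ee y = ee y * (ee (x - y) - 1) := by
    rw [mul_sub, ← ee_add]; simp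
  rw [this, norm_mul, ee_norm, one_mul]
  have h2 : ee (x - y) = Complex.exp (Complex.I * ((x - y : ℝ) : ℂ)) := by
    rw [ee, mul_comm]
  rw [h2, Complex.norm_exp_I_mul_ofReal_sub_one, Real.norm_eq_abs, abs_mul, abs_two]
  have := Real.abs_sin_le_abs (x := (x - y) / 2)
  rw [abs_div, abs_two] at this
  linarith

lemma weyl_main (c : ℝ) (hc : 0 < c) (hci : ¬∃ m : ℤ, c = m) :
    ∃ δ σ : ℝ, 0 < δ ∧ 0 < σ ∧ ∀ᶠ M : ℕ in Filter.atTop, ∃ H : ℕ, 1 ≤ H ∧ H ≤ M ∧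
      ∀ α : ℝ, (M : ℝ) ^ (-δ) ≤ |α| → |α| ≤ 10 →
        ‖∑ h ∈ range H, ee (α * (((M + h : ℕ) : ℝ)) ^ c)‖ ≤ H * (M : ℝ) ^ (-σ) := by
  set d : ℕ := ⌊c⌋₊ with hd
  have hdc : (d : ℝ) ≤ c := Nat.floor_le hc.le
  have hcd : c < d + 1 := Nat.lt_floor_add_one c
  set D : ℝ := (d : ℝ) + 1 with hD
  have hDp : 0 < D := by positivity
  obtain ⟨C, κ, hC, hκ, hκ2, hweyl⟩ := weyl d
  obtain ⟨CT, hCT, htay⟩ := taylor_rpow (d + 2) c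
  set t : ℝ := c / D with ht
  have ht0 : 0 < t := by positivity
  have ht1 : t < 1 := by rw [ht, div_lt_one hDp]; exact hcd
  have hct : c = D * t := by rw [ht]; field_simp
  set ξ : ℝ := min (1 - t) t / (4 * (D + 1)) with hξ
  have hξ0 : 0 < ξ := by
    apply div_pos (lt_min (by linarith) ht0); positivity
  have hξ4 : 4 * (D + 1) * ξ = min (1 - t) t := by rw [hξ]; field_simp
  have hξa : 4 * (D + 1) * ξ ≤ 1 - t := hξ4 ▸ min_le_left _ _
  have hξb : 4 * (D + 1) * ξ ≤ t := hξ4 ▸ min_le_right _ _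
  have hDξ : 0 < D * ξ := by positivity
  set θ : ℝ := 1 - t + ξ with hθ
  have hθ0 : 0 < θ := by rw [hθ]; linarith
  have hθ1 : θ ≤ 1 := by rw [hθ]; nlinarith
  set δ : ℝ := D * ξ / 2 with hδ
  have hδ0 : 0 < δ := by positivity
  set ν : ℝ := t - (D + 1) * ξ with hν
  have hν0 : 0 < ν := by rw [hν]; nlinarith
  set σ : ℝ := min (κ * δ) ν / 2 with hσ
  have hκδ : 0 < κ * δ := by positivity
  have hσ0 : 0 < σ := by
    apply div_pos (lt_min hκδ hν0); norm_num
  have hσ1 : σ < κ * δ := by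
    have := min_le_left (κ * δ) ν; rw [hσ]; linarith
  have hσ2 : σ < ν := by
    have := min_le_right (κ * δ) ν; rw [hσ]; linarith
  set K : ℝ := (d + 1).factorial * |binc (d + 1) c| with hK
  have hK0 : 0 < K := by
    have := abs_pos.2 (binc_ne (d + 1) c hci)
    positivity
  refine ⟨δ, σ, hδ0, hσ0, ?_⟩
  have e1 := ev_rpow (10 * K) (c - D + d * θ) 0 (by
    have : c - D + d * θ = D * ξ - θ := by rw [hct, hθ]; rw [hD]; ring
    rw [this, hθ]; nlinarith)
  have e2 := ev_rpow (2 * (C * (K / 2 ^ (d + 1)) ^ (-κ))) (-(κ * δ)) (-σ) (by linarith)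
  have e3 := ev_rpow (2 * (10 * CT)) (-ν) (-σ) (by linarith)
  have e4 := ev_rpow 2 0 θ hθ0
  filter_upwards [e1, e2, e3, e4, Filter.eventually_ge_atTop 1] with M e1 e2 e3 e4 hM
  have hM1 : (1 : ℝ) ≤ M := by exact_mod_cast hM
  have hM0 : (0 : ℝ) < M := by linarith
  rw [Real.rpow_zero] at e1 e4
  set H : ℕ := ⌊(M : ℝ) ^ θ⌋₊ with hH
  have hHu : (H : ℝ) ≤ (M : ℝ) ^ θ := Nat.floor_le (by positivity)
  have hHl : (M : ℝ) ^ θ / 2 ≤ H := by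
    have := Nat.lt_floor_add_one ((M : ℝ) ^ θ)
    rw [← hH] at this
    linarith
  have hH1 : 1 ≤ H := by
    apply Nat.le_floor
    push_cast
    linarith
  have hH1' : (1 : ℝ) ≤ H := by exact_mod_cast hH1
  have hHM : (H : ℝ) ≤ M := by
    refine hHu.trans ?_
    calc (M : ℝ) ^ θ ≤ (M : ℝ) ^ (1 : ℝ) := Real.rpow_le_rpow_of_exponent_le hM1 hθ1
      _ = M := Real.rpow_one _
  refine ⟨H, hH1, by exact_mod_cast hHM, ?_⟩
  intro α hα1 hα2
  have hα0 : 0 < |α| := lt_of_lt_of_le (by positivity) hα1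
  set P : Polynomial ℝ := ∑ j ∈ range (d + 2),
    Polynomial.C (α * (M : ℝ) ^ c * binc j c / (M : ℝ) ^ j) * Polynomial.X ^ j with hP
  have hPdeg : P.natDegree ≤ d + 1 := by
    apply Polynomial.natDegree_sum_le_of_forall_le
    intro j hj
    refine (Polynomial.natDegree_C_mul_X_pow_le _ _).trans ?_
    have := Finset.mem_range.1 hj
    omega
  have hPco : P.coeff (d + 1) = α * (M : ℝ) ^ c * binc (d + 1) c / (M : ℝ) ^ (d + 1) := by
    rw [hP, Polynomial.finsetSum_coeff]
    simp only [Polynomial.coeff_C_mul_X_pow]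
    rw [Finset.sum_ite_eq]
    simp
  set b : ℝ := (d + 1).factorial * P.coeff (d + 1) with hb
  have habs : |b| = K * |α| * (M : ℝ) ^ (c - D) := by
    rw [hb, hPco, abs_mul, abs_div, abs_mul, abs_mul, hK, Nat.abs_cast,
      abs_of_pos (show (0 : ℝ) < (M : ℝ) ^ c by positivity),
      abs_of_pos (show (0 : ℝ) < (M : ℝ) ^ (d + 1) by positivity), Real.rpow_sub hM0, hD,
      show (d : ℝ) + 1 = ((d + 1 : ℕ) : ℝ) by push_cast; ring, Real.rpow_natCast]
    ring
  have hb0 : b ≠ 0 := by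
    rw [← abs_pos, habs]; positivity
  have hbH : |b| * (H : ℝ) ^ d ≤ 1 := by
    rw [habs]
    calc K * |α| * (M : ℝ) ^ (c - D) * (H : ℝ) ^ d
        ≤ K * 10 * (M : ℝ) ^ (c - D) * ((M : ℝ) ^ θ) ^ d := by gcongr
      _ = 10 * K * (M : ℝ) ^ (c - D + d * θ) := by
          rw [← Real.rpow_natCast ((M : ℝ) ^ θ), ← Real.rpow_mul hM0.le, Real.rpow_add hM0]
          ring_nf
      _ ≤ 1 := e1
  have hbig : K / 2 ^ (d + 1) * (M : ℝ) ^ δ ≤ |b| * (H : ℝ) ^ (d + 1) := by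
    rw [habs]
    calc K / 2 ^ (d + 1) * (M : ℝ) ^ δ
        = K * (M : ℝ) ^ (-δ) * (M : ℝ) ^ (c - D) * ((M : ℝ) ^ θ / 2) ^ (d + 1) := by
          rw [div_pow, ← Real.rpow_natCast ((M : ℝ) ^ θ), ← Real.rpow_mul hM0.le]
          have : (M : ℝ) ^ δ = (M : ℝ) ^ (-δ) * (M : ℝ) ^ (c - D) *
              (M : ℝ) ^ (θ * ((d + 1 : ℕ) : ℝ)) := by
            rw [← Real.rpow_add hM0, ← Real.rpow_add hM0]
            congr 1
            push_cast
            rw [← hD, hct, hθ, hδ]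
            ring
          rw [this]
          ring
      _ ≤ K * |α| * (M : ℝ) ^ (c - D) * (H : ℝ) ^ (d + 1) := by gcongr
  have hw := hweyl H hH1 b hb0 hbH _ (polyLike_poly d P hPdeg) H le_rfl
  have hw2 : ‖∑ n ∈ range H, ee (P.eval (n : ℝ))‖ ≤ H * ((M : ℝ) ^ (-σ) / 2) := by
    refine hw.trans ?_
    have : (|b| * (H : ℝ) ^ (d + 1)) ^ (-κ) ≤ (K / 2 ^ (d + 1)) ^ (-κ) * (M : ℝ) ^ (-(κ * δ)) := by
      calc (|b| * (H : ℝ) ^ (d + 1)) ^ (-κ) ≤ (K / 2 ^ (d + 1) * (M : ℝ) ^ δ) ^ (-κ) :=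
            Real.rpow_le_rpow_of_nonpos (by positivity) hbig (by linarith)
        _ = _ := by
            rw [Real.mul_rpow (by positivity) (by positivity), ← Real.rpow_mul hM0.le]
            ring_nf
    calc C * H * (|b| * (H : ℝ) ^ (d + 1)) ^ (-κ)
        ≤ C * H * ((K / 2 ^ (d + 1)) ^ (-κ) * (M : ℝ) ^ (-(κ * δ))) := by gcongr
      _ = H * ((2 * (C * (K / 2 ^ (d + 1)) ^ (-κ)) * (M : ℝ) ^ (-(κ * δ))) / 2) := by ring
      _ ≤ _ := by gcongr
  have hdiff : ∀ n ∈ range H, ‖ee (α * (((M + n : ℕ) : ℝ)) ^ c) - ee (P.eval (n : ℝ))‖ ≤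
      (M : ℝ) ^ (-σ) / 2 := by
    intro n hn
    have hnH : (n : ℝ) ≤ H := by exact_mod_cast (Finset.mem_range.1 hn).le
    refine (ee_lip _ _).trans ?_
    have hev : P.eval (n : ℝ) = α * (M : ℝ) ^ c * ∑ j ∈ range (d + 2),
        binc j c * ((n : ℝ) / M) ^ j := by
      rw [hP, Polynomial.eval_finsetSum, Finset.mul_sum]
      refine Finset.sum_congr rfl fun j _ => ?_
      simp only [Polynomial.eval_mul, Polynomial.eval_C, Polynomial.eval_pow, Polynomial.eval_X]
      rw [div_pow]
      ring
    have hpow : (((M + n : ℕ) : ℝ)) ^ c = (M : ℝ) ^ c * (1 + (n : ℝ) / M) ^ c := by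
      rw [← Real.mul_rpow hM0.le (by positivity)]
      congr 1
      push_cast
      field_simp
    have hz0 : (0 : ℝ) ≤ (n : ℝ) / M := by positivity
    have hz1 : (n : ℝ) / M ≤ 1 := by rw [div_le_one hM0]; linarith
    have hT := htay _ hz0 hz1
    rw [hev, hpow, ← mul_assoc, ← mul_sub, abs_mul, abs_mul,
      abs_of_pos (show (0 : ℝ) < (M : ℝ) ^ c by positivity)]
    have hnM : (n : ℝ) / M ≤ (M : ℝ) ^ (θ - 1) := by
      rw [Real.rpow_sub hM0, Real.rpow_one]
      gcongr
      linarith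
    calc |α| * (M : ℝ) ^ c * |(1 + (n : ℝ) / M) ^ c - ∑ j ∈ range (d + 2),
          binc j c * ((n : ℝ) / M) ^ j|
        ≤ 10 * (M : ℝ) ^ c * (CT * ((M : ℝ) ^ (θ - 1)) ^ (d + 2)) := by
          gcongr
          refine hT.trans ?_
          gcongr
      _ = (2 * (10 * CT) * (M : ℝ) ^ (-ν)) / 2 := by
          have : (M : ℝ) ^ (-ν) = (M : ℝ) ^ c * ((M : ℝ) ^ (θ - 1)) ^ (d + 2) := by
            rw [← Real.rpow_natCast ((M : ℝ) ^ (θ - 1)), ← Real.rpow_mul hM0.le,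
              ← Real.rpow_add hM0]
            congr 1
            push_cast
            rw [hν, hct, hθ, show (d : ℝ) + 2 = D + 1 by rw [hD]; ring]
            ring
          rw [this]
          ring
      _ ≤ _ := by gcongr
  have hsum : ‖∑ n ∈ range H, ee (α * (((M + n : ℕ) : ℝ)) ^ c) -
      ∑ n ∈ range H, ee (P.eval (n : ℝ))‖ ≤ H * ((M : ℝ) ^ (-σ) / 2) := by
    rw [← Finset.sum_sub_distrib]
    refine (norm_sum_le _ _).trans ((Finset.sum_le_sum hdiff).trans ?_)
    simp
  calc ‖∑ h ∈ range H, ee (α * (((M + h : ℕ) : ℝ)) ^ c)‖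
      ≤ ‖∑ n ∈ range H, ee (α * (((M + n : ℕ) : ℝ)) ^ c) -
      ∑ n ∈ range H, ee (P.eval (n : ℝ))‖ + ‖∑ n ∈ range H, ee (P.eval (n : ℝ))‖ := by
        have := norm_add_le (∑ n ∈ range H, ee (α * (((M + n : ℕ) : ℝ)) ^ c) -
          ∑ n ∈ range H, ee (P.eval (n : ℝ))) (∑ n ∈ range H, ee (P.eval (n : ℝ)))
        rwa [sub_add_cancel] at this
    _ ≤ H * ((M : ℝ) ^ (-σ) / 2) + H * ((M : ℝ) ^ (-σ) / 2) := add_le_add hsum hw2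
    _ = _ := by ring

/-- The Fejer kernel. -/
noncomputable def kap (t : ℝ) : ℝ := ∫ β in (-1 : ℝ)..1, (1 - |β|) * Real.cos (β * t)

lemma kap_zero : kap 0 = 1 := by
  have h : kap 0 = ∫ β in (-1 : ℝ)..1, (1 - |β|) := by simp [kap]
  rw [h, ← intervalIntegral.integral_add_adjacent_intervals (b := 0)
    (Continuous.intervalIntegrable (by fun_prop) _ _)
    (Continuous.intervalIntegrable (by fun_prop) _ _)]
  have h1 : ∫ β in (-1 : ℝ)..0, (1 - |β|) = ∫ β in (-1 : ℝ)..0, (1 + β) := by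
    apply intervalIntegral.integral_congr
    intro x hx
    rw [Set.uIcc_of_le (by norm_num)] at hx
    simp [abs_of_nonpos hx.2]
  have h2 : ∫ β in (0 : ℝ)..1, (1 - |β|) = ∫ β in (0 : ℝ)..1, (1 - β) := by
    apply intervalIntegral.integral_congr
    intro x hx
    rw [Set.uIcc_of_le (by norm_num)] at hx
    simp [abs_of_nonneg hx.1]
  rw [h1, h2, intervalIntegral.integral_add (by simp) (by simp),
    intervalIntegral.integral_sub (by simp) (by simp)]
  simp
  norm_num

lemma kap_formula (t : ℝ) (ht : t ≠ 0) : kap t = 2 * (1 - Real.cos t) / t ^ 2 := by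
  rw [kap, ← intervalIntegral.integral_add_adjacent_intervals (b := 0)
    (Continuous.intervalIntegrable (by fun_prop) _ _)
    (Continuous.intervalIntegrable (by fun_prop) _ _)]
  have h1 : ∫ β in (-1 : ℝ)..0, (1 - |β|) * Real.cos (β * t) =
      ∫ β in (-1 : ℝ)..0, (1 + β) * Real.cos (β * t) := by
    apply intervalIntegral.integral_congr
    intro x hx
    rw [Set.uIcc_of_le (by norm_num)] at hx
    simp [abs_of_nonpos hx.2]
  have h2 : ∫ β in (0 : ℝ)..1, (1 - |β|) * Real.cos (β * t) =
      ∫ β in (0 : ℝ)..1, (1 - β) * Real.cos (β * t) := by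
    apply intervalIntegral.integral_congr
    intro x hx
    rw [Set.uIcc_of_le (by norm_num)] at hx
    simp [abs_of_nonneg hx.1]
  have hs : ∀ x : ℝ, HasDerivAt (fun β => Real.sin (β * t)) (Real.cos (x * t) * t) x := by
    intro x
    have := (Real.hasDerivAt_sin (x * t)).comp x ((hasDerivAt_id x).mul_const t)
    simpa [Function.comp_def] using this
  have hcs : ∀ x : ℝ, HasDerivAt (fun β => Real.cos (β * t)) (-Real.sin (x * t) * t) x := by
    intro x
    have := (Real.hasDerivAt_cos (x * t)).comp x ((hasDerivAt_id x).mul_const t)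
    simpa [Function.comp_def] using this
  have d1 : ∀ x ∈ Set.uIcc (-1 : ℝ) 0, HasDerivAt
      (fun β => (1 + β) * Real.sin (β * t) / t + Real.cos (β * t) / t ^ 2)
      ((1 + x) * Real.cos (x * t)) x := by
    intro x _
    have := ((((hasDerivAt_id x).const_add 1).mul (hs x)).div_const t).add
      ((hcs x).div_const (t ^ 2))
    refine HasDerivAt.congr_deriv this ?_
    simp only [id]
    field_simp
    ring
  have d2 : ∀ x ∈ Set.uIcc (0 : ℝ) 1, HasDerivAt
      (fun β => (1 - β) * Real.sin (β * t) / t - Real.cos (β * t) / t ^ 2)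
      ((1 - x) * Real.cos (x * t)) x := by
    intro x _
    have := ((((hasDerivAt_id x).const_sub 1).mul (hs x)).div_const t).sub
      ((hcs x).div_const (t ^ 2))
    refine HasDerivAt.congr_deriv this ?_
    simp only [id]
    field_simp
    ring
  rw [h1, h2, intervalIntegral.integral_eq_sub_of_hasDerivAt d1
    (Continuous.intervalIntegrable (by fun_prop) _ _),
    intervalIntegral.integral_eq_sub_of_hasDerivAt d2
    (Continuous.intervalIntegrable (by fun_prop) _ _)]
  simp
  ring

lemma kap_nonneg (t : ℝ) : 0 ≤ kap t := by
  by_cases ht : t = 0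
  · rw [ht, kap_zero]; norm_num
  · rw [kap_formula t ht]
    have := Real.cos_le_one t
    apply div_nonneg <;> nlinarith [sq_nonneg t]

lemma kap_le_one (t : ℝ) : kap t ≤ 1 := by
  by_cases ht : t = 0
  · rw [ht, kap_zero]
  · rw [kap_formula t ht, div_le_one (by positivity)]
    have := Real.one_sub_sq_div_two_le_cos (x := t)
    linarith

lemma kap_le (t : ℝ) (ht : t ≠ 0) : kap t ≤ 4 / t ^ 2 := by
  rw [kap_formula t ht]
  gcongr
  have := Real.neg_one_le_cos t
  linarith

lemma kap_lower (t : ℝ) (ht : |t| ≤ 1) : 1 / 4 ≤ kap t := by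
  by_cases h0 : t = 0
  · rw [h0, kap_zero]; norm_num
  · rw [kap_formula t h0, le_div_iff₀ (by positivity)]
    have h2 := Real.cos_le_one_sub_mul_cos_sq (x := t) (by have := Real.pi_gt_three; linarith)
    have h3 : (1 : ℝ) / 8 ≤ 2 / Real.pi ^ 2 := by
      rw [div_le_div_iff₀ (by norm_num) (by positivity)]
      nlinarith [Real.pi_le_four, Real.pi_pos]
    nlinarith [sq_nonneg t]

lemma normsq_expand {ι : Type*} (I : Finset ι) (y : ι → ℝ) (β : ℝ) :
    ‖∑ i ∈ I, ee (β * y i)‖ ^ 2 = ∑ i ∈ I, ∑ j ∈ I, Real.cos (β * (y i - y j)) := by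
  have h : ((‖∑ i ∈ I, ee (β * y i)‖ ^ 2 : ℝ) : ℂ) = ∑ i ∈ I, ∑ j ∈ I, ee (β * (y i - y j)) := by
    push_cast
    rw [← Complex.mul_conj', map_sum, Finset.sum_mul_sum]
    refine Finset.sum_congr rfl fun i _ => Finset.sum_congr rfl fun j _ => ?_
    rw [mul_sub, ee_sub]
  have h2 := congrArg Complex.re h
  rw [Complex.ofReal_re, Complex.re_sum] at h2
  rw [h2]
  refine Finset.sum_congr rfl fun i _ => ?_
  rw [Complex.re_sum]
  exact Finset.sum_congr rfl fun j _ => ee_re _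

lemma ee_cont : Continuous ee := by
  unfold ee
  fun_prop

lemma fejer_identity {ι : Type*} (I : Finset ι) (y : ι → ℝ) :
    ∫ β in (-1 : ℝ)..1, (1 - |β|) * ‖∑ i ∈ I, ee (β * y i)‖ ^ 2 =
      ∑ i ∈ I, ∑ j ∈ I, kap (y i - y j) := by
  simp only [normsq_expand, Finset.mul_sum]
  rw [intervalIntegral.integral_finsetSum]
  · refine Finset.sum_congr rfl fun i _ => ?_
    rw [intervalIntegral.integral_finsetSum]
    · rfl
    · intro j _
      exact Continuous.intervalIntegrable (by fun_prop) _ _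
  · intro i _
    exact Continuous.intervalIntegrable (by fun_prop) _ _

lemma fejer_upper {ι : Type*} (I : Finset ι) (y : ι → ℝ) :
    ∫ u in (-1 : ℝ)..1, ‖∑ i ∈ I, ee (u * y i)‖ ^ 2 ≤
      4 * ∑ i ∈ I, ∑ j ∈ I, kap (2 * (y i - y j)) := by
  have hc := ee_cont
  have hf : Continuous fun u : ℝ => ‖∑ i ∈ I, ee (u * y i)‖ ^ 2 := by fun_prop
  set f : ℝ → ℝ := fun u => ‖∑ i ∈ I, ee (u * y i)‖ ^ 2 with hfd
  have hf0 : ∀ u, 0 ≤ f u := fun u => by positivity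
  have h1 : ∫ u in (-1 : ℝ)..1, f u = 2 * ∫ v in (-(1 / 2) : ℝ)..(1 / 2), f (2 * v) := by
    rw [intervalIntegral.integral_comp_mul_left (fun u => f u) (by norm_num : (2 : ℝ) ≠ 0)]
    norm_num
    ring
  have h2 : ∫ v in (-(1 / 2) : ℝ)..(1 / 2), f (2 * v) ≤
      ∫ v in (-(1 / 2) : ℝ)..(1 / 2), 2 * ((1 - |v|) * f (2 * v)) := by
    apply intervalIntegral.integral_mono_on (by norm_num)
      (Continuous.intervalIntegrable (by fun_prop) _ _)
      (Continuous.intervalIntegrable (by fun_prop) _ _)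
    intro x hx
    have : |x| ≤ 1 / 2 := abs_le.2 hx
    nlinarith [hf0 (2 * x)]
  have h3 : ∫ v in (-(1 / 2) : ℝ)..(1 / 2), (1 - |v|) * f (2 * v) ≤
      ∫ v in (-1 : ℝ)..1, (1 - |v|) * f (2 * v) := by
    apply intervalIntegral.integral_mono_interval (by norm_num) (by norm_num) (by norm_num)
    · filter_upwards [MeasureTheory.ae_restrict_mem measurableSet_Ioc] with x hx
      have : |x| ≤ 1 := abs_le.2 ⟨hx.1.le, hx.2⟩
      exact mul_nonneg (by linarith) (hf0 _)
    · exact Continuous.intervalIntegrable (by fun_prop) _ _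
  have h4 := fejer_identity I (fun i => 2 * y i)
  have h5 : ∫ v in (-1 : ℝ)..1, (1 - |v|) * f (2 * v) =
      ∑ i ∈ I, ∑ j ∈ I, kap (2 * (y i - y j)) := by
    rw [show (∑ i ∈ I, ∑ j ∈ I, kap (2 * (y i - y j))) =
      ∑ i ∈ I, ∑ j ∈ I, kap (2 * y i - 2 * y j) by simp only [mul_sub], ← h4]
    congr 1
    funext v
    simp only [hfd]
    simp only [mul_comm, mul_left_comm]
  rw [h1]
  rw [intervalIntegral.integral_const_mul] at h2
  linarith

lemma sum_inv_sq (n : ℕ) : ∑ i ∈ range n, 1 / ((i : ℝ) + 1) ^ 2 ≤ 2 - 2 / ((n : ℝ) + 1) := by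
  induction n with
  | zero => simp
  | succ n ih =>
    rw [Finset.sum_range_succ]
    have : 1 / ((n : ℝ) + 1) ^ 2 ≤ 2 / ((n : ℝ) + 1) - 2 / ((n : ℝ) + 1 + 1) := by
      have e : 2 / ((n : ℝ) + 1) - 2 / ((n : ℝ) + 1 + 1) = 2 / (((n : ℝ) + 1) * (n + 1 + 1)) := by
        field_simp; ring
      rw [e, div_le_div_iff₀ (by positivity) (by positivity)]
      nlinarith [Nat.cast_nonneg (α := ℝ) n]
    push_cast
    linarith

lemma sum_sep (J : ℕ) (v : ℕ → ℕ → ℝ) (h1 : ∀ i, v i i ≤ 1)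
    (h2 : ∀ i j, i < J → j < J → i ≠ j → v i j ≤ 1 / ((i : ℝ) - j) ^ 2) :
    ∑ i ∈ range J, ∑ j ∈ range J, v i j ≤ 5 * J := by
  have key : ∀ i ∈ range J, ∑ j ∈ range J, v i j ≤ 5 := by
    intro i hi
    have hi' := Finset.mem_range.1 hi
    have hb : ∀ n : ℕ, ∑ i ∈ range n, 1 / ((i : ℝ) + 1) ^ 2 ≤ 2 := fun n => by
      have := sum_inv_sq n
      have h : 0 < 2 / ((n : ℝ) + 1) := by positivity
      linarith
    rw [Finset.range_eq_Ico, ← Finset.sum_Ico_consecutive _ (Nat.zero_le (i + 1)) hi',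
      ← Finset.range_eq_Ico, Finset.sum_range_succ]
    have a1 : ∑ j ∈ range i, v i j ≤ 2 := by
      rw [← Finset.sum_range_reflect]
      refine le_trans (Finset.sum_le_sum fun j hj => ?_) (hb i)
      have hj' := Finset.mem_range.1 hj
      refine (h2 _ _ (by omega) (by omega) (by omega)).trans (le_of_eq ?_)
      have : ((i - 1 - j : ℕ) : ℝ) = (i : ℝ) - 1 - j := by
        rw [Nat.cast_sub (by omega), Nat.cast_sub (by omega)]; simp
      rw [this]
      ring_nf
    have a2 : ∑ j ∈ Finset.Ico (i + 1) J, v i j ≤ 2 := by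
      rw [Finset.sum_Ico_eq_sum_range]
      refine le_trans (Finset.sum_le_sum fun j hj => ?_) (hb (J - (i + 1)))
      have hj' := Finset.mem_range.1 hj
      refine (h2 _ _ (by omega) (by omega) (by omega)).trans (le_of_eq ?_)
      push_cast
      ring
    linarith [h1 i]
  calc _ ≤ ∑ i ∈ range J, (5 : ℝ) := Finset.sum_le_sum key
    _ = _ := by simp [mul_comm]

lemma card_sq_le_image {Ω : Type*} (S : Finset Ω) (Z : Ω → ℤ) :
    ((#S : ℝ)) ^ 2 ≤ #(S.image Z) * #{p ∈ S ×ˢ S | Z p.1 = Z p.2} := by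
  classical
  have h1 : (#S : ℝ) = ∑ z ∈ S.image Z, (#{a ∈ S | Z a = z} : ℝ) := by
    rw [Finset.card_eq_sum_card_image Z S]
    push_cast
    rfl
  have h2 : (#{p ∈ S ×ˢ S | Z p.1 = Z p.2} : ℝ) =
      ∑ z ∈ S.image Z, (#{a ∈ S | Z a = z} : ℝ) ^ 2 := by
    have h3 := Finset.sum_comp (s := S) (fun z : ℤ => (#{a ∈ S | Z a = z} : ℝ)) Z
    rw [Finset.card_filter, Finset.sum_product]
    push_cast
    have h4 : ∀ x ∈ S, ∑ y ∈ S, (if Z x = Z y then (1 : ℝ) else 0) = #{a ∈ S | Z a = Z x} := by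
      intro x _
      rw [Finset.card_filter]
      push_cast
      refine Finset.sum_congr rfl fun y _ => ?_
      simp only [eq_comm]
    rw [Finset.sum_congr rfl h4, h3]
    refine Finset.sum_congr rfl fun z _ => ?_
    rw [nsmul_eq_mul, sq]
  rw [h2, h1]
  exact sq_sum_le_card_mul_sum_sq

lemma energy {ι : Type*} (I : Finset ι) (X : ι → ℝ) (J : ℕ) (g : ℕ → ℝ) (L w η : ℝ)
    (hw : 1 ≤ w) (hwL : w ≤ L)
    (hT : ∀ α : ℝ, 1 / L ≤ |α| → |α| ≤ 1 → ‖∑ i ∈ I, ee (α * X i)‖ ≤ η * #I)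
    (hg : ∀ i j, i < J → j < J → i ≠ j → L * |(i : ℝ) - j| ≤ |g i - g j|) :
    (#{p ∈ (I ×ˢ range J) ×ˢ (I ×ˢ range J) |
      |X p.1.1 + g p.1.2 - (X p.2.1 + g p.2.2)| ≤ w} : ℝ) ≤
      4 * (20 * J * (#I : ℝ) ^ 2 * (w / L) + 2 * η ^ 2 * (#I : ℝ) ^ 2 * J ^ 2) := by
  classical
  have hw0 : 0 < w := by linarith
  have hL0 : 0 < L := by linarith
  have hc := ee_cont
  set Y : ι × ℕ → ℝ := fun p => (X p.1 + g p.2) / w with hY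
  set Ω := I ×ˢ range J with hΩ
  set τ := w / L with hτ
  have hτ0 : 0 < τ := by positivity
  have hτ1 : τ ≤ 1 := by rw [hτ, div_le_one hL0]; exact hwL
  set T : ℝ → ℂ := fun α => ∑ i ∈ I, ee (α * X i) with hTd
  set G : ℝ → ℂ := fun α => ∑ j ∈ range J, ee (α * g j) with hGd
  have hTc : Continuous T := by fun_prop
  have hGc : Continuous G := by fun_prop
  have hTtriv : ∀ α, ‖T α‖ ≤ #I := fun α => by
    refine (norm_sum_le _ _).trans ?_
    simp [ee_norm]
  have hGtriv : ∀ α, ‖G α‖ ≤ J := fun α => by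
    refine (norm_sum_le _ _).trans ?_
    simp [ee_norm]
  have hF : ∀ β : ℝ, ∑ p ∈ Ω, ee (β * Y p) = T (β / w) * G (β / w) := by
    intro β
    rw [hTd, hGd, hΩ, Finset.sum_product, Finset.sum_mul_sum]
    refine Finset.sum_congr rfl fun i _ => Finset.sum_congr rfl fun j _ => ?_
    rw [← ee_add, hY]
    congr 1
    field_simp
  have h1 : (#{p ∈ Ω ×ˢ Ω | |X p.1.1 + g p.1.2 - (X p.2.1 + g p.2.2)| ≤ w} : ℝ) ≤
      4 * ∑ p ∈ Ω, ∑ q ∈ Ω, kap (Y p - Y q) := by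
    rw [Finset.card_filter, ← Finset.sum_product', Finset.mul_sum]
    push_cast
    refine Finset.sum_le_sum fun p _ => ?_
    split_ifs with hp
    · have := kap_lower (Y p.1 - Y p.2) (by
        rw [hY]
        simp only
        rw [← sub_div, abs_div, abs_of_pos hw0, div_le_one hw0]
        exact hp)
      linarith
    · have := kap_nonneg (Y p.1 - Y p.2)
      linarith
  have h2 := fejer_identity Ω Y
  simp only [hF] at h2
  set f : ℝ → ℝ := fun β => (1 - |β|) * ‖T (β / w) * G (β / w)‖ ^ 2 with hf
  have hfc : Continuous f := by fun_prop
  have hii : ∀ a b, IntervalIntegrable f MeasureTheory.volume a b :=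
    fun a b => hfc.intervalIntegrable a b
  have hsplit : ∫ β in (-1 : ℝ)..1, f β = (∫ β in (-1 : ℝ)..(-τ), f β) +
      (∫ β in (-τ)..τ, f β) + ∫ β in τ..1, f β := by
    rw [intervalIntegral.integral_add_adjacent_intervals (hii _ _) (hii _ _),
      intervalIntegral.integral_add_adjacent_intervals (hii _ _) (hii _ _)]
  set B : ℝ := η ^ 2 * (#I : ℝ) ^ 2 * J ^ 2 with hB
  have hB0 : 0 ≤ B := by positivity
  have hout : ∀ β : ℝ, τ ≤ |β| → |β| ≤ 1 → f β ≤ B := by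
    intro β hb1 hb2
    have hα : |β / w| = |β| / w := by rw [abs_div, abs_of_pos hw0]
    have ht := hT (β / w) (by
      rw [hα, div_le_div_iff₀ hL0 hw0, one_mul]
      rw [hτ, div_le_iff₀ hL0] at hb1
      exact hb1) (by
      rw [hα, div_le_one hw0]; linarith)
    have hg' := hGtriv (β / w)
    have : ‖T (β / w) * G (β / w)‖ ^ 2 ≤ B := by
      rw [norm_mul, hB, ← mul_pow, ← mul_pow]
      gcongr
      exact (norm_nonneg _).trans ht
    have h0 : 0 ≤ ‖T (β / w) * G (β / w)‖ ^ 2 := by positivity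
    have := abs_nonneg β
    simp only [hf]
    nlinarith
  have ho1 : ∫ β in (-1 : ℝ)..(-τ), f β ≤ B := by
    calc ∫ β in (-1 : ℝ)..(-τ), f β ≤ ∫ β in (-1 : ℝ)..(-τ), B := by
          apply intervalIntegral.integral_mono_on (by linarith) (hii _ _) (by simp)
          intro x hx
          apply hout
          · rw [abs_of_nonpos (by linarith [hx.2])]; linarith [hx.2]
          · rw [abs_of_nonpos (by linarith [hx.2])]; linarith [hx.1]
      _ ≤ B := by
          rw [intervalIntegral.integral_const, smul_eq_mul]
          nlinarith
  have ho2 : ∫ β in τ..1, f β ≤ B := by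
    calc ∫ β in τ..1, f β ≤ ∫ β in τ..1, B := by
          apply intervalIntegral.integral_mono_on hτ1 (hii _ _) (by simp)
          intro x hx
          apply hout
          · rw [abs_of_nonneg (by linarith [hx.1])]; linarith [hx.1]
          · rw [abs_of_nonneg (by linarith [hx.1])]; linarith [hx.2]
      _ ≤ B := by
          rw [intervalIntegral.integral_const, smul_eq_mul]
          nlinarith
  have hin : ∫ β in (-τ)..τ, f β ≤ (#I : ℝ) ^ 2 * (τ * (20 * J)) := by
    have i1 : ∫ β in (-τ)..τ, f β ≤ ∫ β in (-τ)..τ, (#I : ℝ) ^ 2 * ‖G (β / w)‖ ^ 2 := by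
      apply intervalIntegral.integral_mono_on (by linarith) (hii _ _)
        (Continuous.intervalIntegrable (by fun_prop) _ _)
      intro x hx
      have hx1 : |x| ≤ 1 := (abs_le.2 hx).trans hτ1
      have : ‖T (x / w) * G (x / w)‖ ^ 2 ≤ (#I : ℝ) ^ 2 * ‖G (x / w)‖ ^ 2 := by
        rw [norm_mul, mul_pow]
        have := hTtriv (x / w)
        gcongr
      have h0 : 0 ≤ ‖T (x / w) * G (x / w)‖ ^ 2 := by positivity
      have := abs_nonneg x
      simp only [hf]
      nlinarith
    have i2 : ∫ β in (-τ)..τ, ‖G (β / w)‖ ^ 2 =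
        τ * ∫ u in (-1 : ℝ)..1, ‖∑ j ∈ range J, ee (u * (g j / L))‖ ^ 2 := by
      have e : (fun u : ℝ => ‖∑ j ∈ range J, ee (u * (g j / L))‖ ^ 2) =
          fun u : ℝ => (fun β => ‖G (β / w)‖ ^ 2) (τ * u) := by
        funext u
        simp only [hGd]
        congr 2
        refine Finset.sum_congr rfl fun j _ => ?_
        congr 1
        rw [hτ]
        field_simp
      rw [e, intervalIntegral.integral_comp_mul_left (fun β => ‖G (β / w)‖ ^ 2) hτ0.ne']
      rw [smul_eq_mul, mul_neg, mul_one]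
      field_simp
    have i3 := fejer_upper (range J) (fun j => g j / L)
    have i4 : ∑ i ∈ range J, ∑ j ∈ range J, kap (2 * (g i / L - g j / L)) ≤ 5 * J := by
      apply sum_sep
      · intro i; exact kap_le_one _
      · intro i j hi hj hij
        have hs := hg i j hi hj hij
        have hij' : (0 : ℝ) < |(i : ℝ) - j| := by
          rw [abs_pos, sub_ne_zero]; exact_mod_cast hij
        have hs2 : |(i : ℝ) - j| ≤ |g i / L - g j / L| := by
          rw [← sub_div, abs_div, abs_of_pos hL0, le_div_iff₀ hL0]
          linarith
        have hne : g i / L - g j / L ≠ 0 := by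
          rw [← abs_pos]; linarith
        refine (kap_le _ (mul_ne_zero two_ne_zero hne)).trans ?_
        rw [mul_pow, ← sq_abs ((i : ℝ) - j), ← sq_abs (g i / L - g j / L)]
        rw [div_le_div_iff₀ (by positivity) (by positivity)]
        nlinarith
    rw [intervalIntegral.integral_const_mul, i2] at i1
    refine i1.trans ?_
    gcongr
    linarith
  have : ∑ p ∈ Ω, ∑ q ∈ Ω, kap (Y p - Y q) ≤
      20 * J * (#I : ℝ) ^ 2 * τ + 2 * η ^ 2 * (#I : ℝ) ^ 2 * J ^ 2 := by
    rw [← h2, hsplit]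
    rw [hB] at ho1 ho2
    linarith
  linarith

lemma greedy_step (c : ℝ) (hc : 0 < c) : ∃ ρ C : ℝ, 0 ≤ ρ ∧ ρ < 1 ∧ 1 ≤ C ∧
    ∀ y : ℝ, 0 ≤ y → ∃ n : ℕ, 0 ≤ y - (n : ℝ) ^ c ∧ y - (n : ℝ) ^ c ≤ C * (max 1 y) ^ ρ := by
  have key : ∀ y : ℝ, 0 ≤ y → 0 ≤ y ^ (1 / c) ∧ (y ^ (1 / c)) ^ c = y := by
    intro y hy
    refine ⟨by positivity, ?_⟩
    rw [← Real.rpow_mul hy, one_div, inv_mul_cancel₀ hc.ne', Real.rpow_one]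
  rcases le_total c 1 with h1 | h1
  · refine ⟨0, 1, le_rfl, by norm_num, le_rfl, ?_⟩
    intro y hy
    obtain ⟨hx0, hx⟩ := key y hy
    set x := y ^ (1 / c)
    refine ⟨⌊x⌋₊, ?_, ?_⟩
    · have : (⌊x⌋₊ : ℝ) ^ c ≤ x ^ c :=
        Real.rpow_le_rpow (by positivity) (Nat.floor_le hx0) hc.le
      linarith
    · have h2 : x ^ c ≤ ((⌊x⌋₊ : ℝ) + 1) ^ c :=
        Real.rpow_le_rpow hx0 (Nat.lt_floor_add_one x).le hc.le
      have h3 := Real.rpow_add_le_add_rpow (Nat.cast_nonneg (α := ℝ) ⌊x⌋₊) zero_le_one hc.le h1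
      rw [Real.one_rpow] at h3
      rw [Real.rpow_zero]
      linarith
  · refine ⟨1 - 1 / c, c, ?_, ?_, h1, ?_⟩
    · rw [sub_nonneg, div_le_one hc]; exact h1
    · have : 0 < 1 / c := by positivity
      linarith
    intro y hy
    obtain ⟨hx0, hx⟩ := key y hy
    have hρ : 0 ≤ 1 - 1 / c := by rw [sub_nonneg, div_le_one hc]; exact h1
    rcases hy.eq_or_lt with h0 | hy0
    · refine ⟨0, ?_, ?_⟩
      · simp [Real.zero_rpow hc.ne', hy]
      · rw [← h0]; simp [Real.zero_rpow hc.ne']; exact hc.le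
    set x := y ^ (1 / c) with hxd
    have hxp : 0 < x := by positivity
    refine ⟨⌊x⌋₊, ?_, ?_⟩
    · have : (⌊x⌋₊ : ℝ) ^ c ≤ x ^ c :=
        Real.rpow_le_rpow (by positivity) (Nat.floor_le hx0) hc.le
      linarith
    · set n : ℝ := (⌊x⌋₊ : ℝ) with hn
      have hn0 : 0 ≤ n := by positivity
      have hb := one_add_mul_self_le_rpow_one_add (s := n / x - 1) (by
        have : 0 ≤ n / x := by positivity
        linarith) h1
      rw [show 1 + (n / x - 1) = n / x by ring, Real.div_rpow hn0 hx0, hx, le_div_iff₀ hy0] at hb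
      have h4 : x - n ≤ 1 := by have := Nat.lt_floor_add_one x; linarith
      have h5 : y / x = y ^ (1 - 1 / c) := by
        rw [hxd, Real.rpow_sub hy0, Real.rpow_one]
      have h6 : y ^ (1 - 1 / c) ≤ (max 1 y) ^ (1 - 1 / c) :=
        Real.rpow_le_rpow hy (le_max_right _ _) hρ
      have h7 : c * (1 - n / x) * y = c * (y / x) * (x - n) := by field_simp
      have h8 : c * (y / x) * (x - n) ≤ c * (y / x) * 1 := by gcongr
      rw [h5] at h8 h7
      have h9 : c * y ^ (1 - 1 / c) ≤ c * (max 1 y) ^ (1 - 1 / c) := by gcongr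
      nlinarith

lemma greedy_iter (c : ℝ) (hc : 0 < c) : ∃ ρ : ℝ, 0 ≤ ρ ∧ ρ < 1 ∧ ∀ r : ℕ, ∃ K : ℝ, 1 ≤ K ∧
    ∀ Y : ℝ, 1 ≤ Y → ∀ y : ℝ, 0 ≤ y → y ≤ Y → ∃ n : Fin r → ℕ,
      0 ≤ y - ∑ i, (n i : ℝ) ^ c ∧ y - ∑ i, (n i : ℝ) ^ c ≤ K * Y ^ (ρ ^ r) := by
  obtain ⟨ρ, C, hρ0, hρ1, hC, hst⟩ := greedy_step c hc
  refine ⟨ρ, hρ0, hρ1, ?_⟩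
  intro r
  induction r with
  | zero =>
    refine ⟨1, le_rfl, ?_⟩
    intro Y hY y hy hyY
    exact ⟨fun _ => 0, by simpa using hy, by simpa using hyY⟩
  | succ r ih =>
    obtain ⟨K, hK, ih⟩ := ih
    refine ⟨C * K ^ ρ, ?_, ?_⟩
    · have : 1 ≤ K ^ ρ := Real.one_le_rpow hK hρ0
      nlinarith
    intro Y hY y hy hyY
    obtain ⟨n, hn0, hn1⟩ := ih Y hY y hy hyY
    obtain ⟨m, hm0, hm1⟩ := hst _ hn0
    refine ⟨Fin.snoc n m, ?_⟩
    have hs : ∑ i, ((Fin.snoc (α := fun _ => ℕ) n m i : ℕ) : ℝ) ^ c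
        = ∑ i, (n i : ℝ) ^ c + (m : ℝ) ^ c := by
      rw [Fin.sum_univ_castSucc]; simp
    rw [hs, ← sub_sub]
    refine ⟨hm0, hm1.trans ?_⟩
    have h1 : 1 ≤ K * Y ^ (ρ ^ r) := by
      have : 1 ≤ Y ^ (ρ ^ r) := Real.one_le_rpow hY (by positivity)
      nlinarith
    have h2 : (max 1 (y - ∑ i, (n i : ℝ) ^ c)) ^ ρ ≤ (K * Y ^ (ρ ^ r)) ^ ρ :=
      Real.rpow_le_rpow (by positivity) (max_le h1 hn1) hρ0
    rw [Real.mul_rpow (by linarith) (by positivity), ← Real.rpow_mul (by linarith), ← pow_succ] at h2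
    calc _ ≤ C * (K ^ ρ * Y ^ ρ ^ (r + 1)) := by gcongr
      _ = _ := by ring

lemma greedy (c : ℝ) (hc : 0 < c) (δ : ℝ) (hδ : 0 < δ) : ∃ r : ℕ, ∀ᶠ M : ℕ in Filter.atTop,
    ∀ y : ℝ, 0 ≤ y → y ≤ (M : ℝ) ^ c → ∃ n : Fin r → ℕ,
      0 ≤ y - ∑ i, (n i : ℝ) ^ c ∧ y - ∑ i, (n i : ℝ) ^ c ≤ (M : ℝ) ^ δ := by
  obtain ⟨ρ, hρ0, hρ1, hit⟩ := greedy_iter c hc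
  obtain ⟨r, hr⟩ := exists_pow_lt_of_lt_one (show 0 < δ / c by positivity) hρ1
  obtain ⟨K, hK, h⟩ := hit r
  refine ⟨r, ?_⟩
  rw [lt_div_iff₀ hc] at hr
  filter_upwards [ev_rpow K (c * ρ ^ r) δ (by linarith), Filter.eventually_ge_atTop 1] with M hM hM1
  intro y hy hyM
  have hM1' : (1 : ℝ) ≤ M := by exact_mod_cast hM1
  obtain ⟨n, h0, h1⟩ := h _ (Real.one_le_rpow hM1' hc.le) y hy hyM
  refine ⟨n, h0, h1.trans ?_⟩
  rw [← Real.rpow_mul (by linarith)]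
  exact hM

lemma ee_sum {ι : Type*} (I : Finset ι) (f : ι → ℝ) : ee (∑ i ∈ I, f i) = ∏ i ∈ I, ee (f i) := by
  simp only [ee]
  rw [← Complex.exp_sum]
  congr 1
  push_cast
  rw [Finset.sum_mul]

lemma floor_sum_bd {n : ℕ} (f : Fin n → ℝ) : 0 ≤ ∑ i, f i - ((∑ i, ⌊f i⌋ : ℤ) : ℝ) ∧
    ∑ i, f i - ((∑ i, ⌊f i⌋ : ℤ) : ℝ) ≤ n := by
  push_cast
  rw [← Finset.sum_sub_distrib]
  constructor
  · apply Finset.sum_nonneg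
    intro i _
    linarith [Int.floor_le (f i)]
  · calc ∑ i, (f i - (⌊f i⌋ : ℝ)) ≤ ∑ i : Fin n, (1 : ℝ) := by
          apply Finset.sum_le_sum
          intro i _
          linarith [Int.lt_floor_add_one (f i)]
      _ = n := by simp

lemma final_arith (i j P w L e im En : ℝ) (hi : 0 < i) (hj : 0 < j) (hP : 0 < P) (hw : 0 < w)
    (him : 0 ≤ im)
    (hcs : (i * j) ^ 2 ≤ im * En)
    (hen : En ≤ 4 * (20 * j * i ^ 2 * (w / L) + 2 * e ^ 2 * i ^ 2 * j ^ 2))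
    (he : e ^ 2 ≤ 1 / P) (hwJ : w / L ≤ 4 * w * j / P) : 1 / (4 * (80 * w + 2)) * P ≤ im := by
  have hE : En ≤ (i * j) ^ 2 * ((4 * (80 * w + 2)) / P) := by
    refine hen.trans ?_
    calc _ ≤ 4 * (20 * j * i ^ 2 * (4 * w * j / P) + 2 * (1 / P) * i ^ 2 * j ^ 2) := by gcongr
      _ = _ := by field_simp; ring
  have h5 : (i * j) ^ 2 * 1 ≤ (i * j) ^ 2 * (im * ((4 * (80 * w + 2)) / P)) := by
    calc _ = (i * j) ^ 2 := by rw [mul_one]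
      _ ≤ _ := hcs
      _ ≤ im * ((i * j) ^ 2 * ((4 * (80 * w + 2)) / P)) := by gcongr
      _ = _ := by ring
  have h6 := le_of_mul_le_mul_left h5 (by positivity)
  rw [← mul_div_assoc, le_div_iff₀ hP] at h6
  rw [div_mul_eq_mul_div, div_le_iff₀ (by positivity)]
  linarith

set_option maxHeartbeats 1000000 in
lemma density_block (c : ℝ) (hc : 0 < c) (hci : ¬∃ m : ℤ, c = m) :
    ∃ t : ℕ, ∃ κ C : ℝ, 0 < κ ∧ 0 < C ∧ ∀ᶠ M : ℕ in Filter.atTop, ∃ F : Finset ℤ,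
      (∀ z ∈ F, 0 ≤ z ∧ (z : ℝ) ≤ C * (M : ℝ) ^ c ∧
        ∃ n : Fin t → ℕ, z = ∑ i, ⌊(n i : ℝ) ^ c⌋) ∧ κ * (M : ℝ) ^ c ≤ #F := by
  obtain ⟨δ₀, σ, hδ₀, hσ, hweyl⟩ := weyl_main c hc hci
  obtain ⟨δ, hδ, hδ1, hδ2⟩ : ∃ δ : ℝ, 0 < δ ∧ δ ≤ δ₀ ∧ δ < c :=
    ⟨min δ₀ (c / 2), by positivity, min_le_left _ _, (min_le_right _ _).trans_lt (by linarith)⟩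
  obtain ⟨r, hgreedy⟩ := greedy c hc δ hδ
  obtain ⟨s, hs1, hs⟩ : ∃ s : ℕ, 1 ≤ s ∧ c ≤ 2 * s * σ := by
    obtain ⟨s, hs⟩ := exists_nat_ge (c / (2 * σ))
    refine ⟨s + 1, by omega, ?_⟩
    rw [div_le_iff₀ (by positivity)] at hs
    push_cast
    nlinarith
  set w : ℝ := (s : ℝ) + r with hw
  have hs1' : (1 : ℝ) ≤ s := by exact_mod_cast hs1
  have hr0 : (0 : ℝ) ≤ r := by positivity
  have hw1 : 1 ≤ w := by linarith
  refine ⟨s + r, 1 / (4 * (80 * w + 2)), s * (2 : ℝ) ^ c + 1, by positivity, by positivity, ?_⟩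
  filter_upwards [hweyl, hgreedy, ev_rpow w 0 δ hδ, ev_rpow 4 δ c hδ2,
    Filter.eventually_ge_atTop 1] with M hW hG hwL h4 hM1
  have hM1' : (1 : ℝ) ≤ M := by exact_mod_cast hM1
  have hM0 : (0 : ℝ) < M := by linarith
  rw [Real.rpow_zero, mul_one] at hwL
  set L : ℝ := (M : ℝ) ^ δ with hL
  set P : ℝ := (M : ℝ) ^ c with hP
  have hL0 : 0 < L := by positivity
  have hP0 : 0 < P := by positivity
  obtain ⟨H, hH1, hHM, hW⟩ := hW
  set J : ℕ := ⌊P / (2 * L)⌋₊ with hJ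
  have hJ1 : (J : ℝ) * (2 * L) ≤ P := by
    rw [← le_div_iff₀ (by positivity)]
    exact Nat.floor_le (by positivity)
  have hJ2 : P / 4 ≤ L * J := by
    have h := Nat.lt_floor_add_one (P / (2 * L))
    rw [div_lt_iff₀ (by positivity)] at h
    change P < ((J : ℝ) + 1) * (2 * L) at h
    nlinarith
  have hex : ∀ j : ℕ, ∃ n : Fin r → ℕ, j < J →
      0 ≤ 2 * L * (j + 1) - ∑ i, (n i : ℝ) ^ c ∧ 2 * L * (j + 1) - ∑ i, (n i : ℝ) ^ c ≤ L := by
    intro j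
    by_cases hj : j < J
    · have : (j : ℝ) + 1 ≤ J := by exact_mod_cast hj
      obtain ⟨n, hn⟩ := hG (2 * L * (j + 1)) (by positivity) (by nlinarith)
      exact ⟨n, fun _ => hn⟩
    · exact ⟨fun _ => 0, fun h => absurd h hj⟩
  choose m hm using hex
  set g : ℕ → ℝ := fun j => ∑ i, (m j i : ℝ) ^ c with hg
  set I : Finset (Fin s → ℕ) := Fintype.piFinset (fun _ => range H) with hI
  set X : (Fin s → ℕ) → ℝ := fun x => ∑ i, ((M + x i : ℕ) : ℝ) ^ c with hX
  have hIc : (#I : ℝ) = (H : ℝ) ^ s := by simp [hI]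
  have hT : ∀ α : ℝ, 1 / L ≤ |α| → |α| ≤ 1 → ‖∑ i ∈ I, ee (α * X i)‖ ≤
      (M : ℝ) ^ (-(s * σ)) * #I := by
    intro α h1 h2
    have e1 : ∑ x ∈ I, ee (α * X x) =
        (∑ h ∈ range H, ee (α * (((M + h : ℕ) : ℝ)) ^ c)) ^ s := by
      have := Finset.prod_univ_sum (fun _ : Fin s => range H)
        (fun _ h => ee (α * (((M + h : ℕ) : ℝ)) ^ c))
      rw [Finset.prod_const, Finset.card_univ, Fintype.card_fin] at this
      rw [this]
      apply Finset.sum_congr rfl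
      intro x _
      rw [← ee_sum, hX, Finset.mul_sum]
    rw [e1, norm_pow, hIc]
    have h3 := hW α (by
      refine le_trans ?_ h1
      rw [hL, one_div, ← Real.rpow_neg hM0.le]
      exact Real.rpow_le_rpow_of_exponent_le hM1' (by linarith)) (by linarith)
    calc _ ≤ ((H : ℝ) * (M : ℝ) ^ (-σ)) ^ s := by gcongr
      _ = _ := by
        rw [mul_pow, ← Real.rpow_natCast (_ ^ (-σ)), ← Real.rpow_mul hM0.le, mul_comm]
        congr 2
        ring
  have hgs : ∀ i j, i < J → j < J → i ≠ j → L * |(i : ℝ) - j| ≤ |g i - g j| := by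
    intro i j hi hj hij
    obtain ⟨a1, a2⟩ := hm i hi
    obtain ⟨b1, b2⟩ := hm j hj
    change 0 ≤ 2 * L * (i + 1) - g i at a1
    change 2 * L * (i + 1) - g i ≤ L at a2
    change 0 ≤ 2 * L * (j + 1) - g j at b1
    change 2 * L * (j + 1) - g j ≤ L at b2
    rcases lt_or_gt_of_ne hij with h | h
    · have h' : (i : ℝ) + 1 ≤ j := by exact_mod_cast h
      rw [abs_sub_comm, abs_sub_comm (g i), abs_of_nonneg (by linarith)]
      refine le_trans ?_ (le_abs_self _)
      nlinarith
    · have h' : (j : ℝ) + 1 ≤ i := by exact_mod_cast h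
      rw [abs_of_nonneg (by linarith)]
      refine le_trans ?_ (le_abs_self _)
      nlinarith
  have hen := energy I X J g L w _ hw1 hwL hT hgs
  set Z : (Fin s → ℕ) × ℕ → ℤ := fun p =>
    ∑ i, ⌊((M + p.1 i : ℕ) : ℝ) ^ c⌋ + ∑ i, ⌊(m p.2 i : ℝ) ^ c⌋ with hZ
  have hZY : ∀ p, 0 ≤ X p.1 + g p.2 - (Z p : ℝ) ∧ X p.1 + g p.2 - (Z p : ℝ) ≤ w := by
    intro p
    obtain ⟨a1, a2⟩ := floor_sum_bd (fun i => ((M + p.1 i : ℕ) : ℝ) ^ c)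
    obtain ⟨b1, b2⟩ := floor_sum_bd (fun i => (m p.2 i : ℝ) ^ c)
    have e : (Z p : ℝ) = ((∑ i, ⌊((M + p.1 i : ℕ) : ℝ) ^ c⌋ : ℤ) : ℝ) +
      ((∑ i, ⌊(m p.2 i : ℝ) ^ c⌋ : ℤ) : ℝ) := by
      simp only [hZ]; push_cast; rfl
    have e1 : X p.1 = ∑ i, ((M + p.1 i : ℕ) : ℝ) ^ c := rfl
    have e2 : g p.2 = ∑ i, (m p.2 i : ℝ) ^ c := rfl
    rw [e, e1, e2]
    constructor <;> linarith
  set S := I ×ˢ range J with hS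
  have hcs := card_sq_le_image S Z
  have hsub : (#{p ∈ S ×ˢ S | Z p.1 = Z p.2} : ℝ) ≤
      #{p ∈ S ×ˢ S | |X p.1.1 + g p.1.2 - (X p.2.1 + g p.2.2)| ≤ w} := by
    norm_cast
    apply Finset.card_le_card
    intro p hp
    rw [Finset.mem_filter] at hp ⊢
    refine ⟨hp.1, ?_⟩
    obtain ⟨a1, a2⟩ := hZY p.1
    obtain ⟨b1, b2⟩ := hZY p.2
    rw [hp.2] at a1 a2
    rw [abs_le]
    constructor <;> linarith
  refine ⟨S.image Z, ?_, ?_⟩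
  · intro z hz
    rw [Finset.mem_image] at hz
    obtain ⟨p, hp, rfl⟩ := hz
    rw [hS, Finset.mem_product, hI, Fintype.mem_piFinset] at hp
    refine ⟨?_, ?_, ?_⟩
    · apply add_nonneg <;>
      · apply Finset.sum_nonneg
        intro i _
        apply Int.floor_nonneg.mpr
        positivity
    · have h1 := (hZY p).1
      have h2 := (hm p.2 (Finset.mem_range.mp hp.2)).1
      change 0 ≤ _ - g p.2 at h2
      have hj : (p.2 : ℝ) + 1 ≤ J := by exact_mod_cast (Finset.mem_range.mp hp.2)
      have h3 : X p.1 ≤ s * (2 : ℝ) ^ c * P := by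
        calc X p.1 ≤ ∑ i : Fin s, (2 : ℝ) ^ c * P := by
              apply Finset.sum_le_sum
              intro i _
              rw [hP, ← Real.mul_rpow (by norm_num) hM0.le]
              apply Real.rpow_le_rpow (by positivity) _ hc.le
              have : p.1 i < H := Finset.mem_range.mp (hp.1 i)
              have : M + p.1 i ≤ 2 * M := by omega
              exact_mod_cast this
          _ = _ := by simp; ring
      nlinarith
    · refine ⟨Fin.append (fun i => M + p.1 i) (m p.2), ?_⟩
      rw [Fin.sum_univ_add]
      simp [hZ]
  · have hI0 : 0 < (#I : ℝ) := by
      rw [hIc]; have : (0 : ℝ) < H := by exact_mod_cast hH1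
      positivity
    have hJ0 : 0 < (J : ℝ) := by
      by_contra h
      have : (J : ℝ) = 0 := le_antisymm (not_lt.mp h) (by positivity)
      rw [this] at hJ2; linarith
    have hSc : (#S : ℝ) = #I * J := by simp [hS]
    have hη : ((M : ℝ) ^ (-(s * σ))) ^ 2 ≤ 1 / P := by
      rw [← Real.rpow_natCast, ← Real.rpow_mul hM0.le, hP, one_div, ← Real.rpow_neg hM0.le]
      apply Real.rpow_le_rpow_of_exponent_le hM1'
      push_cast; linarith
    have hwJ : w / L ≤ 4 * w * J / P := by
      rw [div_le_div_iff₀ hL0 hP0]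
      have := mul_le_mul_of_nonneg_left hJ2 (show 0 ≤ 4 * w by linarith)
      linarith
    rw [hSc] at hcs
    exact final_arith _ _ P w L _ _ _ hI0 hJ0 hP0 (by linarith) (by positivity) hcs
      (hsub.trans hen) hη hwJ

open Classical in
/-- Number of positive elements of `A` up to `n`. -/
noncomputable def cnt (A : Set ℕ) (n : ℕ) : ℕ := #{a ∈ Finset.Ioc 0 n | a ∈ A}

/-- Sums of `h` elements of `A`. -/
def sums (A : Set ℕ) (h : ℕ) : Set ℕ := {x | ∃ f : Fin h → ℕ, (∀ i, f i ∈ A) ∧ ∑ i, f i = x}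

/-- The sumset. -/
def addS (A B : Set ℕ) : Set ℕ := {x | ∃ a ∈ A, ∃ b ∈ B, a + b = x}

lemma cnt_mono {A B : Set ℕ} (h : A ⊆ B) (n : ℕ) : cnt A n ≤ cnt B n := by
  classical
  unfold cnt
  apply Finset.card_le_card
  intro x hx
  rw [Finset.mem_filter] at hx ⊢
  exact ⟨hx.1, h hx.2⟩

lemma sch_ineq (A B : Set ℕ) (hA : 0 ∈ A) (hB : 0 ∈ B) (β : ℝ) (hβ : ∀ n, β * n ≤ cnt B n)
    (n : ℕ) : (cnt A n : ℝ) + β * (n - cnt A n) ≤ cnt (addS A B) n := by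
  classical
  induction n using Nat.strong_induction_on with
  | _ n ih =>
  by_cases hne : ({a ∈ Finset.Ioc 0 n | a ∈ A} : Finset ℕ).Nonempty
  · set P : Finset ℕ := {a ∈ Finset.Ioc 0 n | a ∈ A} with hP
    set a := P.max' hne with ha
    have haP : a ∈ P := Finset.max'_mem _ _
    have haP' := haP
    rw [hP, Finset.mem_filter, Finset.mem_Ioc] at haP'
    obtain ⟨⟨ha0, han⟩, haA⟩ := haP'
    have hc1 : cnt A n = cnt A (a - 1) + 1 := by
      unfold cnt
      have : ({b ∈ Finset.Ioc 0 n | b ∈ A} : Finset ℕ) =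
          insert a {b ∈ Finset.Ioc 0 (a - 1) | b ∈ A} := by
        ext b
        simp only [Finset.mem_insert, Finset.mem_filter, Finset.mem_Ioc]
        constructor
        · rintro ⟨⟨h1, h2⟩, h3⟩
          have hb : b ∈ P := by rw [hP, Finset.mem_filter, Finset.mem_Ioc]; exact ⟨⟨h1, h2⟩, h3⟩
          have := Finset.le_max' P b hb
          rcases eq_or_ne b a with h | h
          · exact Or.inl h
          · exact Or.inr ⟨⟨h1, by omega⟩, h3⟩
        · rintro (rfl | ⟨⟨h1, h2⟩, h3⟩)
          · exact ⟨⟨ha0, han⟩, haA⟩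
          · exact ⟨⟨h1, by omega⟩, h3⟩
      rw [this, Finset.card_insert_of_notMem]
      simp only [Finset.mem_filter, Finset.mem_Ioc]
      omega
    have hc2 : cnt (addS A B) (a - 1) + 1 + cnt B (n - a) ≤ cnt (addS A B) n := by
      unfold cnt
      have hd1 : Disjoint ({b ∈ Finset.Ioc 0 (a - 1) | b ∈ addS A B} : Finset ℕ) {a} := by
        rw [Finset.disjoint_singleton_right]
        simp only [Finset.mem_filter, Finset.mem_Ioc]
        omega
      have hd2 : Disjoint (({b ∈ Finset.Ioc 0 (a - 1) | b ∈ addS A B} : Finset ℕ) ∪ {a})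
          (({b ∈ Finset.Ioc 0 (n - a) | b ∈ B} : Finset ℕ).image (fun b => a + b)) := by
        rw [Finset.disjoint_left]
        intro x hx hx2
        simp only [Finset.mem_union, Finset.mem_filter, Finset.mem_Ioc, Finset.mem_singleton,
          Finset.mem_image] at hx hx2
        obtain ⟨b, ⟨⟨h1, h2⟩, h3⟩, rfl⟩ := hx2
        omega
      have hi : #(({b ∈ Finset.Ioc 0 (n - a) | b ∈ B} : Finset ℕ).image (fun b => a + b)) =
          #{b ∈ Finset.Ioc 0 (n - a) | b ∈ B} :=
        Finset.card_image_of_injective _ (fun x y h => by simpa using h)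
      have e1 := Finset.card_union_of_disjoint hd1
      have e2 := Finset.card_union_of_disjoint hd2
      rw [Finset.card_singleton] at e1
      rw [← hi, ← e1, ← e2]
      apply Finset.card_le_card
      intro x hx
      simp only [Finset.mem_union, Finset.mem_filter, Finset.mem_Ioc, Finset.mem_singleton,
          Finset.mem_image] at hx ⊢
      rcases hx with (⟨⟨h1, h2⟩, h3⟩ | rfl) | ⟨b, ⟨⟨h1, h2⟩, h3⟩, rfl⟩
      · exact ⟨⟨h1, by omega⟩, h3⟩
      · exact ⟨⟨ha0, han⟩, _, haA, 0, hB, rfl⟩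
      · exact ⟨⟨by omega, by omega⟩, a, haA, b, h3, rfl⟩
    have h1 := ih (a - 1) (by omega)
    have h2 := hβ (n - a)
    have hc2' : (cnt (addS A B) (a - 1) : ℝ) + 1 + cnt B (n - a) ≤ cnt (addS A B) n := by
      exact_mod_cast hc2
    rw [hc1]
    rw [Nat.cast_sub han] at h2
    rw [Nat.cast_sub (by omega : 1 ≤ a)] at h1
    push_cast at *
    linarith
  · have h0 : cnt A n = 0 := by
      unfold cnt
      rw [Finset.card_eq_zero]
      exact Finset.not_nonempty_iff_eq_empty.mp hne
    rw [h0]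
    have h1 : cnt B n ≤ cnt (addS A B) n := by
      apply cnt_mono
      intro b hb
      exact ⟨0, hA, b, hb, by simp⟩
    have h1' : (cnt B n : ℝ) ≤ cnt (addS A B) n := by exact_mod_cast h1
    have := hβ n
    push_cast
    linarith

lemma addS_sums (A : Set ℕ) (h k : ℕ) : addS (sums A h) (sums A k) ⊆ sums A (h + k) := by
  rintro x ⟨a, ⟨f, hf, rfl⟩, b, ⟨g, hg, rfl⟩, rfl⟩
  refine ⟨Fin.append f g, ?_, ?_⟩
  · intro i
    refine Fin.addCases ?_ ?_ i
    · intro i; simpa using hf i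
    · intro i; simpa using hg i
  · rw [Fin.sum_univ_add]; simp

lemma sums_one (A : Set ℕ) : A ⊆ sums A 1 := fun a ha => ⟨fun _ => a, fun _ => ha, by simp⟩

lemma sums_zero_mem (A : Set ℕ) (hA : 0 ∈ A) (h : ℕ) : 0 ∈ sums A h :=
  ⟨fun _ => 0, fun _ => hA, by simp⟩

lemma sch_basis (D : Set ℕ) (h0 : 0 ∈ D) (α : ℝ) (hα : 0 < α) (hD : ∀ n, α * n ≤ cnt D n) :
    ∃ k : ℕ, ∀ n : ℕ, n ∈ sums D k := by
  classical
  have hα1 : α ≤ 1 := by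
    have h1 := hD 1
    have h2 : cnt D 1 ≤ 1 := by
      unfold cnt
      exact (Finset.card_filter_le _ _).trans (by simp)
    have h2' : (cnt D 1 : ℝ) ≤ 1 := by exact_mod_cast h2
    push_cast at h1
    linarith
  have hit : ∀ h : ℕ, ∀ n : ℕ, (1 - (1 - α) ^ h) * n ≤ cnt (sums D h) n := by
    intro h
    induction h with
    | zero => intro n; simp
    | succ h ih =>
      intro n
      have h1 := sch_ineq (sums D h) D (sums_zero_mem D h0 h) h0 α hD n
      have h2 : cnt (addS (sums D h) D) n ≤ cnt (sums D (h + 1)) n := by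
        apply cnt_mono
        rintro x ⟨a, ha, b, hb, rfl⟩
        exact addS_sums D h 1 ⟨a, ha, b, sums_one D hb, rfl⟩
      have h2' : (cnt (addS (sums D h) D) n : ℝ) ≤ cnt (sums D (h + 1)) n := by exact_mod_cast h2
      have h3 := mul_le_mul_of_nonneg_left (ih n) (show 0 ≤ 1 - α by linarith)
      rw [pow_succ]
      linarith
  obtain ⟨h, hh⟩ := exists_pow_lt_of_lt_one (show (0 : ℝ) < 1 / 2 by norm_num)
    (show 1 - α < 1 by linarith)
  refine ⟨h + h, ?_⟩
  intro n
  apply addS_sums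
  have hz := sums_zero_mem D h0 h
  by_cases hn : n ∈ sums D h
  · exact ⟨n, hn, 0, hz, by simp⟩
  have hn0 : 0 < n := by
    rcases Nat.eq_zero_or_pos n with h | h
    · rw [h] at hn; exact absurd hz hn
    · exact h
  set P : Finset ℕ := {a ∈ Finset.Ioo 0 n | a ∈ sums D h} with hP
  have hc : cnt (sums D h) n = #P := by
    unfold cnt
    congr 1
    ext a
    simp only [hP, Finset.mem_filter, Finset.mem_Ioc, Finset.mem_Ioo]
    constructor
    · rintro ⟨⟨h1, h2⟩, h3⟩
      refine ⟨⟨h1, lt_of_le_of_ne h2 ?_⟩, h3⟩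
      rintro rfl
      exact hn h3
    · rintro ⟨⟨h1, h2⟩, h3⟩
      exact ⟨⟨h1, h2.le⟩, h3⟩
  have hbig : n < 2 * #P := by
    have h1 := hit h n
    rw [hc] at h1
    have h2 : (0 : ℝ) < n := by exact_mod_cast hn0
    have : (n : ℝ) < 2 * #P := by nlinarith
    exact_mod_cast this
  have hq : #(P.image (fun a => n - a)) = #P := by
    apply Finset.card_image_of_injOn
    intro x hx y hy hxy
    simp only [hP, Finset.coe_filter, Finset.mem_Ioo, Set.mem_ofPred_eq] at hx hy
    simp only at hxy
    omega
  have hnd : ¬ Disjoint P (P.image (fun a => n - a)) := by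
    intro hd
    have h1 := Finset.card_union_of_disjoint hd
    have h2 : P ∪ P.image (fun a => n - a) ⊆ Finset.Ioo 0 n := by
      intro x hx
      simp only [hP, Finset.mem_union, Finset.mem_image, Finset.mem_filter, Finset.mem_Ioo] at hx
      rw [Finset.mem_Ioo]
      rcases hx with h | ⟨a, ⟨⟨h1, h2⟩, h3⟩, rfl⟩
      · exact h.1
      · omega
    have h3 := Finset.card_le_card h2
    rw [h1, hq, Nat.card_Ioo] at h3
    omega
  rw [Finset.not_disjoint_iff] at hnd
  obtain ⟨x, hx1, hx2⟩ := hnd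
  simp only [hP, Finset.mem_image, Finset.mem_filter, Finset.mem_Ioo] at hx1 hx2
  obtain ⟨a, ⟨⟨h1, h2⟩, h3⟩, rfl⟩ := hx2
  exact ⟨n - a, hx1.2, a, h3, by omega⟩

/-- The sequence. -/
noncomputable def nf (c : ℝ) (n : ℕ) : ℕ := ⌊(n : ℝ) ^ c⌋₊

lemma nf_int (c : ℝ) (n : ℕ) : ⌊(n : ℝ) ^ c⌋ = (nf c n : ℤ) := by
  unfold nf
  rw [Int.natCast_floor_eq_floor (by positivity)]

lemma posdens (c : ℝ) (hc : 0 < c) (hci : ¬∃ m : ℤ, c = m) :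
    ∃ t : ℕ, ∃ α : ℝ, 0 < α ∧ ∀ n : ℕ, α * n ≤ cnt (sums (Set.range (nf c)) t ∪ {1}) n := by
  classical
  obtain ⟨t, κ, C, hκ, hC, hev⟩ := density_block c hc hci
  obtain ⟨M₀, hM₀⟩ := Filter.eventually_atTop.mp hev
  set κ' : ℝ := κ * (1 / (2 : ℝ) ^ c / C) with hκ'
  have hκ'0 : 0 < κ' := by positivity
  obtain ⟨N₁, hN₁⟩ := exists_nat_ge (max (C * ((M₀ : ℝ) + 1) ^ c) (max (2 / κ') 1))
  have hN₁1 := (le_max_left _ _).trans hN₁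
  have hN₁2 := ((le_max_left _ _).trans (le_max_right _ _)).trans hN₁
  have hN₁3 := ((le_max_right _ _).trans (le_max_right _ _)).trans hN₁
  have hN₁0 : (0 : ℝ) < N₁ := by linarith
  refine ⟨t, min (κ' / 2) (1 / N₁), by positivity, ?_⟩
  intro n
  rcases Nat.eq_zero_or_pos n with h0 | hn0
  · subst h0; simp
  have hn0' : (0 : ℝ) < n := by exact_mod_cast hn0
  rcases le_total n N₁ with h | h
  · have h1 : 1 ≤ cnt (sums (Set.range (nf c)) t ∪ {1}) n := by
      unfold cnt
      rw [Nat.one_le_iff_ne_zero, Finset.card_ne_zero]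
      exact ⟨1, by simp only [Finset.mem_filter, Finset.mem_Ioc]; exact ⟨⟨by omega, hn0⟩, Or.inr rfl⟩⟩
    have h1' : (1 : ℝ) ≤ cnt (sums (Set.range (nf c)) t ∪ {1}) n := by exact_mod_cast h1
    have h' : (n : ℝ) ≤ N₁ := by exact_mod_cast h
    calc _ ≤ 1 / (N₁ : ℝ) * N₁ := by gcongr; exact min_le_right _ _
      _ = 1 := by field_simp
      _ ≤ _ := h1'
  · have h' : (N₁ : ℝ) ≤ n := by exact_mod_cast h
    set x : ℝ := ((n : ℝ) / C) ^ (1 / c) with hx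
    have hx0 : 0 ≤ x := by positivity
    have hxc : x ^ c = n / C := by
      rw [hx, ← Real.rpow_mul (by positivity), one_div, inv_mul_cancel₀ hc.ne', Real.rpow_one]
    have hxM : (M₀ : ℝ) + 1 ≤ x := by
      by_contra hlt
      have := Real.rpow_lt_rpow hx0 (not_le.mp hlt) hc
      rw [hxc, div_lt_iff₀ hC] at this
      linarith
    set M := ⌊x⌋₊ with hM
    have hMx : (M : ℝ) ≤ x := Nat.floor_le hx0
    have hxM2 : x < M + 1 := Nat.lt_floor_add_one x
    have hMM : M₀ ≤ M := by
      have : (M₀ : ℝ) < M + 1 := by linarith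
      have : M₀ < M + 1 := by exact_mod_cast this
      omega
    have hM1 : (1 : ℝ) ≤ M := by
      have h2 : (1 : ℝ) ≤ x := by have : (0 : ℝ) ≤ M₀ := by positivity
                                  linarith
      have : 1 ≤ M := Nat.le_floor (by simpa using h2)
      exact_mod_cast this
    have hMc : 1 / (2 : ℝ) ^ c / C * n ≤ (M : ℝ) ^ c := by
      have h2 : x / 2 ≤ M := by linarith
      have h3 := Real.rpow_le_rpow (by positivity) h2 hc.le
      rw [Real.div_rpow hx0 (by norm_num), hxc] at h3
      calc _ = (n : ℝ) / C / 2 ^ c := by field_simp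
        _ ≤ _ := h3
    have hMC : C * (M : ℝ) ^ c ≤ n := by
      have h3 := Real.rpow_le_rpow (by positivity) hMx hc.le
      rw [hxc, le_div_iff₀ hC] at h3
      linarith
    obtain ⟨F, hF, hcard⟩ := hM₀ M hMM
    have hcF : #F ≤ cnt (sums (Set.range (nf c)) t ∪ {1}) n + 1 := by
      have h5 : F ⊆ insert 0 (({a ∈ Finset.Ioc 0 n | a ∈ sums (Set.range (nf c)) t ∪ {1}} :
          Finset ℕ).image (fun a : ℕ => (a : ℤ))) := by
        intro z hz
        obtain ⟨z0, z1, m, hm⟩ := hF z hz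
        simp only [Finset.mem_insert, Finset.mem_image, Finset.mem_filter, Finset.mem_Ioc]
        rcases z0.eq_or_lt with h | h
        · exact Or.inl h.symm
        · right
          refine ⟨z.toNat, ⟨⟨by omega, ?_⟩, Or.inl ⟨fun i => nf c (m i), fun i => ⟨_, rfl⟩, ?_⟩⟩,
            by omega⟩
          · have : (z : ℝ) ≤ n := z1.trans hMC
            have : z ≤ n := by exact_mod_cast this
            omega
          · have : ((∑ i, nf c (m i) : ℕ) : ℤ) = z := by
              rw [hm]; push_cast
              exact Finset.sum_congr rfl (fun i _ => (nf_int c (m i)).symm)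
            change ∑ i, nf c (m i) = z.toNat
            omega
      refine (Finset.card_le_card h5).trans ((Finset.card_insert_le _ _).trans ?_)
      have := Finset.card_image_le (s := ({a ∈ Finset.Ioc 0 n | a ∈ sums (Set.range (nf c)) t ∪ {1}} :
          Finset ℕ)) (f := fun a : ℕ => (a : ℤ))
      have hce : cnt (sums (Set.range (nf c)) t ∪ {1}) n =
          #({a ∈ Finset.Ioc 0 n | a ∈ sums (Set.range (nf c)) t ∪ {1}} : Finset ℕ) := by
        unfold cnt
        congr!
      rw [hce]
      omega
    have hcF' : (#F : ℝ) ≤ cnt (sums (Set.range (nf c)) t ∪ {1}) n + 1 := by exact_mod_cast hcF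
    have h6 : κ' * n ≤ κ * (M : ℝ) ^ c := by
      rw [hκ', mul_assoc]
      exact mul_le_mul_of_nonneg_left hMc hκ.le
    have h7 : 2 ≤ κ' * n := by
      rw [div_le_iff₀ hκ'0] at hN₁2
      nlinarith
    have h8 : min (κ' / 2) (1 / (N₁ : ℝ)) * n ≤ κ' / 2 * n := by
      gcongr; exact min_le_left _ _
    linarith

lemma conv (P Q : Set ℕ) (t E : ℕ) (h : ∀ d ∈ P, ∃ x ∈ sums Q t, ∃ e ≤ E, d = x + e) (k : ℕ) :
    ∀ d ∈ sums P k, ∃ x ∈ sums Q (k * t), ∃ e ≤ k * E, d = x + e := by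
  induction k with
  | zero =>
    rintro d ⟨f, _, rfl⟩
    exact ⟨0, ⟨fun _ => 0, fun i => absurd i.2 (by simp), by simp⟩, 0, by simp, by simp⟩
  | succ k ih =>
    rintro d ⟨f, hf, rfl⟩
    obtain ⟨x, hx, e, he, h1⟩ := ih _ ⟨fun i => f i.castSucc, fun i => hf _, rfl⟩
    obtain ⟨y, hy, e', he', h2⟩ := h _ (hf (Fin.last k))
    refine ⟨x + y, ?_, e + e', ?_, ?_⟩
    · have := addS_sums Q (k * t) t ⟨x, hx, y, hy, rfl⟩
      rwa [Nat.succ_mul]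
    · rw [Nat.succ_mul]; omega
    · rw [Fin.sum_univ_castSucc, h1, h2]; ring

lemma sums_mul (Q : Set ℕ) (p u : ℕ) (hu : u ∈ sums Q p) (k : ℕ) : k * u ∈ sums Q (k * p) := by
  induction k with
  | zero => exact ⟨fun _ => 0, fun i => absurd i.2 (by simp), by simp⟩
  | succ k ih =>
    have := addS_sums Q (k * p) p ⟨_, ih, _, hu, rfl⟩
    rwa [Nat.succ_mul, Nat.succ_mul]

lemma sums_mono (Q : Set ℕ) (h0 : 0 ∈ Q) {h k : ℕ} (hk : h ≤ k) : sums Q h ⊆ sums Q k := by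
  intro x hx
  have := addS_sums Q h (k - h) ⟨x, hx, 0, sums_zero_mem Q h0 _, rfl⟩
  rwa [add_zero, Nat.add_sub_cancel' hk] at this

lemma no_div (c : ℝ) (hc : 0 < c) (hci : ¬∃ m : ℤ, c = m) (d : ℕ)
    (hd : ∀ n : ℕ, 1 ≤ n → (d : ℤ) ∣ ⌊(n : ℝ) ^ c⌋ - 1) : d = 1 := by
  by_contra hd1
  rcases Nat.eq_zero_or_pos d with h0 | hpos
  · subst h0
    have h2 := hd (⌈(2 : ℝ) ^ (1 / c)⌉₊ + 1) (by omega)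
    rw [Nat.cast_zero, zero_dvd_iff, sub_eq_zero, Int.floor_eq_iff] at h2
    have h3 : (2 : ℝ) ≤ ((⌈(2 : ℝ) ^ (1 / c)⌉₊ + 1 : ℕ) : ℝ) ^ c := by
      calc (2 : ℝ) = ((2 : ℝ) ^ (1 / c)) ^ c := by
            rw [← Real.rpow_mul (by norm_num), one_div, inv_mul_cancel₀ hc.ne', Real.rpow_one]
        _ ≤ _ := by
          apply Real.rpow_le_rpow (by positivity) _ hc.le
          push_cast
          linarith [Nat.le_ceil ((2 : ℝ) ^ (1 / c))]
    have := h2.2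
    push_cast at this h3
    linarith
  have hd2 : 2 ≤ d := by omega
  have hd2' : (2 : ℝ) ≤ d := by exact_mod_cast hd2
  have hd0 : (0 : ℝ) < d := by linarith
  have hpi := Real.pi_pos
  set α : ℝ := 2 * Real.pi / d with hα
  have hα0 : 0 < α := by positivity
  have hαpi : α ≤ Real.pi := by
    rw [hα, div_le_iff₀ hd0]; nlinarith
  set φ : ℝ := Real.pi / 2 - α with hφ
  obtain ⟨δ, σ, hδ, hσ, hweyl⟩ := weyl_main c hc hci
  obtain ⟨M, ⟨H, hH1, -, hW⟩, hMα, hMσ, hM1⟩ := (hweyl.and ((ev_rpow (1 / α) 0 δ hδ).and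
    ((ev_rpow 4 0 σ hσ).and (Filter.eventually_ge_atTop 1)))).exists
  have hM0 : (0 : ℝ) < M := by exact_mod_cast hM1
  rw [Real.rpow_zero, mul_one] at hMα hMσ
  have hδα : (M : ℝ) ^ (-δ) ≤ α := by
    rw [Real.rpow_neg hM0.le, inv_le_comm₀ (by positivity) hα0, ← one_div]
    exact hMα
  have hσ4 : (M : ℝ) ^ (-σ) ≤ 1 / 4 := by
    rw [Real.rpow_neg hM0.le, inv_le_comm₀ (by positivity) (by norm_num)]
    norm_num
    exact hMσ
  have hpi4 := Real.pi_lt_d2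
  have hHpos : (0 : ℝ) < H := by exact_mod_cast hH1
  have hcos : ∀ (β ψ : ℝ), (M : ℝ) ^ (-δ) ≤ |β| → |β| ≤ 10 →
      -(H / 4 : ℝ) ≤ ∑ h ∈ range H, Real.cos (β * ((M + h : ℕ) : ℝ) ^ c + ψ) := by
    intro β ψ h1 h2
    have h3 := hW β h1 h2
    have h4 : ∑ h ∈ range H, Real.cos (β * ((M + h : ℕ) : ℝ) ^ c + ψ) =
        ((∑ h ∈ range H, ee (β * ((M + h : ℕ) : ℝ) ^ c)) * ee ψ).re := by
      rw [Finset.sum_mul, Complex.re_sum]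
      apply Finset.sum_congr rfl
      intro h _
      rw [← ee_add, ee_re]
    rw [h4]
    have h5 := Complex.abs_re_le_norm ((∑ h ∈ range H, ee (β * ((M + h : ℕ) : ℝ) ^ c)) * ee ψ)
    rw [norm_mul, ee_norm, mul_one] at h5
    have h6 := neg_abs_le ((∑ h ∈ range H, ee (β * ((M + h : ℕ) : ℝ) ^ c)) * ee ψ).re
    nlinarith
  have hs1 := hcos α φ (by rw [abs_of_pos hα0]; exact hδα) (by rw [abs_of_pos hα0]; linarith)
  have hs2 := hcos (2 * α) (2 * φ) (by rw [abs_of_pos (by positivity)]; linarith)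
    (by rw [abs_of_pos (by positivity)]; linarith)
  have hneg : ∑ h ∈ range H, (1 / 2 + Real.cos (α * ((M + h : ℕ) : ℝ) ^ c + φ) +
      1 / 2 * Real.cos (2 * α * ((M + h : ℕ) : ℝ) ^ c + 2 * φ)) ≤ 0 := by
    apply Finset.sum_nonpos
    intro h _
    obtain ⟨k, hk⟩ := hd (M + h) (by omega)
    set y : ℝ := ((M + h : ℕ) : ℝ) ^ c with hy
    have hfl : (⌊y⌋ : ℝ) = d * k + 1 := by
      have : ⌊y⌋ = d * k + 1 := by linarith
      rw [this]; push_cast; ring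
    have f1 := Int.floor_le y
    have f2 := Int.lt_floor_add_one y
    rw [hfl] at f1 f2
    have hαd : α * d = 2 * Real.pi := by rw [hα]; field_simp
    set θ : ℝ := α * y + φ with hθ
    have e1 : Real.cos θ = Real.cos (θ - k * (2 * Real.pi)) := by
      rw [Real.cos_sub_int_mul_two_pi]
    have e2 : θ - k * (2 * Real.pi) = Real.pi / 2 + α * (y - d * k - 1) := by
      rw [hθ, hφ, ← hαd]; ring
    have hc1 : Real.cos θ ≤ 0 := by
      rw [e1, e2]
      apply Real.cos_nonpos_of_pi_div_two_le_of_le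
      · have : 0 ≤ α * (y - d * k - 1) := mul_nonneg hα0.le (by linarith)
        linarith
      · have : α * (y - d * k - 1) ≤ α * 1 := mul_le_mul_of_nonneg_left (by linarith) hα0.le
        linarith
    have e3 : 2 * α * y + 2 * φ = 2 * θ := by rw [hθ]; ring
    rw [e3, Real.cos_two_mul]
    have := Real.neg_one_le_cos θ
    nlinarith
  rw [Finset.sum_add_distrib, Finset.sum_add_distrib, ← Finset.mul_sum, Finset.sum_const,
    Finset.card_range, nsmul_eq_mul] at hneg
  linarith

lemma gadget (c : ℝ) (hc : 0 < c) (hci : ¬∃ m : ℤ, c = m) (A : Set ℕ)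
    (hA : A = {x | ∃ n : ℕ, 1 ≤ n ∧ x + 1 = nf c n}) (h0 : 0 ∈ A)
    (hnf : ∀ n : ℕ, 1 ≤ n → 1 ≤ nf c n) :
    ∃ p q u v : ℕ, u ∈ sums A p ∧ v ∈ sums A q ∧ u = v + 1 := by
  set G : AddSubgroup ℤ := AddSubgroup.closure ((fun a : ℕ => (a : ℤ)) '' A) with hG
  have hrep : ∀ g ∈ G, ∃ p q u v : ℕ, u ∈ sums A p ∧ v ∈ sums A q ∧ (g : ℤ) = u - v := by
    intro g hg
    induction hg using AddSubgroup.closure_induction with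
    | mem x hx =>
      obtain ⟨a, ha, rfl⟩ := hx
      exact ⟨1, 0, a, 0, sums_one A ha, sums_zero_mem A h0 0, by simp⟩
    | zero => exact ⟨0, 0, 0, 0, sums_zero_mem A h0 0, sums_zero_mem A h0 0, by simp⟩
    | add x y _ _ hx hy =>
      obtain ⟨p, q, u, v, h1, h2, rfl⟩ := hx
      obtain ⟨p', q', u', v', h1', h2', rfl⟩ := hy
      exact ⟨p + p', q + q', u + u', v + v', addS_sums A _ _ ⟨_, h1, _, h1', rfl⟩,
        addS_sums A _ _ ⟨_, h2, _, h2', rfl⟩, by push_cast; ring⟩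
    | neg x _ hx =>
      obtain ⟨p, q, u, v, h1, h2, rfl⟩ := hx
      exact ⟨q, p, v, u, h2, h1, by ring⟩
  obtain ⟨d, hd⟩ := Int.subgroup_cyclic G
  have hdv : ∀ n : ℕ, 1 ≤ n → ((d.natAbs : ℕ) : ℤ) ∣ ⌊(n : ℝ) ^ c⌋ - 1 := by
    intro n hn
    have hm : ((nf c n - 1 : ℕ) : ℤ) ∈ G := by
      apply AddSubgroup.subset_closure
      refine ⟨_, ?_, rfl⟩
      rw [hA]
      exact ⟨n, hn, by have := hnf n hn; omega⟩
    rw [hd, AddSubgroup.mem_closure_singleton] at hm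
    obtain ⟨k, hk⟩ := hm
    rw [Int.natAbs_dvd, nf_int]
    refine ⟨k, ?_⟩
    have := hnf n hn
    rw [smul_eq_mul] at hk
    rw [mul_comm, hk]
    omega
  have h1 := no_div c hc hci _ hdv
  have hone : (1 : ℤ) ∈ G := by
    rw [hd, AddSubgroup.mem_closure_singleton]
    rcases Int.natAbs_eq d with h | h <;> rw [h1] at h
    · exact ⟨1, by rw [h]; simp⟩
    · exact ⟨-1, by rw [h]; simp⟩
  obtain ⟨p, q, u, v, hu, hv, h⟩ := hrep 1 hone
  exact ⟨p, q, u, v, hu, hv, by omega⟩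

/-- Segal's theorem: for a positive non-integer real `c`, the sequence
`(⌊n^c⌋)` is an asymptotic basis. -/
theorem stmt_11 (c : ℝ) (hc : 0 < c) (hci : ¬∃ m : ℤ, c = m) :
    ∃ s : ℕ, ∃ N₀ : ℤ, ∀ N : ℤ, N₀ ≤ N →
      ∃ n : Fin s → ℕ, (∀ i, 0 < n i) ∧ ∑ i, ⌊(n i : ℝ) ^ c⌋ = N := by
  obtain ⟨t, α, hα, hdens⟩ := posdens c hc hci
  have hz : nf c 0 = 0 := by simp [nf, Real.zero_rpow hc.ne']
  have hz1 : nf c 1 = 1 := by simp [nf]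
  have hnf : ∀ n : ℕ, 1 ≤ n → 1 ≤ nf c n := by
    intro n hn
    apply Nat.le_floor
    rw [Nat.cast_one]
    exact Real.one_le_rpow (by exact_mod_cast hn) hc.le
  have hD0 : 0 ∈ sums (Set.range (nf c)) t ∪ {1} := 
    Or.inl (sums_zero_mem (Set.range (nf c)) (Set.mem_range.mpr ⟨0, hz⟩) t)
  obtain ⟨k, hk⟩ := sch_basis _ hD0 α hα hdens
  set A : Set ℕ := {x | ∃ n : ℕ, 1 ≤ n ∧ x + 1 = nf c n} with hA
  have hA0 : 0 ∈ A := ⟨1, le_rfl, by rw [hz1]⟩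
  obtain ⟨p, q, u, v, hu, hv, huv⟩ := gadget c hc hci A hA hA0 hnf
  have c1 : ∀ d ∈ Set.range (nf c), ∃ x ∈ sums A 1, ∃ e ≤ 1, d = x + e := by
    rintro d ⟨n, rfl⟩
    rcases Nat.eq_zero_or_pos n with h | h
    · subst h
      exact ⟨0, sums_zero_mem A hA0 1, 0, by simp, by rw [hz]⟩
    · have := hnf n h
      exact ⟨nf c n - 1, sums_one A ⟨n, h, by omega⟩, 1, le_rfl, by omega⟩
  have c2 : ∀ d ∈ sums (Set.range (nf c)) t ∪ {1}, ∃ x ∈ sums A t, ∃ e ≤ t + 1, d = x + e := by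
    rintro d (h | h)
    · obtain ⟨x, hx, e, he, h2⟩ := conv _ _ _ _ c1 t d h
      rw [mul_one] at hx he
      exact ⟨x, hx, e, by omega, h2⟩
    · have h' : d = 1 := h
      exact ⟨0, sums_zero_mem A hA0 t, 1, by omega, by omega⟩
  have c3 := conv _ _ _ _ c2 k
  set E := k * (t + 1) with hE
  set T := k * t + (E * p + E * q) with hT
  refine ⟨T, E * v + T, ?_⟩
  intro N hN
  obtain ⟨x, hx, e, he, hxe⟩ := c3 (N - (E * v + T)).toNat (hk _)
  have hmem : x + (e * u + (E - e) * v) ∈ sums A T := by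
    have h1 : e * u ∈ sums A (E * p) :=
      sums_mono A hA0 (Nat.mul_le_mul_right p he) (sums_mul A p u hu e)
    have h2 : (E - e) * v ∈ sums A (E * q) :=
      sums_mono A hA0 (Nat.mul_le_mul_right q (Nat.sub_le E e)) (sums_mul A q v hv (E - e))
    exact addS_sums A _ _ ⟨x, hx, _, addS_sums A _ _ ⟨_, h1, _, h2, rfl⟩, rfl⟩
  obtain ⟨f, hf, hsum⟩ := hmem
  choose n hn1 hn2 using hf
  refine ⟨n, fun i => hn1 i, ?_⟩
  have h3 : ∑ i, ⌊(n i : ℝ) ^ c⌋ = ((∑ i, f i : ℕ) : ℤ) + T := by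
    push_cast
    have : (T : ℤ) = ∑ i : Fin T, 1 := by simp
    rw [this, ← Finset.sum_add_distrib]
    apply Finset.sum_congr rfl
    intro i _
    rw [nf_int, ← hn2 i]
    push_cast; ring
  have h4 : x + (e * u + (E - e) * v) = x + e + E * v := by
    obtain ⟨w, hw⟩ := Nat.exists_eq_add_of_le he
    rw [hw, huv, Nat.add_sub_cancel_left]; ring
  rw [h3, hsum, h4, ← hxe]
  push_cast
  omega
end
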